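/- Let d ≥ 2, α ∈ ℝ∖{0}, (β, γ) ∈ ℝ²∖{(0,0)}, and let (p, r) and (p̃′, r̃′) be admissible pairs (where p̃′, r̃′ denote the Hölder conjugates of p̃, r̃). Then for every F ∈ L^{r̃}(ℝ, L^{p̃}(ℝ^d)) the inhomogeneous Strichartz estimate ‖∫₀ᵗ W(t−τ) F(τ, ·) dτ‖_{L^r_t L^p_x} ≲ ‖F‖_{L^{r̃}_t L^{p̃}_x} holds, with implicit constant independent of F. -/

import Mathlib

open MeasureTheory Filter
open scoped ENNReal FourierTransform

noncomputable section

/-- Euclidean space `ℝ^d`. -/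
abbrev Sp (d : ℕ) : Type := EuclideanSpace ℝ (Fin d)

/-- A smooth partition of unity `(σ_k)_{k ∈ ℤ^d}` adapted to the unit cubes
`Q_k = k + (-1/2, 1/2]^d`:  each `σ_k` is smooth, supported in `B_{√d}(k)`,
uniformly bounded below on `Q_k`, and the family sums to `1`. -/
structure BoxPartition (d : ℕ) where
  σ : (Fin d → ℤ) → Sp d → ℂ
  smooth : ∀ k, ContDiff ℝ (⊤ : ℕ∞) (σ k)
  support_subset : ∀ k, Function.support (σ k) ⊆
    Metric.ball ((EuclideanSpace.equiv (Fin d) ℝ).symm (fun i => (k i : ℝ))) (Real.sqrt d)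
  lower_bound : ∃ C : ℝ, 0 < C ∧ ∀ k ξ,
    (∀ i, (EuclideanSpace.equiv (Fin d) ℝ) ξ i - (k i : ℝ) ∈ Set.Ioc (-(1/2) : ℝ) (1/2)) →
    C ≤ ‖σ k ξ‖
  partition : ∀ ξ, HasSum (fun k => σ k ξ) 1

/-- The isometric decomposition (box) operator `□_k = 𝓕⁻¹ σ_k 𝓕`, realized as
convolution with the inverse Fourier transform of `σ_k`. -/
def boxOp {d : ℕ} (P : BoxPartition d) (k : Fin d → ℤ) (f : Sp d → ℂ) : Sp d → ℂ :=
  fun x => ∫ y, 𝓕⁻ (P.σ k) (x - y) * f y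

/-- The Japanese bracket `⟨k⟩^s = (1 + |k|²)^{s/2}` as an extended nonnegative real. -/
def jbr {d : ℕ} (k : Fin d → ℤ) (s : ℝ) : ℝ≥0∞ :=
  ENNReal.ofReal ((1 + ∑ i, ((k i : ℝ))^2) ^ (s/2))

/-- The `ℓ^q` norm of a family of extended nonnegative reals. -/
def lqNorm {ι : Type*} (q : ℝ≥0∞) (a : ι → ℝ≥0∞) : ℝ≥0∞ :=
  if q = ∞ then ⨆ k, a k else (∑' k, a k ^ q.toReal) ^ (1 / q.toReal)

/-- The `L^r(ℝ)` norm (with respect to Lebesgue measure in time) of an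
`ℝ≥0∞`-valued function. -/
def timeNorm (r : ℝ≥0∞) (g : ℝ → ℝ≥0∞) : ℝ≥0∞ :=
  if r = ∞ then essSup g volume else (∫⁻ t, g t ^ r.toReal) ^ (1 / r.toReal)

/-- The modulation space norm `‖f‖_{M^s_{p,q}} = ‖(⟨k⟩^s ‖□_k f‖_{L^p})_k‖_{ℓ^q}`. -/
def modNorm {d : ℕ} (P : BoxPartition d) (s : ℝ) (p q : ℝ≥0∞) (f : Sp d → ℂ) : ℝ≥0∞ :=
  lqNorm q (fun k => jbr k s * eLpNorm (boxOp P k f) p volume)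

/-- The Planchon-type space norm
`‖u‖_{l^{s,q}_□(L^r L^p)} = ‖(⟨k⟩^s ‖□_k u‖_{L^r_t L^p_x})_k‖_{ℓ^q}`
(box operators act in the space variable only). -/
def planchonNorm {d : ℕ} (P : BoxPartition d) (s : ℝ) (q r p : ℝ≥0∞)
    (u : ℝ → Sp d → ℂ) : ℝ≥0∞ :=
  lqNorm q (fun k => jbr k s * timeNorm r (fun t => eLpNorm (boxOp P k (u t)) p volume))

/-- The norm of `X = l^{s,q}_□(L^∞ L²) ∩ l^{s,q}_□(L^r L^p)`. -/
def XNorm {d : ℕ} (P : BoxPartition d) (s : ℝ) (q r p : ℝ≥0∞) (u : ℝ → Sp d → ℂ) : ℝ≥0∞ :=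
  planchonNorm P s q ∞ 2 u + planchonNorm P s q r p u

/-- Membership in `X = l^{s,q}_□(L^∞ L²) ∩ l^{s,q}_□(L^r L^p)`. -/
def InX {d : ℕ} (P : BoxPartition d) (s : ℝ) (q r p : ℝ≥0∞) (u : ℝ → Sp d → ℂ) : Prop :=
  planchonNorm P s q ∞ 2 u < ∞ ∧ planchonNorm P s q r p u < ∞

/-- The first coordinate `x₁` of a point of `ℝ^d`. -/
def firstCoord {d : ℕ} (ξ : Sp d) : ℝ :=
  if h : 0 < d then (EuclideanSpace.equiv (Fin d) ℝ) ξ ⟨0, h⟩ else 0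

/-- The dispersion relation `α|ξ|² + βξ₁³ + γξ₁⁴`. -/
def dispersion {d : ℕ} (α β γ : ℝ) (ξ : Sp d) : ℝ :=
  α * ‖ξ‖ ^ 2 + β * (firstCoord ξ) ^ 3 + γ * (firstCoord ξ) ^ 4

/-- The free Schrödinger propagator with higher-order anisotropic dispersion,
`W(t) = 𝓕⁻¹ e^{i(α|ξ|² + βξ₁³ + γξ₁⁴)t} 𝓕`. -/
def propagator {d : ℕ} (α β γ : ℝ) (t : ℝ) (f : Sp d → ℂ) : Sp d → ℂ :=
  𝓕⁻ (fun ξ => Complex.exp (Complex.I * ((dispersion α β γ ξ * t : ℝ) : ℂ)) * 𝓕 f ξ)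

/-- The Duhamel integral `∫₀ᵗ W(t-τ) F(τ) dτ`. -/
def duhamel {d : ℕ} (α β γ : ℝ) (F : ℝ → Sp d → ℂ) : ℝ → Sp d → ℂ :=
  fun t x => ∫ τ in (0:ℝ)..t, propagator α β γ (t - τ) (F τ) x

/-- The Duhamel integral from `-∞`: `∫_{-∞}^t W(t-τ) F(τ) dτ`. -/
def duhamelFrom {d : ℕ} (α β γ : ℝ) (F : ℝ → Sp d → ℂ) : ℝ → Sp d → ℂ :=
  fun t x => ∫ τ in Set.Iic t, propagator α β γ (t - τ) (F τ) x

/-- A power-like nonlinearity `π^{m+1}(z)`: a fixed product of `m+1` factors,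
each equal to `z` or its complex conjugate, together with a sign `c ∈ {1, -1}`. -/
def powerNonlin (m : ℕ) (c : ℂ) (ε : Fin (m + 1) → Bool) (z : ℂ) : ℂ :=
  c * ∏ j, (if ε j then (starRingEnd ℂ) z else z)

/-- The exponential nonlinearity `f(z) = λ(e^{ρ|z|²} - 1)z`. -/
def expNonlin (lam : ℂ) (ρ : ℝ) (z : ℂ) : ℂ :=
  lam * (Complex.exp (((ρ * ‖z‖ ^ 2 : ℝ) : ℂ)) - 1) * z

/-- `c_γ = 2` if `γ ≠ 0` and `c_γ = 3` if `γ = 0`. -/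
def cgam (γ : ℝ) : ℝ := if γ ≠ 0 then 2 else 3

/-- The effective dimension `d - 1/c_γ`. -/
def dEff (d : ℕ) (γ : ℝ) : ℝ := (d : ℝ) - (cgam γ)⁻¹

/-- The minimal power `m₀ = ⌈4/(d - 1/c_γ)⌉`. -/
def mMin (d : ℕ) (γ : ℝ) : ℤ := ⌈4 / dEff d γ⌉

/-- The interval `I_{m,d} = [1/(2(m+1)), 1/(m₀+1)]` of admissible `1/r`. -/
def Iset (m d : ℕ) (γ : ℝ) : Set ℝ :=
  Set.Icc (1 / (2 * ((m : ℝ) + 1))) (1 / ((mMin d γ : ℝ) + 1))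

/-- The effective nonlinearity `l = min(⌊r⌋ - 1, m)`. -/
def leff (r : ℝ) (m : ℕ) : ℤ := min (⌊r⌋ - 1) (m : ℤ)

/-- The lower endpoint of `J_{r,d}`. -/
def Jlo (r : ℝ) (m d : ℕ) (γ : ℝ) : ℝ :=
  1 / 2 - 2 / (r * dEff d γ) -
    (1 / (2 * ((leff r m : ℝ) + 1))) * ((leff r m : ℝ) - 4 / dEff d γ)

/-- The upper endpoint of `J_{r,d}`. -/
def Jhi (r : ℝ) (d : ℕ) (γ : ℝ) : ℝ := 1 / 2 - 2 / (r * dEff d γ)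

/-- The interval `J_{r,d}` of admissible `1/p`. -/
def Jset (r : ℝ) (m d : ℕ) (γ : ℝ) : Set ℝ := Set.Icc (Jlo r m d γ) (Jhi r d γ)

/-- A pair `(p, r) ∈ [2,∞] × [2,∞]` is admissible if
`2/r + (d - 1/c_γ)/p = (d - 1/c_γ)/2`. -/
def Admissible (d : ℕ) (γ : ℝ) (p r : ℝ≥0∞) : Prop :=
  2 ≤ p ∧ 2 ≤ r ∧ 2 * (r⁻¹).toReal + dEff d γ * (p⁻¹).toReal = dEff d γ * (1 / 2)

/-- The regularity condition on `s`: `s ≥ 0` if `q = 1` and `s > d(1 - 1/q) = d/q'`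
if `q > 1`. -/
def sCond (d : ℕ) (q : ℝ≥0∞) (s : ℝ) : Prop :=
  (q = 1 ∧ 0 ≤ s) ∨ (1 < q ∧ (d : ℝ) * (1 - (q⁻¹).toReal) < s)

/-- `u` is a global mild solution of the higher-order NLS with nonlinearity `f`
and initial datum `u₀`: `u(t) = W(t)u₀ + ∫₀ᵗ W(t-τ) f(u(τ)) dτ`. -/
def IsMildSolution {d : ℕ} (α β γ : ℝ) (f : ℂ → ℂ) (u₀ : Sp d → ℂ)
    (u : ℝ → Sp d → ℂ) : Prop :=
  ∀ t x, u t x = propagator α β γ t u₀ x + duhamel α β γ (fun τ y => f (u τ y)) t x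

/-- `u` solves the final-state (scattering) equation with datum `u₀⁻` at `-∞`:
`u(t) = W(t)u₀⁻ + ∫_{-∞}^t W(t-τ) f(u(τ)) dτ`. -/
def IsMildSolutionFrom {d : ℕ} (α β γ : ℝ) (f : ℂ → ℂ) (u₀ : Sp d → ℂ)
    (u : ℝ → Sp d → ℂ) : Prop :=
  ∀ t x, u t x = propagator α β γ t u₀ x + duhamelFrom α β γ (fun τ y => f (u τ y)) t x

end

namespace Strichartz

open Polynomial in
/-- First-derivative van der Corput bound for a polynomial phase with monotone derivative. -/
theorem vdc_first (P : ℝ[X]) {a b μ : ℝ} (hab : a ≤ b) (hμ : 0 < μ)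
    (h1 : ∀ x ∈ Set.Icc a b, μ ≤ |P.derivative.eval x|)
    (h2 : ∀ x ∈ Set.Icc a b, 0 ≤ P.derivative.derivative.eval x) :
    ‖∫ x in a..b, Complex.exp (Complex.I * ((P.eval x : ℝ) : ℂ))‖ ≤ 4 / μ := by
  set q : ℝ → ℝ := fun x => P.derivative.eval x with hq
  set q' : ℝ → ℝ := fun x => P.derivative.derivative.eval x with hq'
  set e : ℝ → ℂ := fun x => Complex.exp (Complex.I * ((P.eval x : ℝ) : ℂ)) with he
  have hne : ∀ x ∈ Set.Icc a b, q x ≠ 0 := fun x hx h0 => by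
    have := h1 x hx
    simp only [hq] at h0
    rw [h0, abs_zero] at this
    linarith
  have hcq : Continuous q := P.derivative.continuous
  have hcq' : Continuous q' := P.derivative.derivative.continuous
  have hce : Continuous e := by
    have : Continuous fun x : ℝ => P.eval x := P.continuous
    fun_prop
  have hnorm : ∀ x, ‖e x‖ = 1 := fun x => by
    simp only [he]
    rw [mul_comm, Complex.norm_exp_ofReal_mul_I]
  have hu : Set.uIcc a b = Set.Icc a b := Set.uIcc_of_le hab
  have hde : ∀ x, HasDerivAt e (e x * (Complex.I * (q x : ℂ))) x := fun x => by
    have h := (P.hasDerivAt x).ofReal_comp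
    exact (h.const_mul Complex.I).cexp
  have hdq : ∀ x, HasDerivAt q (q' x) x := fun x => P.derivative.hasDerivAt x
  have hF : ∀ x ∈ Set.uIcc a b, HasDerivAt (fun x => e x * (-Complex.I * ((q x)⁻¹ : ℝ)))
      (e x + e x * (-Complex.I * ((-(q' x) / (q x) ^ 2 : ℝ) : ℂ))) x := fun x hx => by
    rw [hu] at hx
    have h := (hde x).mul ((((hdq x).inv (hne x hx)).ofReal_comp).const_mul (-Complex.I))
    refine h.congr_deriv ?_
    have h0 : (q x : ℂ) ≠ 0 := by exact_mod_cast hne x hx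
    have h3 : e x * (Complex.I * (q x : ℂ)) * (-Complex.I * ((q⁻¹ x : ℝ) : ℂ)) = e x := by
      rw [Pi.inv_apply, Complex.ofReal_inv]
      field_simp
      linear_combination (-(e x)) * Complex.I_sq
    rw [h3]
  have hcont : ContinuousOn (fun x => -(q' x) / (q x) ^ 2) (Set.uIcc a b) := by
    rw [hu]
    exact hcq'.continuousOn.neg.div (hcq.continuousOn.pow 2) fun x hx => pow_ne_zero 2 (hne x hx)
  have hcont2 : ContinuousOn (fun x => e x * (-Complex.I * ((-(q' x) / (q x) ^ 2 : ℝ) : ℂ)))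
      (Set.uIcc a b) :=
    hce.continuousOn.mul (continuousOn_const.mul
      (Complex.continuous_ofReal.comp_continuousOn hcont))
  have hint := intervalIntegral.integral_eq_sub_of_hasDerivAt hF
    ((hce.continuousOn.add hcont2).intervalIntegrable)
  rw [intervalIntegral.integral_add (hce.intervalIntegrable _ _) hcont2.intervalIntegrable] at hint
  have hqi : ∀ x ∈ Set.Icc a b, |(q x)⁻¹| ≤ 1 / μ := fun x hx => by
    rw [abs_inv, inv_eq_one_div]
    exact one_div_le_one_div_of_le hμ (h1 x hx)
  have hbd : ∀ x ∈ Set.Icc a b, ‖e x * (-Complex.I * ((q x)⁻¹ : ℝ))‖ ≤ 1 / μ := fun x hx => by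
    rw [norm_mul, hnorm, norm_mul, Complex.norm_real]
    simpa using hqi x hx
  have hI2 : ‖∫ x in a..b, e x * (-Complex.I * ((-(q' x) / (q x) ^ 2 : ℝ) : ℂ))‖ ≤ 2 / μ := by
    calc _ ≤ ∫ x in a..b, ‖e x * (-Complex.I * ((-(q' x) / (q x) ^ 2 : ℝ) : ℂ))‖ :=
          intervalIntegral.norm_integral_le_integral_norm hab
      _ = ∫ x in a..b, -(-(q' x) / (q x) ^ 2) := by
          apply intervalIntegral.integral_congr
          intro x hx
          rw [hu] at hx
          have h0 := h2 x hx
          simp only [norm_mul, hnorm, Complex.norm_real, norm_neg, Complex.norm_I, one_mul,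
            Real.norm_eq_abs]
          rw [abs_div, abs_neg, abs_of_nonneg h0, abs_of_nonneg (sq_nonneg _)]
          ring
      _ = -((q b)⁻¹ - (q a)⁻¹) := by
          rw [intervalIntegral.integral_neg, intervalIntegral.integral_eq_sub_of_hasDerivAt
            (f := fun x => (q x)⁻¹) (fun x hx => (hdq x).inv (hne x (hu ▸ hx)))
            hcont.intervalIntegrable]
      _ ≤ 2 / μ := by
          have ha := abs_le.1 (hqi a (Set.left_mem_Icc.2 hab))
          have hb := abs_le.1 (hqi b (Set.right_mem_Icc.2 hab))
          have : 2 / μ = 1 / μ + 1 / μ := by ring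
          linarith [ha.2, hb.1]
  have hfin : ∫ x in a..b, e x = (e b * (-Complex.I * ((q b)⁻¹ : ℝ)) -
      e a * (-Complex.I * ((q a)⁻¹ : ℝ))) -
      ∫ x in a..b, e x * (-Complex.I * ((-(q' x) / (q x) ^ 2 : ℝ) : ℂ)) := by
    rw [← hint]; ring
  rw [hfin]
  have ha := hbd a (Set.left_mem_Icc.2 hab)
  have hb := hbd b (Set.right_mem_Icc.2 hab)
  have h3 : 4 / μ = 1 / μ + 1 / μ + 2 / μ := by ring
  rw [h3]
  exact (norm_sub_le _ _).trans (add_le_add ((norm_sub_le _ _).trans (add_le_add hb ha)) hI2)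

/-- Splitting off a neighbourhood of the critical point of a strongly increasing function. -/
theorem vdc_split {f : ℝ → ℂ} (hf : Continuous f) (hf1 : ∀ x, ‖f x‖ ≤ 1) {g : ℝ → ℝ}
    (hg : Continuous g) {a b lam δ B : ℝ} (hab : a ≤ b) (hlam : 0 < lam) (hδ : 0 < δ)
    (hmono : ∀ x ∈ Set.Icc a b, ∀ y ∈ Set.Icc a b, x ≤ y → lam * (y - x) ≤ g y - g x)
    (hB : 0 ≤ B)
    (hpos : ∀ a' b', a ≤ a' → a' ≤ b' → b' ≤ b → (∀ x ∈ Set.Icc a' b', lam * δ ≤ g x) →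
      ‖∫ x in a'..b', f x‖ ≤ B)
    (hneg : ∀ a' b', a ≤ a' → a' ≤ b' → b' ≤ b → (∀ x ∈ Set.Icc a' b', g x ≤ -(lam * δ)) →
      ‖∫ x in a'..b', f x‖ ≤ B) :
    ‖∫ x in a..b, f x‖ ≤ 2 * B + 2 * δ := by
  have haI : a ∈ Set.Icc a b := Set.left_mem_Icc.2 hab
  have hbI : b ∈ Set.Icc a b := Set.right_mem_Icc.2 hab
  obtain ⟨c, hc, hcr, hcl⟩ : ∃ c ∈ Set.Icc a b, (∀ x ∈ Set.Icc a b, c < x → lam * (x - c) ≤ g x) ∧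
      (∀ x ∈ Set.Icc a b, x < c → g x ≤ -(lam * (c - x))) := by
    by_cases ha : 0 ≤ g a
    · refine ⟨a, haI, fun x hx h => ?_, fun x hx h => absurd hx.1 (not_le.2 h)⟩
      have := hmono a haI x hx h.le
      linarith
    by_cases hb : g b ≤ 0
    · refine ⟨b, hbI, fun x hx h => absurd hx.2 (not_le.2 h), fun x hx h => ?_⟩
      have := hmono x hx b hbI h.le
      linarith
    push Not at ha hb
    obtain ⟨c, hc, hc0⟩ := intermediate_value_Icc hab hg.continuousOn ⟨ha.le, hb.le⟩
    refine ⟨c, hc, fun x hx h => ?_, fun x hx h => ?_⟩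
    · have := hmono c hc x hx h.le
      linarith
    · have := hmono x hx c hc h.le
      linarith
  have hi : ∀ x y, IntervalIntegrable f volume x y := fun x y => hf.intervalIntegrable x y
  set u := max a (c - δ) with hu
  set v := min b (c + δ) with hv
  have huc : u ≤ c := max_le hc.1 (by linarith)
  have hcv : c ≤ v := le_min hc.2 (by linarith)
  have hau : a ≤ u := le_max_left _ _
  have hvb : v ≤ b := min_le_left _ _
  have e1 : ∫ x in a..b, f x = (∫ x in a..u, f x) + (∫ x in u..v, f x) + ∫ x in v..b, f x := by
    rw [intervalIntegral.integral_add_adjacent_intervals (hi _ _) (hi _ _),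
      intervalIntegral.integral_add_adjacent_intervals (hi _ _) (hi _ _)]
  have b1 : ‖∫ x in a..u, f x‖ ≤ B := by
    rcases le_total a (c - δ) with h | h
    · refine hneg a u le_rfl hau (huc.trans hc.2) fun x hx => ?_
      have hxu : x ≤ c - δ := by simpa [hu, h] using hx.2
      have := hcl x ⟨hx.1, hx.2.trans (huc.trans hc.2)⟩ (by linarith)
      nlinarith
    · rw [hu, max_eq_left h, intervalIntegral.integral_same, norm_zero]
      exact hB
  have b3 : ‖∫ x in v..b, f x‖ ≤ B := by
    rcases le_total b (c + δ) with h | h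
    · rw [hv, min_eq_left h, intervalIntegral.integral_same, norm_zero]
      exact hB
    · refine hpos v b (hc.1.trans hcv) hvb le_rfl fun x hx => ?_
      have hxu : c + δ ≤ x := by simpa [hv, h] using hx.1
      have := hcr x ⟨(hc.1.trans hcv).trans hx.1, hx.2⟩ (by linarith)
      nlinarith
  have b2 : ‖∫ x in u..v, f x‖ ≤ 2 * δ := by
    refine (intervalIntegral.norm_integral_le_of_norm_le_const (C := 1) fun x _ => hf1 x).trans ?_
    rw [abs_of_nonneg (by linarith), one_mul]
    have : v ≤ c + δ := min_le_right _ _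
    have : c - δ ≤ u := le_max_right _ _
    linarith
  rw [e1]
  linarith [norm_add_le ((∫ x in a..u, f x) + (∫ x in u..v, f x)) (∫ x in v..b, f x),
    norm_add_le (∫ x in a..u, f x) (∫ x in u..v, f x)]

open Polynomial in
/-- The van der Corput lemma for polynomial phases. -/
theorem vdc (k : ℕ) : ∃ C : ℝ, 0 < C ∧ ∀ (P : ℝ[X]) (a b lam : ℝ), 0 < lam → a ≤ b →
    (∀ x ∈ Set.Icc a b, lam ≤ (derivative^[k + 2] P).eval x) →
    ‖∫ x in a..b, Complex.exp (Complex.I * ((P.eval x : ℝ) : ℂ))‖ ≤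
      C * lam ^ (-(1 / ((k : ℝ) + 2))) := by
  have hconj : ∀ (P : ℝ[X]) (a b : ℝ),
      ‖∫ x in a..b, Complex.exp (Complex.I * (((-P).eval x : ℝ) : ℂ))‖ =
      ‖∫ x in a..b, Complex.exp (Complex.I * ((P.eval x : ℝ) : ℂ))‖ := fun P a b => by
    rw [← Complex.norm_conj (∫ x in a..b, Complex.exp (Complex.I * ((P.eval x : ℝ) : ℂ)))]
    congr 1
    rw [intervalIntegral, intervalIntegral, map_sub, ← integral_conj, ← integral_conj]
    simp [← Complex.exp_conj]
  have hc : ∀ P : ℝ[X], Continuous fun x : ℝ => P.eval x := fun P => P.continuous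
  have hstep : ∀ (j : ℕ) (P : ℝ[X]) (a b lam : ℝ),
      (∀ x ∈ Set.Icc a b, lam ≤ (derivative^[j + 1] P).eval x) →
      ∀ x ∈ Set.Icc a b, ∀ y ∈ Set.Icc a b, x ≤ y →
      lam * (y - x) ≤ (derivative^[j] P).eval y - (derivative^[j] P).eval x := by
    intro j P a b lam h x hx y hy hxy
    refine (convex_Icc a b).mul_sub_le_image_sub_of_le_deriv (hc _).continuousOn
      (derivative^[j] P).differentiable.differentiableOn (fun z hz => ?_) x hx y hy hxy
    rw [Polynomial.deriv]
    have := h z (interior_subset hz)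
    rwa [Function.iterate_succ_apply'] at this
  induction k with
  | zero =>
    refine ⟨10, by norm_num, fun P a b lam hlam hab h => ?_⟩
    set δ : ℝ := lam ^ (-(1 / 2 : ℝ)) with hδ
    have hδ0 : 0 < δ := Real.rpow_pos_of_pos hlam _
    have hδ2 : lam * δ * δ = 1 := by
      rw [hδ, mul_assoc, ← Real.rpow_add hlam]
      norm_num
      rw [Real.rpow_neg hlam.le, Real.rpow_one, mul_inv_cancel₀ hlam.ne']
    have hm : 0 < lam * δ := mul_pos hlam hδ0
    have hB : 4 / (lam * δ) = 4 * δ := by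
      rw [div_eq_iff hm.ne']
      linear_combination (-4) * hδ2
    have key := vdc_split (f := fun x => Complex.exp (Complex.I * ((P.eval x : ℝ) : ℂ)))
      (by have := hc P; fun_prop)
      (fun x => by rw [mul_comm, Complex.norm_exp_ofReal_mul_I])
      (hc (derivative^[1] P)) hab hlam hδ0 (hstep 1 P a b lam h) (B := 4 / (lam * δ))
      (by positivity)
      (fun a' b' h1 h2 h3 h4 => vdc_first P h2 hm (fun x hx => (h4 x hx).trans (le_abs_self _))
        (fun x hx => hlam.le.trans (h x ⟨h1.trans hx.1, hx.2.trans h3⟩)))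
      (fun a' b' h1 h2 h3 h4 => vdc_first P h2 hm
        (fun x hx => (le_neg.2 (h4 x hx)).trans (neg_le_abs _))
        (fun x hx => hlam.le.trans (h x ⟨h1.trans hx.1, hx.2.trans h3⟩)))
    refine key.trans (le_of_eq ?_)
    rw [hB]
    norm_num
    rw [← hδ]; ring
  | succ k ih =>
    obtain ⟨C, hC, ih⟩ := ih
    refine ⟨2 * C + 2, by positivity, fun P a b lam hlam hab h => ?_⟩
    have hk : (0 : ℝ) < (k : ℝ) + 2 := by positivity
    set δ : ℝ := lam ^ (-(1 / ((k : ℝ) + 3))) with hδ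
    have hδ0 : 0 < δ := Real.rpow_pos_of_pos hlam _
    have hm : 0 < lam * δ := mul_pos hlam hδ0
    have hB : (lam * δ) ^ (-(1 / ((k : ℝ) + 2))) = δ := by
      have : lam * δ = lam ^ (1 + -(1 / ((k : ℝ) + 3))) := by
        rw [Real.rpow_add hlam, Real.rpow_one]
      rw [this, ← Real.rpow_mul hlam.le, hδ]
      congr 1
      field_simp
      ring
    have key := vdc_split (f := fun x => Complex.exp (Complex.I * ((P.eval x : ℝ) : ℂ)))
      (by have := hc P; fun_prop)
      (fun x => by rw [mul_comm, Complex.norm_exp_ofReal_mul_I])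
      (hc (derivative^[k + 2] P)) hab hlam hδ0 (hstep (k + 2) P a b lam h) (B := C * δ)
      (by positivity)
      (fun a' b' h1 h2 h3 h4 => by
        have := ih P a' b' (lam * δ) hm h2 h4
        rwa [hB] at this)
      (fun a' b' h1 h2 h3 h4 => by
        have := ih (-P) a' b' (lam * δ) hm h2 (fun x hx => by
          rw [iterate_derivative_neg, eval_neg]
          exact le_neg.2 (h4 x hx))
        rwa [hB, hconj] at this)
    refine key.trans (le_of_eq ?_)
    push_cast
    rw [show (k : ℝ) + 1 + 2 = k + 3 by ring, ← hδ]; ring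

open Polynomial in
/-- Two-sided form of the van der Corput lemma when the top derivative is a constant. -/
theorem vdc_const (k : ℕ) : ∃ C : ℝ, 0 < C ∧ ∀ (P : ℝ[X]) (a b lam : ℝ), lam ≠ 0 → a ≤ b →
    (∀ x, (derivative^[k + 2] P).eval x = lam) →
    ‖∫ x in a..b, Complex.exp (Complex.I * ((P.eval x : ℝ) : ℂ))‖ ≤
      C * |lam| ^ (-(1 / ((k : ℝ) + 2))) := by
  obtain ⟨C, hC, h⟩ := vdc k
  refine ⟨C, hC, fun P a b lam hlam hab hP => ?_⟩
  rcases lt_or_gt_of_ne hlam with h0 | h0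
  · have hconj : ‖∫ x in a..b, Complex.exp (Complex.I * (((-P).eval x : ℝ) : ℂ))‖ =
        ‖∫ x in a..b, Complex.exp (Complex.I * ((P.eval x : ℝ) : ℂ))‖ := by
      rw [← Complex.norm_conj (∫ x in a..b, Complex.exp (Complex.I * ((P.eval x : ℝ) : ℂ)))]
      congr 1
      rw [intervalIntegral, intervalIntegral, map_sub, ← integral_conj, ← integral_conj]
      simp [← Complex.exp_conj]
    rw [← hconj, abs_of_neg h0]
    refine h (-P) a b (-lam) (neg_pos.2 h0) hab fun x _ => ?_
    rw [iterate_derivative_neg, eval_neg, hP]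
  · rw [abs_of_pos h0]
    exact h P a b lam h0 hab fun x _ => (hP x).ge

/-- The Hilbert space `L²(ℝ^d)`. -/
abbrev L2 (d : ℕ) : Type := Lp ℂ 2 (volume : Measure (Sp d))

theorem integral_fourier_smul_flip {d : ℕ} {f g : Sp d → ℂ} (hf : Integrable f)
    (hg : Integrable g) : ∫ ξ, 𝓕 f ξ * g ξ = ∫ x, f x * 𝓕 g x := by
  simpa using! VectorFourier.integral_fourierIntegral_smul_eq_flip (L := innerₗ (Sp d))
    Real.continuous_fourierChar continuous_inner hf hg

theorem continuous_fourier {d : ℕ} {f : Sp d → ℂ} (hf : Integrable f) : Continuous (𝓕 f) :=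
  VectorFourier.fourierIntegral_continuous Real.continuous_fourierChar
    (by exact continuous_inner) hf

theorem norm_fourier_le {d : ℕ} (f : Sp d → ℂ) (ξ : Sp d) : ‖𝓕 f ξ‖ ≤ ∫ x, ‖f x‖ :=
  VectorFourier.norm_fourierIntegral_le_integral_norm _ _ _ _ _

theorem ae_eq_of_integral_schwartz {d : ℕ} {u v : Sp d → ℂ} (hu : LocallyIntegrable u)
    (hv : LocallyIntegrable v)
    (h : ∀ g : SchwartzMap (Sp d) ℂ, ∫ x, g x * u x = ∫ x, g x * v x) : u =ᵐ[volume] v := by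
  refine ae_eq_of_integral_contDiff_smul_eq hu hv fun g hg1 hg2 => ?_
  have h1 : HasCompactSupport (Complex.ofRealCLM ∘ g) := hg2.comp_left rfl
  have h2 : ContDiff ℝ (⊤ : ℕ∞) (Complex.ofRealCLM ∘ g) := by fun_prop
  simpa using h (h1.toSchwartzMap h2)

theorem fourier_ae_eq {d : ℕ} (f : L2 d) (hf : Integrable f) :
    ⇑(𝓕 f : L2 d) =ᵐ[volume] 𝓕 (f : Sp d → ℂ) := by
  refine ae_eq_of_integral_schwartz ((Lp.memLp _).locallyIntegrable (by norm_num))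
    (continuous_fourier hf).locallyIntegrable fun g => ?_
  have h1 : ∫ x, g x * (𝓕 f : L2 d) x = ∫ x, (𝓕 g) x * f x := by
    have := congrArg (fun T => T g) (Lp.fourier_toTemperedDistribution_eq f)
    simp only [TemperedDistribution.fourier_apply, Lp.toTemperedDistribution_apply,
      smul_eq_mul] at this
    exact this.symm
  rw [h1, SchwartzMap.fourier_coe, integral_fourier_smul_flip g.integrable hf]

theorem memLp_two_of_fourier {d : ℕ} {f : Sp d → ℂ} (hf : Integrable f)
    (hf' : Integrable (𝓕 f)) : MemLp f 2 := by
  have h2 : MemLp (𝓕 f) 2 := by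
    refine (memLp_two_iff_integrable_sq_norm hf'.1).2 ?_
    refine (hf'.norm.const_mul (∫ x, ‖f x‖)).mono' (hf'.1.norm.pow 2) (ae_of_all _ fun ξ => ?_)
    rw [Real.norm_eq_abs, abs_of_nonneg (by positivity), sq]
    exact mul_le_mul_of_nonneg_right (norm_fourier_le f ξ) (norm_nonneg _)
  set u : L2 d := 𝓕⁻ h2.toLp with hu
  have : ⇑u =ᵐ[volume] f := by
    refine ae_eq_of_integral_schwartz ((Lp.memLp _).locallyIntegrable (by norm_num))
      hf.locallyIntegrable fun g => ?_
    have h1 : ∫ x, g x * u x = ∫ x, (𝓕⁻ g) x * (h2.toLp (𝓕 f)) x := by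
      have := congrArg (fun T => T g) (Lp.fourierInv_toTemperedDistribution_eq h2.toLp)
      simp only [TemperedDistribution.fourierInv_apply, Lp.toTemperedDistribution_apply,
        smul_eq_mul] at this
      exact this.symm
    have h3 : ∫ x, (𝓕⁻ g) x * (h2.toLp (𝓕 f)) x = ∫ x, 𝓕 f x * (𝓕⁻ g) x := by
      refine integral_congr_ae ?_
      filter_upwards [h2.coeFn_toLp] with x hx
      rw [hx, mul_comm]
    rw [h1, h3, integral_fourier_smul_flip hf (𝓕⁻ g).integrable, ← SchwartzMap.fourier_coe,
      FourierTransform.fourier_fourierInv_eq]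
    simp_rw [mul_comm]
  exact (memLp_congr_ae this).1 (Lp.memLp u)

theorem norm_phase (x : ℝ) : ‖Complex.exp (-(Complex.I * (x : ℂ)))‖ = 1 := by
  have := Complex.norm_exp_ofReal_mul_I (-x)
  rwa [show ((-x : ℝ) : ℂ) * Complex.I = -(Complex.I * (x : ℂ)) by push_cast; ring] at this

theorem memLp_phase_mul {d : ℕ} {φ : Sp d → ℝ} (hφ : Continuous φ) (s : ℝ) {f : Sp d → ℂ}
    (hf : MemLp f 2) :
    MemLp (fun ξ => Complex.exp (-(Complex.I * ((φ ξ * s : ℝ) : ℂ))) * f ξ) 2 := by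
  refine hf.congr_norm (AEStronglyMeasurable.mul ?_ hf.1) (ae_of_all _ fun ξ => ?_)
  · exact Continuous.aestronglyMeasurable (by fun_prop)
  · rw [norm_mul, norm_phase, one_mul]

/-- Multiplication by the unimodular function `exp(-iφs)` on `L²`. -/
noncomputable def phaseMul {d : ℕ} (φ : Sp d → ℝ) (hφ : Continuous φ) (s : ℝ) : L2 d →L[ℂ] L2 d :=
  LinearMap.mkContinuous
    { toFun := fun f => (memLp_phase_mul hφ s (Lp.memLp f)).toLp
      map_add' := fun f g => by
        rw [← MemLp.toLp_add]
        refine MemLp.toLp_congr _ _ ?_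
        filter_upwards [Lp.coeFn_add f g] with x hx
        simp only [hx, Pi.add_apply, mul_add]
      map_smul' := fun c f => by
        rw [RingHom.id_apply, ← MemLp.toLp_const_smul]
        refine MemLp.toLp_congr _ _ ?_
        filter_upwards [Lp.coeFn_smul c f] with x hx
        simp only [hx, Pi.smul_apply, smul_eq_mul]
        ring } 1 fun f => by
    rw [one_mul]
    refine Lp.norm_le_norm_of_ae_le ?_
    filter_upwards [(memLp_phase_mul hφ s (Lp.memLp f)).coeFn_toLp] with x hx
    simp only [LinearMap.coe_mk, AddHom.coe_mk]
    rw [hx, norm_mul, norm_phase, one_mul]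

theorem phaseMul_ae {d : ℕ} {φ : Sp d → ℝ} (hφ : Continuous φ) (s : ℝ) (f : L2 d) :
    ⇑(phaseMul φ hφ s f) =ᵐ[volume]
      fun ξ => Complex.exp (-(Complex.I * ((φ ξ * s : ℝ) : ℂ))) * f ξ :=
  (memLp_phase_mul hφ s (Lp.memLp f)).coeFn_toLp

/-- The operator `f ↦ e^{-iφs} f̂` on `L²`. -/
noncomputable def evol {d : ℕ} (φ : Sp d → ℝ) (hφ : Continuous φ) (s : ℝ) : L2 d →L[ℂ] L2 d :=
  (phaseMul φ hφ s).comp (Lp.fourierTransformₗᵢ (Sp d) ℂ).toLinearIsometry.toContinuousLinearMap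

theorem evol_ae {d : ℕ} {φ : Sp d → ℝ} (hφ : Continuous φ) (s : ℝ) (f : L2 d) :
    ⇑(evol φ hφ s f) =ᵐ[volume]
      fun ξ => Complex.exp (-(Complex.I * ((φ ξ * s : ℝ) : ℂ))) * (𝓕 f : L2 d) ξ :=
  phaseMul_ae hφ s _

theorem norm_evol {d : ℕ} {φ : Sp d → ℝ} (hφ : Continuous φ) (s : ℝ) (f : L2 d) :
    ‖evol φ hφ s f‖ = ‖f‖ := by
  rw [← Lp.norm_fourier_eq f]
  rw [Lp.norm_def, Lp.norm_def]
  congr 1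
  refine eLpNorm_congr_norm_ae ?_
  filter_upwards [evol_ae hφ s f] with x hx
  rw [hx, norm_mul, norm_phase, one_mul]

theorem inner_evol {d : ℕ} {φ : Sp d → ℝ} (hφ : Continuous φ) (s t : ℝ) (f g : L2 d) :
    inner ℂ (evol φ hφ t g) (evol φ hφ s f) =
      ∫ ξ, Complex.exp (Complex.I * ((φ ξ * (t - s) : ℝ) : ℂ)) *
        (starRingEnd ℂ ((𝓕 g : L2 d) ξ) * (𝓕 f : L2 d) ξ) := by
  rw [MeasureTheory.L2.inner_def]
  refine integral_congr_ae ?_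
  filter_upwards [evol_ae hφ s f, evol_ae hφ t g] with x hx hy
  rw [hx, hy, RCLike.inner_apply, map_mul, ← Complex.exp_conj]
  simp only [map_neg, map_mul, Complex.conj_I, Complex.conj_ofReal]
  have : Complex.exp (Complex.I * ((φ x * (t - s) : ℝ) : ℂ)) =
      Complex.exp (-(Complex.I * ((φ x * s : ℝ) : ℂ))) *
      Complex.exp (-(-Complex.I * ((φ x * t : ℝ) : ℂ))) := by
    rw [← Complex.exp_add]
    congr 1
    push_cast
    ring
  rw [this]
  ring

theorem integrable_conj_mul {d : ℕ} (f g : L2 d) :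
    Integrable fun ξ => starRingEnd ℂ (g ξ) * f ξ := by
  have := MeasureTheory.L2.integrable_inner (𝕜 := ℂ) g f
  refine this.congr (ae_of_all _ fun ξ => ?_)
  simp [RCLike.inner_apply, mul_comm]

theorem continuous_evol {d : ℕ} {φ : Sp d → ℝ} (hφ : Continuous φ) (f : L2 d) :
    Continuous fun s => evol φ hφ s f := by
  have hw : ∀ s, Continuous fun t => (inner ℂ (evol φ hφ t f) (evol φ hφ s f) : ℂ) := fun s => by
    simp_rw [inner_evol hφ]
    refine continuous_of_dominated
      (bound := fun ξ => ‖starRingEnd ℂ ((𝓕 f : L2 d) ξ) * (𝓕 f : L2 d) ξ‖) (fun t => ?_)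
      (fun t => ae_of_all _ fun ξ => ?_) (integrable_conj_mul _ _).norm
      (ae_of_all _ fun ξ => by fun_prop)
    · exact (Continuous.aestronglyMeasurable (by fun_prop)).mul (integrable_conj_mul _ _).1
    · rw [norm_mul, mul_comm Complex.I, Complex.norm_exp_ofReal_mul_I, one_mul]
  refine continuous_iff_continuousAt.2 fun s => ?_
  have h1 : ∀ t, ‖evol φ hφ t f - evol φ hφ s f‖ ^ 2 =
      2 * ‖f‖ ^ 2 - 2 * (inner ℂ (evol φ hφ t f) (evol φ hφ s f) : ℂ).re := fun t => by
    have := norm_sub_sq (𝕜 := ℂ) (evol φ hφ t f) (evol φ hφ s f)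
    rw [norm_evol, norm_evol] at this
    rw [this]
    simp only [RCLike.re_to_complex]
    ring
  have h2 : Tendsto (fun t => ‖evol φ hφ t f - evol φ hφ s f‖ ^ 2) (nhds s) (nhds 0) := by
    simp_rw [h1]
    have : Tendsto (fun t => 2 * ‖f‖ ^ 2 - 2 * (inner ℂ (evol φ hφ t f) (evol φ hφ s f) : ℂ).re)
        (nhds s) (nhds (2 * ‖f‖ ^ 2 - 2 * (inner ℂ (evol φ hφ s f) (evol φ hφ s f) : ℂ).re)) :=
      tendsto_const_nhds.sub
        (((Complex.continuous_re.comp (hw s)).tendsto s).const_mul 2)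
    convert this using 2
    have h3 := inner_self_eq_norm_sq (𝕜 := ℂ) (evol φ hφ s f)
    rw [norm_evol] at h3
    simp only [RCLike.re_to_complex] at h3
    rw [h3]; ring
  rw [ContinuousAt, tendsto_iff_norm_sub_tendsto_zero]
  have h4 := h2.sqrt
  simpa [Real.sqrt_sq (norm_nonneg _)] using h4

open Polynomial in
/-- Phase polynomial of the one-dimensional factors of the dispersive kernel. -/
noncomputable def phasePoly (a b c e : ℝ) : ℝ[X] :=
  C a * X ^ 2 + C b * X ^ 3 + C c * X ^ 4 + C e * X

theorem phasePoly_eval (a b c e x : ℝ) :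
    (phasePoly a b c e).eval x = a * x ^ 2 + b * x ^ 3 + c * x ^ 4 + e * x := by
  simp [phasePoly]

open Polynomial in
theorem phasePoly_deriv_two (a b c e x : ℝ) :
    (derivative^[0 + 2] (phasePoly a b c e)).eval x = 2 * a + 6 * b * x + 12 * c * x ^ 2 := by
  simp only [phasePoly, Function.iterate_succ, Function.iterate_zero, Function.comp, id,
    derivative_add, derivative_X_pow, derivative_X,
    derivative_mul, derivative_C, derivative_one, eval_add, eval_mul, eval_C, eval_pow, eval_X,
    eval_zero, eval_one, map_natCast, eval_natCast, derivative_natCast]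
  norm_num
  ring

open Polynomial in
theorem phasePoly_deriv_three (a b c e x : ℝ) :
    (derivative^[1 + 2] (phasePoly a b c e)).eval x = 6 * b + 24 * c * x := by
  simp only [phasePoly, Function.iterate_succ, Function.iterate_zero, Function.comp, id,
    derivative_add, derivative_X_pow, derivative_X,
    derivative_mul, derivative_C, derivative_one, eval_add, eval_mul, eval_C, eval_pow, eval_X,
    eval_zero, eval_one, map_natCast, eval_natCast, derivative_natCast]
  norm_num
  ring

open Polynomial in
theorem phasePoly_deriv_four (a b c e x : ℝ) :
    (derivative^[2 + 2] (phasePoly a b c e)).eval x = 24 * c := by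
  simp only [phasePoly, Function.iterate_succ, Function.iterate_zero, Function.comp, id,
    derivative_add, derivative_X_pow, derivative_X,
    derivative_mul, derivative_C, derivative_one, eval_add, eval_mul, eval_C, eval_pow, eval_X,
    eval_zero, eval_one, map_natCast, eval_natCast, derivative_natCast]
  norm_num
  ring

/-- Decay of the one-dimensional oscillatory integrals of quadratic phases. -/
theorem osc_quadratic {α : ℝ} (hα : α ≠ 0) : ∃ D : ℝ, 0 < D ∧ ∀ (u e R : ℝ), u ≠ 0 → 0 ≤ R →
    ‖∫ x in (-R)..R, Complex.exp
        (Complex.I * (((phasePoly (u * α) (u * 0) (u * 0) e).eval x : ℝ) : ℂ))‖ ≤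
      D * |u| ^ (-(1 / 2 : ℝ)) := by
  obtain ⟨C, hC, h⟩ := vdc_const 0
  refine ⟨C * |2 * α| ^ (-(1 / 2 : ℝ)), by positivity, fun u e R hu hR => ?_⟩
  have := h (phasePoly (u * α) (u * 0) (u * 0) e) (-R) R (u * (2 * α)) (by positivity) (by linarith)
    (fun x => by rw [phasePoly_deriv_two]; ring)
  refine this.trans (le_of_eq ?_)
  rw [abs_mul, Real.mul_rpow (abs_nonneg _) (abs_nonneg _)]
  norm_num
  ring

/-- Decay of the one-dimensional oscillatory integrals of the degenerate coordinate. -/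
theorem osc_degenerate {α β γ : ℝ} (h0 : (β, γ) ≠ (0, 0)) : ∃ D : ℝ, 0 < D ∧
    ∀ (u e R : ℝ), u ≠ 0 → 0 ≤ R →
    ‖∫ x in (-R)..R, Complex.exp
        (Complex.I * (((phasePoly (u * α) (u * β) (u * γ) e).eval x : ℝ) : ℂ))‖ ≤
      D * |u| ^ (-((1 - (cgam γ)⁻¹) / 2)) := by
  by_cases hγ : γ = 0
  · have hβ : β ≠ 0 := fun hb => h0 (by rw [hb, hγ])
    obtain ⟨C, hC, h⟩ := vdc_const 1
    refine ⟨C * |6 * β| ^ (-(1 / 3 : ℝ)), by positivity, fun u e R hu hR => ?_⟩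
    have := h (phasePoly (u * α) (u * β) (u * γ) e) (-R) R (u * (6 * β)) (by positivity)
      (by linarith) (fun x => by rw [phasePoly_deriv_three, hγ]; ring)
    refine this.trans (le_of_eq ?_)
    rw [abs_mul, Real.mul_rpow (abs_nonneg _) (abs_nonneg _)]
    simp only [cgam, hγ]
    norm_num
    ring
  · obtain ⟨C, hC, h⟩ := vdc_const 2
    refine ⟨C * |24 * γ| ^ (-(1 / 4 : ℝ)), by positivity, fun u e R hu hR => ?_⟩
    have := h (phasePoly (u * α) (u * β) (u * γ) e) (-R) R (u * (24 * γ)) (by positivity)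
      (by linarith) (fun x => by rw [phasePoly_deriv_four]; ring)
    refine this.trans (le_of_eq ?_)
    rw [abs_mul, Real.mul_rpow (abs_nonneg _) (abs_nonneg _)]
    simp only [cgam, if_pos (show γ ≠ 0 from hγ)]
    norm_num
    ring

/-- The indicator function of the cube `[-R, R]^d`. -/
noncomputable def cubeInd (d : ℕ) (R : ℝ) (ξ : Sp d) : ℂ :=
  ∏ i, (Set.Icc (-R) R).indicator (fun _ => (1 : ℂ)) (ξ i)

theorem integral_prod_coord {d : ℕ} (f : Fin d → ℝ → ℂ) :
    ∫ ξ : Sp d, ∏ i, f i (ξ i) = ∏ i, ∫ x, f i x := by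
  rw [← integral_fintype_prod_volume_eq_prod (fun i => f i)]
  exact (EuclideanSpace.volume_preserving_symm_measurableEquiv_toLp (Fin d)).integral_comp'
    (fun x : Fin d → ℝ => ∏ i, f i (x i))

theorem integrable_cubeInd (d : ℕ) (R : ℝ) : Integrable (cubeInd d R) := by
  have h : Integrable (fun x : Fin d → ℝ =>
      ∏ i, (Set.Icc (-R) R).indicator (fun _ => (1 : ℂ)) (x i)) :=
    Integrable.fintype_prod fun i => (integrable_indicator_iff measurableSet_Icc).2
      (by simp [IntegrableOn])
  exact ((EuclideanSpace.volume_preserving_symm_measurableEquiv_toLp (Fin d)).integrable_comp_emb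
    (MeasurableEquiv.measurableEmbedding _)).2 h

theorem continuous_firstCoord {d : ℕ} : Continuous (firstCoord (d := d)) := by
  unfold firstCoord
  split_ifs <;> fun_prop

theorem continuous_dispersion {d : ℕ} (α β γ : ℝ) : Continuous (dispersion (d := d) α β γ) := by
  have := continuous_firstCoord (d := d)
  unfold dispersion
  fun_prop

theorem norm_cubeInd_le (d : ℕ) (R : ℝ) (ξ : Sp d) : ‖cubeInd d R ξ‖ ≤ 1 := by
  rw [cubeInd, norm_prod]
  refine Finset.prod_le_one (fun _ _ => norm_nonneg _) fun i _ => ?_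
  by_cases h : ξ i ∈ Set.Icc (-R) R <;> simp [h]

theorem tendsto_cubeInd {d : ℕ} (ξ : Sp d) :
    Tendsto (fun n : ℕ => cubeInd d n ξ) atTop (nhds 1) := by
  refine tendsto_const_nhds.congr' ?_
  obtain ⟨N, hN⟩ := exists_nat_ge ‖ξ‖
  filter_upwards [eventually_ge_atTop N] with n hn
  rw [cubeInd]
  refine (Finset.prod_eq_one fun i _ => ?_).symm
  have h1 : ‖ξ i‖ ≤ ‖ξ‖ := PiLp.norm_apply_le ξ i
  have h2 : (N : ℝ) ≤ n := by exact_mod_cast hn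
  rw [Real.norm_eq_abs] at h1
  have := abs_le.1 (h1.trans (hN.trans h2))
  rw [Set.indicator_of_mem (by exact this)]

/-- Truncated kernel of the propagator. -/
noncomputable def kern {d : ℕ} (α β γ : ℝ) (u : ℝ) (R : ℝ) (z : Sp d) : ℂ :=
  ∫ ξ, cubeInd d R ξ * Complex.exp (Complex.I *
    ((dispersion α β γ ξ * u + 2 * Real.pi * inner ℝ z ξ : ℝ) : ℂ))

theorem kern_eq_prod {d : ℕ} (hd : 2 ≤ d) (α β γ u R : ℝ) (hR : 0 ≤ R) (z : Sp d) :
    kern α β γ u R z = ∏ i : Fin d, ∫ x in (-R)..R, Complex.exp (Complex.I *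
      (((phasePoly (u * α) (u * if (i : ℕ) = 0 then β else 0) (u * if (i : ℕ) = 0 then γ else 0)
        (2 * Real.pi * z i)).eval x : ℝ) : ℂ)) := by
  have h1 : ∀ i : Fin d, (∫ x in (-R)..R, Complex.exp (Complex.I *
      (((phasePoly (u * α) (u * if (i : ℕ) = 0 then β else 0) (u * if (i : ℕ) = 0 then γ else 0)
        (2 * Real.pi * z i)).eval x : ℝ) : ℂ))) = ∫ x, (Set.Icc (-R) R).indicator (fun x =>
        Complex.exp (Complex.I *
      (((phasePoly (u * α) (u * if (i : ℕ) = 0 then β else 0) (u * if (i : ℕ) = 0 then γ else 0)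
        (2 * Real.pi * z i)).eval x : ℝ) : ℂ))) x := fun i => by
    rw [intervalIntegral.integral_of_le (by linarith), integral_indicator measurableSet_Icc,
      integral_Icc_eq_integral_Ioc]
  rw [Finset.prod_congr rfl fun i _ => h1 i, ← integral_prod_coord, kern]
  congr 1
  ext ξ
  have h2 : ∀ i : Fin d, (Set.Icc (-R) R).indicator (fun x =>
        Complex.exp (Complex.I *
      (((phasePoly (u * α) (u * if (i : ℕ) = 0 then β else 0) (u * if (i : ℕ) = 0 then γ else 0)
        (2 * Real.pi * z i)).eval x : ℝ) : ℂ))) (ξ i) =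
      (Set.Icc (-R) R).indicator (fun _ => (1 : ℂ)) (ξ i) * Complex.exp (Complex.I *
      (((phasePoly (u * α) (u * if (i : ℕ) = 0 then β else 0) (u * if (i : ℕ) = 0 then γ else 0)
        (2 * Real.pi * z i)).eval (ξ i) : ℝ) : ℂ)) := fun i => by
    by_cases h : ξ i ∈ Set.Icc (-R) R <;> simp [h]
  rw [Finset.prod_congr rfl fun i _ => h2 i, Finset.prod_mul_distrib, ← Complex.exp_sum,
    ← Finset.mul_sum, cubeInd]
  congr 3
  rw [← Complex.ofReal_sum]
  congr 1
  simp_rw [phasePoly_eval]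
  have hd0 : 0 < d := by omega
  have hfc : firstCoord ξ = ξ ⟨0, hd0⟩ := by
    rw [firstCoord, dif_pos hd0]; rfl
  have h3 : ∀ (c : ℝ) (k : ℕ), ∑ i : Fin d, (u * if (i : ℕ) = 0 then c else 0) * ξ i ^ k =
      u * c * ξ ⟨0, hd0⟩ ^ k := fun c k => by
    rw [Finset.sum_eq_single ⟨0, hd0⟩]
    · simp
    · intro b _ hb
      have : (b : ℕ) ≠ 0 := fun h => hb (Fin.ext h)
      simp [this]
    · simp
  simp_rw [Finset.sum_add_distrib]
  rw [h3, h3, dispersion, hfc, EuclideanSpace.real_norm_sq_eq, PiLp.inner_apply]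
  simp_rw [RCLike.inner_apply, conj_trivial, mul_assoc, ← Finset.mul_sum]
  simp_rw [mul_comm (z _)]
  ring

/-- The dispersive kernel bound. -/
theorem kern_bound {d : ℕ} (hd : 2 ≤ d) {α β γ : ℝ} (hα : α ≠ 0) (hβγ : (β, γ) ≠ (0, 0)) :
    ∃ D : ℝ, 0 < D ∧ ∀ (u R : ℝ) (z : Sp d), u ≠ 0 → 0 ≤ R →
      ‖kern α β γ u R z‖ ≤ D * |u| ^ (-(dEff d γ / 2)) := by
  obtain ⟨D1, hD1, h1⟩ := osc_quadratic hα
  obtain ⟨D0, hD0, h0⟩ := osc_degenerate (α := α) hβγ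
  refine ⟨D0 * D1 ^ (d - 1), by positivity, fun u R z hu hR => ?_⟩
  have hu0 : 0 < |u| := abs_pos.2 hu
  rw [kern_eq_prod hd α β γ u R hR z, norm_prod]
  have hle : ∀ i ∈ (Finset.univ : Finset (Fin d)), ‖∫ x in (-R)..R, Complex.exp (Complex.I *
      (((phasePoly (u * α) (u * if (i : ℕ) = 0 then β else 0) (u * if (i : ℕ) = 0 then γ else 0)
        (2 * Real.pi * z i)).eval x : ℝ) : ℂ))‖ ≤
      if (i : ℕ) = 0 then D0 * |u| ^ (-((1 - (cgam γ)⁻¹) / 2)) else D1 * |u| ^ (-(1 / 2 : ℝ)) := by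
    intro i _
    by_cases hi : (i : ℕ) = 0
    · simp only [hi, if_true]
      exact h0 u _ R hu hR
    · simp only [hi, if_false]
      exact h1 u _ R hu hR
  refine (Finset.prod_le_prod (fun _ _ => norm_nonneg _) hle).trans (le_of_eq ?_)
  obtain ⟨m, rfl⟩ : ∃ m, d = m + 1 := ⟨d - 1, by omega⟩
  rw [Fin.prod_univ_succ]
  simp only [Fin.val_zero, if_true, Fin.val_succ, Nat.succ_ne_zero, if_false, Finset.prod_const,
    Finset.card_univ, Fintype.card_fin, Nat.add_sub_cancel]
  rw [mul_pow, ← Real.rpow_natCast (|u| ^ (-(1 / 2 : ℝ))), ← Real.rpow_mul hu0.le]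
  have : |u| ^ (-(dEff (m + 1) γ / 2)) =
      |u| ^ (-((1 - (cgam γ)⁻¹) / 2)) * |u| ^ (-(1 / 2 : ℝ) * (m : ℝ)) := by
    rw [← Real.rpow_add hu0, dEff]
    congr 1
    push_cast
    ring
  rw [this]
  ring

theorem fourier_conj_mul {d : ℕ} {f g : Sp d → ℂ} (ξ : Sp d) :
    ∫ p : Sp d × Sp d, Complex.exp (Complex.I * ((2 * Real.pi * inner ℝ (p.2 - p.1) ξ : ℝ) : ℂ)) *
      (f p.1 * starRingEnd ℂ (g p.2)) = starRingEnd ℂ (𝓕 g ξ) * 𝓕 f ξ := by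
  rw [mul_comm (starRingEnd ℂ (𝓕 g ξ)), Real.fourier_eq', Real.fourier_eq', ← integral_conj,
    ← integral_prod_mul]
  refine integral_congr_ae (ae_of_all _ fun p => ?_)
  simp only [smul_eq_mul, map_mul, ← Complex.exp_conj, Complex.conj_I, Complex.conj_ofReal]
  rw [mul_mul_mul_comm, ← Complex.exp_add]
  congr 2
  rw [inner_sub_left]
  push_cast
  ring

theorem integral_truncated_eq {d : ℕ} (α β γ u R : ℝ) {f g : Sp d → ℂ} (hf : Integrable f)
    (hg : Integrable g) :
    ∫ ξ, cubeInd d R ξ * (Complex.exp (Complex.I * ((dispersion α β γ ξ * u : ℝ) : ℂ)) *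
      (starRingEnd ℂ (𝓕 g ξ) * 𝓕 f ξ)) =
    ∫ p : Sp d × Sp d, kern α β γ u R (p.2 - p.1) * (f p.1 * starRingEnd ℂ (g p.2)) := by
  set Ψ : Sp d → Sp d × Sp d → ℂ := fun ξ p =>
    Complex.exp (Complex.I *
      ((dispersion α β γ ξ * u + 2 * Real.pi * inner ℝ (p.2 - p.1) ξ : ℝ) : ℂ)) *
      (cubeInd d R ξ * (f p.1 * starRingEnd ℂ (g p.2))) with hΨ
  have hg' : Integrable fun y => starRingEnd ℂ (g y) := by
    have := hg.norm
    refine hg.mono ?_ (ae_of_all _ fun x => by simp)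
    exact Complex.continuous_conj.comp_aestronglyMeasurable hg.1
  have hc := continuous_dispersion (d := d) α β γ
  have hint : Integrable (Function.uncurry Ψ) (volume.prod (volume.prod volume)) := by
    have h1 : Integrable (fun q : Sp d × Sp d × Sp d =>
        cubeInd d R q.1 * (f q.2.1 * starRingEnd ℂ (g q.2.2)))
        (volume.prod (volume.prod volume)) :=
      (integrable_cubeInd d R).mul_prod (hf.mul_prod hg')
    refine h1.mono (AEStronglyMeasurable.mul ?_ h1.1) (ae_of_all _ fun q => ?_)
    · exact Continuous.aestronglyMeasurable (by fun_prop)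
    · simp only [hΨ, Function.uncurry]
      rw [norm_mul, mul_comm Complex.I, Complex.norm_exp_ofReal_mul_I, one_mul]
  have hswap := integral_integral_swap hint
  calc _ = ∫ ξ, ∫ p, Ψ ξ p ∂(volume.prod volume) := by
        refine integral_congr_ae (ae_of_all _ fun ξ => ?_)
        simp only [hΨ]
        rw [← fourier_conj_mul ξ, ← mul_assoc, ← integral_const_mul]
        refine integral_congr_ae (ae_of_all _ fun p => ?_)
        simp only
        rw [show (dispersion α β γ ξ * u + 2 * Real.pi * inner ℝ (p.2 - p.1) ξ : ℝ) =
          ((dispersion α β γ ξ * u) + (2 * Real.pi * inner ℝ (p.2 - p.1) ξ) : ℝ) by rfl,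
          Complex.ofReal_add, mul_add, Complex.exp_add]
        ring
    _ = ∫ p, (∫ ξ, Ψ ξ p) ∂(volume.prod volume) := hswap
    _ = _ := by
        refine integral_congr_ae (ae_of_all _ fun p => ?_)
        simp only [hΨ, kern]
        rw [← integral_mul_const]
        refine integral_congr_ae (ae_of_all _ fun ξ => ?_)
        simp only
        ring

/-- The dispersive estimate for the evolution family, in weak form. -/
theorem dispersive {d : ℕ} (hd : 2 ≤ d) {α β γ : ℝ} (hα : α ≠ 0) (hβγ : (β, γ) ≠ (0, 0)) :
    ∃ D : ℝ, 0 < D ∧ ∀ (s t : ℝ) (f g : L2 d), s ≠ t → Integrable f → Integrable g →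
      ‖(inner ℂ (evol (dispersion α β γ) (continuous_dispersion α β γ) t g)
        (evol (dispersion α β γ) (continuous_dispersion α β γ) s f) : ℂ)‖ ≤
        D * |t - s| ^ (-(dEff d γ / 2)) * ((∫ x, ‖f x‖) * ∫ x, ‖g x‖) := by
  obtain ⟨D, hD, hK⟩ := kern_bound hd hα hβγ
  refine ⟨D, hD, fun s t f g hst hf hg => ?_⟩
  have hu : t - s ≠ 0 := sub_ne_zero.2 hst.symm
  have hG : Integrable fun ξ => starRingEnd ℂ (𝓕 (g : Sp d → ℂ) ξ) * 𝓕 (f : Sp d → ℂ) ξ := by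
    refine (integrable_conj_mul (𝓕 f : L2 d) (𝓕 g : L2 d)).congr ?_
    filter_upwards [fourier_ae_eq f hf, fourier_ae_eq g hg] with ξ h1 h2
    rw [h1, h2]
  have hc := continuous_dispersion (d := d) α β γ
  rw [inner_evol]
  have h1 : ∫ ξ, Complex.exp (Complex.I * ((dispersion α β γ ξ * (t - s) : ℝ) : ℂ)) *
        (starRingEnd ℂ ((𝓕 g : L2 d) ξ) * (𝓕 f : L2 d) ξ) =
      ∫ ξ, Complex.exp (Complex.I * ((dispersion α β γ ξ * (t - s) : ℝ) : ℂ)) *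
        (starRingEnd ℂ (𝓕 (g : Sp d → ℂ) ξ) * 𝓕 (f : Sp d → ℂ) ξ) := by
    refine integral_congr_ae ?_
    filter_upwards [fourier_ae_eq f hf, fourier_ae_eq g hg] with ξ h1 h2
    rw [h1, h2]
  rw [h1]
  have hlim : Tendsto (fun n : ℕ => ∫ ξ, cubeInd d n ξ *
      (Complex.exp (Complex.I * ((dispersion α β γ ξ * (t - s) : ℝ) : ℂ)) *
        (starRingEnd ℂ (𝓕 (g : Sp d → ℂ) ξ) * 𝓕 (f : Sp d → ℂ) ξ))) atTop
      (nhds (∫ ξ, Complex.exp (Complex.I * ((dispersion α β γ ξ * (t - s) : ℝ) : ℂ)) *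
        (starRingEnd ℂ (𝓕 (g : Sp d → ℂ) ξ) * 𝓕 (f : Sp d → ℂ) ξ))) := by
    have hm : AEStronglyMeasurable (fun ξ =>
        Complex.exp (Complex.I * ((dispersion α β γ ξ * (t - s) : ℝ) : ℂ)) *
        (starRingEnd ℂ (𝓕 (g : Sp d → ℂ) ξ) * 𝓕 (f : Sp d → ℂ) ξ)) :=
      (Continuous.aestronglyMeasurable (by fun_prop)).mul hG.1
    refine tendsto_integral_of_dominated_convergence
      (fun ξ => ‖starRingEnd ℂ (𝓕 (g : Sp d → ℂ) ξ) * 𝓕 (f : Sp d → ℂ) ξ‖)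
      (fun n => (integrable_cubeInd d n).1.mul hm) hG.norm
      (fun n => ae_of_all _ fun ξ => ?_) (ae_of_all _ fun ξ => ?_)
    · rw [norm_mul, norm_mul, mul_comm Complex.I, Complex.norm_exp_ofReal_mul_I, one_mul]
      exact mul_le_of_le_one_left (norm_nonneg _) (norm_cubeInd_le d n ξ)
    · simpa using (tendsto_cubeInd ξ).mul_const
        (Complex.exp (Complex.I * ((dispersion α β γ ξ * (t - s) : ℝ) : ℂ)) *
        (starRingEnd ℂ (𝓕 (g : Sp d → ℂ) ξ) * 𝓕 (f : Sp d → ℂ) ξ))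
  refine le_of_tendsto hlim.norm (Eventually.of_forall fun n => ?_)
  rw [integral_truncated_eq α β γ (t - s) n hf hg]
  have hfg : Integrable (fun p : Sp d × Sp d => ‖f p.1‖ * ‖g p.2‖) (volume.prod volume) :=
    hf.norm.mul_prod hg.norm
  calc _ ≤ ∫ p : Sp d × Sp d, D * |t - s| ^ (-(dEff d γ / 2)) * (‖f p.1‖ * ‖g p.2‖)
          ∂(volume.prod volume) := by
        refine norm_integral_le_of_norm_le (hfg.const_mul _) (ae_of_all _ fun p => ?_)
        rw [norm_mul, norm_mul, RCLike.norm_conj]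
        exact mul_le_mul_of_nonneg_right (hK _ _ _ hu (Nat.cast_nonneg n)) (by positivity)
    _ = _ := by
        rw [integral_const_mul, ← integral_prod_mul]

/-- Duality between the propagator and the evolution family. -/
theorem inner_evol_eq_integral_propagator {d : ℕ} (α β γ s t : ℝ) (f g : L2 d)
    {f₀ g₀ : Sp d → ℂ} (hff : ⇑f =ᵐ[volume] f₀) (hgg : ⇑g =ᵐ[volume] g₀)
    (hf : Integrable f₀) (hf' : Integrable (𝓕 f₀)) (hg : Integrable g₀) :
    (inner ℂ (evol (dispersion α β γ) (continuous_dispersion α β γ) t g)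
        (evol (dispersion α β γ) (continuous_dispersion α β γ) s f) : ℂ) =
      ∫ x, starRingEnd ℂ (g₀ x) * propagator α β γ (t - s) f₀ x := by
  have hc := continuous_dispersion (d := d) α β γ
  rw [inner_evol]
  have e1 : ⇑(𝓕 f : L2 d) =ᵐ[volume] 𝓕 f₀ := by
    refine (fourier_ae_eq f (hf.congr hff.symm)).trans (ae_of_all _ fun ξ => ?_)
    exact Real.fourier_congr_ae hff ξ
  have e2 : ⇑(𝓕 g : L2 d) =ᵐ[volume] 𝓕 g₀ := by
    refine (fourier_ae_eq g (hg.congr hgg.symm)).trans (ae_of_all _ fun ξ => ?_)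
    exact Real.fourier_congr_ae hgg ξ
  set h : Sp d → ℂ := fun ξ =>
    Complex.exp (Complex.I * ((dispersion α β γ ξ * (t - s) : ℝ) : ℂ)) * 𝓕 f₀ ξ with hh
  have hhi : Integrable h := by
    refine hf'.mono ((Continuous.aestronglyMeasurable (by fun_prop)).mul hf'.1)
      (ae_of_all _ fun ξ => ?_)
    simp only [hh]
    rw [norm_mul, mul_comm Complex.I, Complex.norm_exp_ofReal_mul_I, one_mul]
  have hg' : Integrable fun y => starRingEnd ℂ (g₀ y) :=
    hg.mono (Complex.continuous_conj.comp_aestronglyMeasurable hg.1) (ae_of_all _ fun x => by simp)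
  have h2 : ∀ ξ, starRingEnd ℂ (𝓕 g₀ ξ) = 𝓕⁻ (fun y => starRingEnd ℂ (g₀ y)) ξ := fun ξ => by
    rw [Real.fourier_eq', Real.fourierInv_eq', ← integral_conj]
    refine integral_congr_ae (ae_of_all _ fun x => ?_)
    simp only [smul_eq_mul, map_mul, ← Complex.exp_conj, Complex.conj_I, Complex.conj_ofReal]
    congr 2
    push_cast
    ring
  calc _ = ∫ ξ, h ξ * starRingEnd ℂ (𝓕 g₀ ξ) := by
        refine integral_congr_ae ?_
        filter_upwards [e1, e2] with ξ h1 h2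
        simp only [hh]
        rw [h1, h2]
        ring
    _ = ∫ ξ, 𝓕 (fun y => starRingEnd ℂ (g₀ y)) ξ * h (-ξ) := by
        rw [← integral_neg_eq_self]
        refine integral_congr_ae (ae_of_all _ fun ξ => ?_)
        simp only [h2]
        rw [Real.fourierInv_eq_fourier_neg, neg_neg, mul_comm]
    _ = ∫ x, starRingEnd ℂ (g₀ x) * 𝓕 (fun ξ => h (-ξ)) x :=
        integral_fourier_smul_flip hg' hhi.comp_neg
    _ = _ := by
        refine integral_congr_ae (ae_of_all _ fun x => ?_)
        simp only [propagator]
        rw [← Real.fourierInv_eq_fourier_comp_neg]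

/-- Schur's test in `L²`, in extended nonnegative reals. -/
theorem schur_test {X Y : Type*} [MeasurableSpace X] [MeasurableSpace Y] {μ : Measure X}
    {ν : Measure Y} [SFinite μ] [SFinite ν] {w : X → Y → ℝ≥0∞}
    (hw : Measurable (Function.uncurry w)) {a : X → ℝ≥0∞} {b : Y → ℝ≥0∞} (ha : Measurable a)
    (hb : Measurable b) {C : ℝ≥0∞} (h1 : ∀ x, ∫⁻ y, w x y ∂ν ≤ C) (h2 : ∀ y, ∫⁻ x, w x y ∂μ ≤ C) :
    ∫⁻ x, ∫⁻ y, w x y * a x * b y ∂ν ∂μ ≤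
      C * ((∫⁻ x, a x ^ (2 : ℝ) ∂μ) ^ (1 / 2 : ℝ) * (∫⁻ y, b y ^ (2 : ℝ) ∂ν) ^ (1 / 2 : ℝ)) := by
  have hw1 : Measurable fun z : X × Y => w z.1 z.2 := hw
  have hA : ∫⁻ z : X × Y, (w z.1 z.2 ^ (1 / 2 : ℝ) * a z.1) ^ (2 : ℝ) ∂(μ.prod ν) ≤
      C * ∫⁻ x, a x ^ (2 : ℝ) ∂μ := by
    rw [lintegral_prod _ (by fun_prop), ← lintegral_const_mul _ (by fun_prop)]
    refine lintegral_mono fun x => ?_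
    simp_rw [ENNReal.mul_rpow_of_nonneg _ _ (zero_le_two), ← ENNReal.rpow_mul]
    norm_num
    have : Measurable fun y => w x y := hw1.comp measurable_prodMk_left
    rw [lintegral_mul_const _ this]
    exact mul_le_mul_left (h1 x) _
  have hB : ∫⁻ z : X × Y, (w z.1 z.2 ^ (1 / 2 : ℝ) * b z.2) ^ (2 : ℝ) ∂(μ.prod ν) ≤
      C * ∫⁻ y, b y ^ (2 : ℝ) ∂ν := by
    rw [lintegral_prod_symm _ (by fun_prop), ← lintegral_const_mul _ (by fun_prop)]
    refine lintegral_mono fun x => ?_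
    simp_rw [ENNReal.mul_rpow_of_nonneg _ _ (zero_le_two), ← ENNReal.rpow_mul]
    norm_num
    have : Measurable fun y => w y x := hw1.comp measurable_prodMk_right
    rw [lintegral_mul_const _ this]
    exact mul_le_mul_left (h2 x) _
  have hH := ENNReal.lintegral_mul_le_Lp_mul_Lq (μ.prod ν) (Real.HolderConjugate.two_two)
    (f := fun z : X × Y => w z.1 z.2 ^ (1 / 2 : ℝ) * a z.1)
    (g := fun z : X × Y => w z.1 z.2 ^ (1 / 2 : ℝ) * b z.2) (by fun_prop) (by fun_prop)
  have hE : ∫⁻ x, ∫⁻ y, w x y * a x * b y ∂ν ∂μ = ∫⁻ z : X × Y,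
      ((fun z : X × Y => w z.1 z.2 ^ (1 / 2 : ℝ) * a z.1) *
        (fun z : X × Y => w z.1 z.2 ^ (1 / 2 : ℝ) * b z.2)) z ∂(μ.prod ν) := by
    rw [lintegral_prod _ (by fun_prop)]
    refine lintegral_congr fun x => lintegral_congr fun y => ?_
    have : w x y = w x y ^ (1 / 2 : ℝ) * w x y ^ (1 / 2 : ℝ) := by
      rw [← ENNReal.rpow_add_of_nonneg _ _ (by norm_num) (by norm_num)]
      norm_num
    simp only [Pi.mul_apply]
    nth_rw 1 [this]
    ring
  rw [hE]
  refine hH.trans ?_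
  refine (mul_le_mul' (ENNReal.rpow_le_rpow hA (by norm_num))
    (ENNReal.rpow_le_rpow hB (by norm_num))).trans (le_of_eq ?_)
  rw [ENNReal.mul_rpow_of_nonneg _ _ (by norm_num), ENNReal.mul_rpow_of_nonneg _ _ (by norm_num),
    mul_mul_mul_comm, ← ENNReal.rpow_add_of_nonneg _ _ (by norm_num) (by norm_num)]
  norm_num

/-- Discrete Schur test. -/
theorem schur_tsum {w : ℤ → ℤ → ℝ≥0∞} {a b : ℤ → ℝ≥0∞} {C : ℝ≥0∞}
    (h1 : ∀ x, ∑' y, w x y ≤ C) (h2 : ∀ y, ∑' x, w x y ≤ C) :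
    ∑' x, ∑' y, w x y * a x * b y ≤
      C * ((∑' x, a x ^ (2 : ℝ)) ^ (1 / 2 : ℝ) * (∑' y, b y ^ (2 : ℝ)) ^ (1 / 2 : ℝ)) := by
  have := schur_test (μ := Measure.count) (ν := Measure.count) (w := w) (a := a) (b := b) (C := C)
    (measurable_of_countable _) (measurable_of_countable _) (measurable_of_countable _)
    (by simpa [lintegral_count] using h1) (by simpa [lintegral_count] using h2)
  simpa [lintegral_count] using this

/-- Two-sided exponentially decaying sums over shifted integers are uniformly bounded. -/
theorem tsum_two_rpow_abs {ε : ℝ} (hε : 0 < ε) : ∃ C : ℝ≥0∞, C ≠ ∞ ∧ ∀ x : ℝ,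
    ∑' k : ℤ, ENNReal.ofReal (2 ^ (-(ε * |x - k|))) ≤ C := by
  set ρ : ℝ := 2 ^ (-ε) with hρ
  have hρ0 : 0 ≤ ρ := by positivity
  have hρ1 : ρ < 1 := Real.rpow_lt_one_of_one_lt_of_neg (by norm_num) (by linarith)
  set G : ℝ≥0∞ := ∑' n : ℕ, ENNReal.ofReal ρ ^ n with hG
  have hGt : G ≠ ∞ := by
    rw [hG, ENNReal.tsum_geometric]
    refine ENNReal.inv_ne_top.2 ?_
    have : ENNReal.ofReal ρ < 1 := by
      rw [← ENNReal.ofReal_one]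
      exact (ENNReal.ofReal_lt_ofReal_iff one_pos).2 hρ1
    exact (tsub_pos_of_lt this).ne'
  have hpow : ∀ n : ℕ, ENNReal.ofReal ρ ^ n = ENNReal.ofReal (2 ^ (-(ε * n))) := fun n => by
    rw [← ENNReal.ofReal_pow hρ0, hρ, ← Real.rpow_natCast, ← Real.rpow_mul (by norm_num)]
    congr 2; ring
  refine ⟨ENNReal.ofReal (2 ^ ε) * G + G,
    ENNReal.add_ne_top.2 ⟨ENNReal.mul_ne_top ENNReal.ofReal_ne_top hGt, hGt⟩, fun x => ?_⟩
  set m : ℤ := ⌊x⌋ with hm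
  have hm1 : (m : ℝ) ≤ x := Int.floor_le x
  have hm2 : x < m + 1 := Int.lt_floor_add_one x
  rw [← (Equiv.addRight m).tsum_eq]
  have hs : ∀ f : ℤ → ℝ≥0∞, ∑' k : ℤ, f k = ∑' n : ℕ, f n + ∑' n : ℕ, f (-((n : ℤ) + 1)) := fun f =>
    tsum_of_nat_of_neg_add_one ENNReal.summable ENNReal.summable
  have h2 : ∀ a b : ℝ, a ≤ b → ENNReal.ofReal (2 ^ a) ≤ ENNReal.ofReal ((2 : ℝ) ^ b) := fun a b h =>
    ENNReal.ofReal_le_ofReal (Real.rpow_le_rpow_of_exponent_le (by norm_num) h)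
  rw [hs]
  refine add_le_add ?_ ?_
  · rw [hG, ← ENNReal.tsum_mul_left]
    refine ENNReal.tsum_le_tsum fun n => ?_
    rw [hpow, ← ENNReal.ofReal_mul (by positivity), ← Real.rpow_add (by norm_num)]
    apply h2
    have : (n : ℝ) - 1 ≤ |x - (m + n)| := by
      rw [abs_sub_comm]; exact (by linarith : (n : ℝ) - 1 ≤ m + n - x).trans (le_abs_self _)
    simp only [Equiv.coe_addRight]
    push_cast
    rw [add_comm (n : ℝ)]
    nlinarith
  · rw [hG]
    refine ENNReal.tsum_le_tsum fun n => ?_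
    rw [hpow]
    apply h2
    have : (n : ℝ) ≤ |x - (-(n + 1) + m)| :=
      (by linarith : (n : ℝ) ≤ x - (-(n + 1) + m)).trans (le_abs_self _)
    simp only [Equiv.coe_addRight]
    push_cast
    nlinarith

theorem tsum_two_rpow_indicator_le (M : ℝ≥0∞) :
    ∑' m : ℤ, {m : ℤ | ENNReal.ofReal (2 ^ (m : ℝ)) < M}.indicator
      (fun m => ENNReal.ofReal (2 ^ (m : ℝ))) m ≤ 2 * M := by
  rcases eq_or_ne M ∞ with rfl | hM
  · simp
  lift M to NNReal using hM
  rcases eq_or_ne M 0 with rfl | hM0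
  · simp
  obtain ⟨j, hj1, hj2⟩ := exists_mem_Ioc_zpow (x := (M : ℝ)) (y := 2) (by positivity) (by norm_num)
  rw [← (Equiv.addRight (j + 1)).tsum_eq,
    tsum_of_nat_of_neg_add_one ENNReal.summable ENNReal.summable]
  have h0 : ∀ n : ℕ, {m : ℤ | ENNReal.ofReal (2 ^ (m : ℝ)) < (M : ℝ≥0∞)}.indicator
      (fun m => ENNReal.ofReal (2 ^ (m : ℝ))) (Equiv.addRight (j + 1) (n : ℤ)) = 0 := fun n => by
    refine Set.indicator_of_notMem ?_ _
    simp only [Set.mem_ofPred_eq, not_lt, Equiv.coe_addRight]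
    rw [← ENNReal.ofReal_coe_nnreal, Real.rpow_intCast]
    exact ENNReal.ofReal_le_ofReal (hj2.trans (zpow_le_zpow_right₀ (by norm_num) (by omega)))
  simp only [h0, tsum_zero, zero_add]
  have h1 : ∀ n : ℕ, {m : ℤ | ENNReal.ofReal (2 ^ (m : ℝ)) < (M : ℝ≥0∞)}.indicator
      (fun m => ENNReal.ofReal (2 ^ (m : ℝ))) (Equiv.addRight (j + 1) (-((n : ℤ) + 1))) ≤
      M * 2⁻¹ ^ n := fun n => by
    refine (Set.indicator_le_self _ _ _).trans ?_
    have : (2⁻¹ : ℝ≥0∞) = ENNReal.ofReal (2⁻¹) := by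
      rw [ENNReal.ofReal_inv_of_pos (by norm_num)]; norm_num
    rw [this, ← ENNReal.ofReal_pow (by norm_num), ← ENNReal.ofReal_coe_nnreal,
      ← ENNReal.ofReal_mul (by positivity), Real.rpow_intCast]
    refine ENNReal.ofReal_le_ofReal ?_
    have : Equiv.addRight (j + 1) (-((n : ℤ) + 1)) = j - n := by
      simp only [Equiv.coe_addRight]; ring
    rw [this, zpow_sub₀ (by norm_num), inv_pow, zpow_natCast, div_eq_mul_inv]
    gcongr
  refine (ENNReal.tsum_le_tsum h1).trans ?_
  rw [ENNReal.tsum_mul_left, ENNReal.tsum_geometric, mul_comm]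
  norm_num

theorem ofReal_rpow_eq_lintegral {R q : ℝ} (hR : 0 ≤ R) (hq : 0 < q) :
    ENNReal.ofReal (R ^ q) = ENNReal.ofReal q * ∫⁻ t in Set.Ioi (0 : ℝ),
      (if t < R then 1 else 0) * ENNReal.ofReal (t ^ (q - 1)) := by
  have := lintegral_rpow_eq_lintegral_meas_lt_mul (Measure.dirac ()) (f := fun _ => R)
    (by filter_upwards with x using hR) (by fun_prop) hq
  rw [lintegral_dirac] at this
  rw [this]
  congr 1
  refine lintegral_congr fun t => ?_
  congr 1
  split_ifs with h <;> simp [h]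

/-- Decomposition of a nonnegative `L^q` function into pieces adapted to sets of measure `2^m`. -/
theorem exists_level_sets {X : Type*} [MeasurableSpace X] {μ : Measure X} {f : X → ℝ}
    (hf0 : ∀ x, 0 ≤ f x) (hf : Measurable f) {q : ℝ} (hq : 0 < q)
    (hfq : ∫⁻ x, ENNReal.ofReal (f x ^ q) ∂μ ≠ ∞) :
    ∃ (E : ℤ → Set X) (c : ℤ → ℝ), (∀ m, MeasurableSet (E m)) ∧
      Pairwise (Function.onFun Disjoint E) ∧ (∀ᵐ x ∂μ, f x ≠ 0 → ∃ m, x ∈ E m) ∧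
      (∀ m, 0 ≤ c m) ∧ (∀ m, ∀ x ∈ E m, f x ≤ c m * 2 ^ (-(m / q) : ℝ)) ∧
      (∀ m, μ (E m) ≤ ENNReal.ofReal (2 * 2 ^ (m : ℝ))) ∧
      ∑' m, ENNReal.ofReal (c m) ^ q ≤ 2 * ∫⁻ x, ENNReal.ofReal (f x ^ q) ∂μ := by
  set S : ℤ → Set ℝ := fun m => {h | 0 ≤ h ∧ μ {x | h < f x} ≤ ENNReal.ofReal (2 ^ (m : ℝ))} with hS
  set I := ∫⁻ x, ENNReal.ofReal (f x ^ q) ∂μ with hI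
  have hfin : ∀ h : ℝ, 0 < h → μ {x | h < f x} ≤ I / ENNReal.ofReal (h ^ q) := fun h hh => by
    have h1 := meas_ge_le_lintegral_div (μ := μ) (f := fun x => ENNReal.ofReal (f x ^ q))
      (by fun_prop) (ε := ENNReal.ofReal (h ^ q)) (by simp; positivity) ENNReal.ofReal_ne_top
    refine (measure_mono fun x hx => ?_).trans h1
    exact ENNReal.ofReal_le_ofReal (Real.rpow_le_rpow hh.le (le_of_lt hx) hq.le)
  have hbdd : ∀ m, BddBelow (S m) := fun m => ⟨0, fun h hh => hh.1⟩
  have hne : ∀ m, (S m).Nonempty := fun m => by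
    set B : ℝ := I.toReal / 2 ^ (m : ℝ) + 1 with hB
    have hB0 : 0 < B := by positivity
    refine ⟨B ^ (1 / q), by positivity, (hfin _ (by positivity)).trans ?_⟩
    rw [← Real.rpow_mul hB0.le, one_div_mul_cancel hq.ne', Real.rpow_one,
      ← ENNReal.ofReal_toReal hfq, ← ENNReal.ofReal_div_of_pos hB0]
    refine ENNReal.ofReal_le_ofReal ?_
    rw [div_le_iff₀ hB0, hB, mul_add, mul_div_cancel₀ _ (by positivity)]
    have : (0 : ℝ) < 2 ^ (m : ℝ) := by positivity
    linarith
  set R : ℤ → ℝ := fun m => sInf (S m) with hR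
  have hR0 : ∀ m, 0 ≤ R m := fun m => le_csInf (hne m) fun h hh => hh.1
  have hmeas : ∀ m, μ {x | R m < f x} ≤ ENNReal.ofReal (2 ^ (m : ℝ)) := fun m => by
    have : {x | R m < f x} = ⋃ n : ℕ, {x | R m + 1 / ((n : ℝ) + 1) < f x} := by
      ext x
      simp only [Set.mem_ofPred_eq, Set.mem_iUnion]
      constructor
      · intro h
        obtain ⟨n, hn⟩ := exists_nat_one_div_lt (sub_pos.2 h)
        exact ⟨n, by linarith⟩
      · rintro ⟨n, hn⟩
        have : 0 < 1 / ((n : ℝ) + 1) := by positivity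
        linarith
    rw [this, Monotone.measure_iUnion]
    · refine iSup_le fun n => ?_
      have : 0 < 1 / ((n : ℝ) + 1) := by positivity
      obtain ⟨h, hh, hlt⟩ :=
        exists_lt_of_csInf_lt (hne m) (show R m < R m + 1 / ((n : ℝ) + 1) by linarith)
      exact (measure_mono fun x hx => hlt.trans hx).trans hh.2
    · intro a b hab x hx
      simp only [Set.mem_ofPred_eq] at hx ⊢
      have : 1 / ((b : ℝ) + 1) ≤ 1 / ((a : ℝ) + 1) := by gcongr
      linarith
  have hanti : Antitone R := fun a b hab => by
    refine csInf_le_csInf (hbdd _) (hne _) fun h hh => ⟨hh.1, hh.2.trans ?_⟩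
    exact ENNReal.ofReal_le_ofReal
      (Real.rpow_le_rpow_of_exponent_le (by norm_num) (by exact_mod_cast hab))
  have hlow : ∀ m h, 0 ≤ h → h < R m → ENNReal.ofReal (2 ^ (m : ℝ)) < μ {x | h < f x} :=
    fun m h h0 hlt => by
      by_contra hc
      exact notMem_of_lt_csInf hlt (hbdd m) ⟨h0, not_lt.1 hc⟩
  refine ⟨fun m => {x | R (m + 1) < f x ∧ f x ≤ R m}, fun m => R m * 2 ^ (m / q : ℝ), fun m => ?_,
    ?_, ?_, fun m => mul_nonneg (hR0 m) (by positivity), fun m x hx => ?_, fun m => ?_, ?_⟩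
  · exact (measurableSet_lt measurable_const hf).inter (measurableSet_le hf measurable_const)
  · have key : ∀ m n : ℤ, m < n → Disjoint {x | R (m + 1) < f x ∧ f x ≤ R m}
        {x | R (n + 1) < f x ∧ f x ≤ R n} := fun m n hmn => by
      rw [Set.disjoint_left]
      rintro x ⟨h1, -⟩ ⟨-, h2⟩
      have := hanti (show m + 1 ≤ n by omega)
      linarith
    intro m n hmn
    rcases lt_or_gt_of_ne hmn with h | h
    · exact key m n h
    · exact (key n m h).symm
  · have hnull : μ {x | ∀ m, R m < f x} = 0 := by
      refine nonpos_iff_eq_zero.1 (le_of_tendsto_of_tendsto' (f := fun _ => μ {x | ∀ m, R m < f x})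
        tendsto_const_nhds (b := atTop)
          (g := fun n : ℕ => ENNReal.ofReal (2 ^ (((-(n : ℤ)) : ℤ) : ℝ))) ?_
        fun n => (measure_mono fun x (hx : ∀ m, R m < f x) => hx (-(n : ℤ))).trans
          (hmeas (-(n : ℤ))))
      rw [← ENNReal.ofReal_zero]
      refine ENNReal.tendsto_ofReal ?_
      have : (fun n : ℕ => (2 : ℝ) ^ (((-(n : ℤ)) : ℤ) : ℝ)) = fun n : ℕ => (2⁻¹ : ℝ) ^ n := by
        ext n; rw [Real.rpow_intCast]; simp
      rw [this]
      exact tendsto_pow_atTop_nhds_zero_of_lt_one (by norm_num) (by norm_num)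
    have : ∀ᵐ x ∂μ, ¬ ∀ m, R m < f x := by simpa [ae_iff] using hnull
    filter_upwards [this] with x hx hx0
    push Not at hx
    obtain ⟨m0, hm0⟩ := hx
    have hpos : 0 < f x := lt_of_le_of_ne (hf0 x) (Ne.symm hx0)
    have hex : ∃ m, R m < f x := by
      have hM : μ {y | f x / 2 < f y} ≠ ∞ := ne_top_of_le_ne_top
        (ENNReal.div_ne_top hfq (by simp; positivity)) (hfin _ (half_pos hpos))
      obtain ⟨n, hn⟩ := exists_nat_gt (μ {y | f x / 2 < f y}).toReal
      refine ⟨n, (csInf_le (hbdd _) ⟨(half_pos hpos).le, ?_⟩).trans_lt (half_lt_self hpos)⟩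
      rw [← ENNReal.ofReal_toReal hM]
      refine ENNReal.ofReal_le_ofReal (hn.le.trans ?_)
      rw [Real.rpow_intCast, zpow_natCast]
      exact_mod_cast Nat.lt_two_pow_self.le
    obtain ⟨m, hm, hleast⟩ := Int.exists_least_of_bdd (P := fun m => R m < f x)
      ⟨m0, fun z hz => by
        by_contra hc
        have := hanti (not_le.1 hc).le
        linarith⟩ hex
    refine ⟨m - 1, by simpa using hm, ?_⟩
    by_contra hc
    have := hleast (m - 1) (not_le.1 hc)
    omega
  · rw [mul_assoc, ← Real.rpow_add (by norm_num)]
    simpa using hx.2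
  · refine (measure_mono fun x hx => hx.1).trans ((hmeas (m + 1)).trans (le_of_eq ?_))
    push_cast
    rw [Real.rpow_add (by norm_num), Real.rpow_one, mul_comm]
  · have h1 : ∀ m : ℤ, ENNReal.ofReal (R m * 2 ^ (m / q : ℝ)) ^ q = ENNReal.ofReal q *
        ∫⁻ t in Set.Ioi (0 : ℝ), ENNReal.ofReal (2 ^ (m : ℝ)) *
          ((if t < R m then 1 else 0) * ENNReal.ofReal (t ^ (q - 1))) := fun m => by
      rw [ENNReal.ofReal_rpow_of_nonneg (mul_nonneg (hR0 m) (by positivity)) hq.le,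
        Real.mul_rpow (hR0 m) (by positivity), ← Real.rpow_mul (by norm_num),
        div_mul_cancel₀ _ hq.ne', mul_comm, ENNReal.ofReal_mul (by positivity),
        ofReal_rpow_eq_lintegral (hR0 m) hq, lintegral_const_mul' _ _ ENNReal.ofReal_ne_top]
      ring
    simp_rw [h1]
    rw [ENNReal.tsum_mul_left, ← lintegral_tsum]
    · rw [hI, lintegral_rpow_eq_lintegral_meas_lt_mul μ (by filter_upwards with x using hf0 x)
        hf.aemeasurable hq, mul_left_comm]
      gcongr
      rw [← lintegral_const_mul' _ _ (by norm_num)]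
      refine setLIntegral_mono' measurableSet_Ioi fun t ht => ?_
      rw [← mul_assoc]
      simp_rw [← mul_assoc]
      rw [ENNReal.tsum_mul_right]
      gcongr
      refine le_trans (ENNReal.tsum_le_tsum fun m => ?_) (tsum_two_rpow_indicator_le _)
      split_ifs with h
      · rw [Set.indicator_of_mem]
        · simp
        · exact hlow m t (le_of_lt ht) h
      · simp
    · intro m
      refine Measurable.aemeasurable ?_
      refine Measurable.const_mul (Measurable.mul ?_ (by fun_prop)) _
      exact Measurable.ite measurableSet_Iio measurable_const measurable_const

theorem tsum_sq_le {ι : Type*} {a : ι → ℝ≥0∞} {q : ℝ} (hq : 0 < q) (hq2 : q ≤ 2) :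
    ∑' i, a i ^ (2 : ℝ) ≤ (∑' i, a i ^ q) ^ (2 / q) := by
  set S := ∑' i, a i ^ q with hS
  have h1 : ∀ i, a i ^ (2 : ℝ) ≤ a i ^ q * S ^ ((2 - q) / q) := fun i => by
    have : a i ≤ S ^ (1 / q) := by
      have := ENNReal.rpow_le_rpow (ENNReal.le_tsum (f := fun i => a i ^ q) i)
        (show 0 ≤ 1 / q by positivity)
      rwa [← ENNReal.rpow_mul, mul_one_div_cancel hq.ne', ENNReal.rpow_one] at this
    calc a i ^ (2 : ℝ) = a i ^ q * a i ^ (2 - q) := by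
          rw [← ENNReal.rpow_add_of_nonneg _ _ hq.le (by linarith)]; congr 1; ring
      _ ≤ a i ^ q * (S ^ (1 / q)) ^ (2 - q) := by gcongr
      _ = _ := by rw [← ENNReal.rpow_mul]; congr 2; ring
  refine (ENNReal.tsum_le_tsum h1).trans (le_of_eq ?_)
  rw [ENNReal.tsum_mul_right, ← hS]
  nth_rw 1 [← ENNReal.rpow_one S]
  rw [← ENNReal.rpow_add_of_nonneg _ _ zero_le_one (div_nonneg (by linarith) hq.le)]
  congr 1
  field_simp
  ring

theorem eLpNorm_ofReal_eq {X : Type*} [MeasurableSpace X] {μ : Measure X} {E : Type*}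
    [NormedAddCommGroup E] (f : X → E) {q : ℝ} (hq : 0 < q) :
    eLpNorm f (ENNReal.ofReal q) μ = (∫⁻ x, ENNReal.ofReal (‖f x‖ ^ q) ∂μ) ^ (1 / q) := by
  rw [eLpNorm_eq_lintegral_rpow_enorm_toReal (by simpa using hq) ENNReal.ofReal_ne_top,
    ENNReal.toReal_ofReal hq.le]
  congr 1
  refine lintegral_congr fun x => ?_
  rw [← ENNReal.ofReal_rpow_of_nonneg (norm_nonneg _) hq.le, ofReal_norm]

/-- Atomic decomposition of an `L^2 ∩ L^q` function. -/
theorem exists_atoms {X : Type*} [MeasurableSpace X] {μ : Measure X} {q : ℝ} (hq : 1 ≤ q)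
    (hq2 : q ≤ 2) (f : Lp ℂ 2 μ) (hf : eLpNorm f (ENNReal.ofReal q) μ ≠ ∞) :
    ∃ (a : ℤ → Lp ℂ 2 μ) (c : ℤ → ℝ), HasSum a f ∧ (∀ s : Finset ℤ, ‖∑ m ∈ s, a m‖ ≤ ‖f‖) ∧
      (∀ m, 0 ≤ c m) ∧
      (∀ m, eLpNorm (a m) 1 μ ≤ ENNReal.ofReal (2 * c m * 2 ^ (m * (1 - 1 / q) : ℝ))) ∧
      (∀ m, ‖a m‖ₑ ≤ ENNReal.ofReal (2 * c m * 2 ^ (m * (1 / 2 - 1 / q) : ℝ))) ∧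
      (∑' m, ENNReal.ofReal (c m) ^ (2 : ℝ)) ^ (1 / 2 : ℝ) ≤
        2 * eLpNorm f (ENNReal.ofReal q) μ := by
  have hq0 : 0 < q := by linarith
  have hfm : StronglyMeasurable (f : X → ℂ) := Lp.stronglyMeasurable f
  have hfq : ∫⁻ x, ENNReal.ofReal (‖f x‖ ^ q) ∂μ ≠ ∞ := by
    intro h
    rw [eLpNorm_ofReal_eq _ hq0, h] at hf
    exact hf (ENNReal.top_rpow_of_pos (by positivity))
  obtain ⟨E, c, hE, hdis, hcov, hc0, hcf, hμE, hsum⟩ := exists_level_sets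
    (f := fun x => ‖f x‖) (fun x => norm_nonneg _) hfm.norm.measurable hq0 hfq
  have hmem : ∀ m, MemLp ((E m).indicator f) 2 μ := fun m => (Lp.memLp f).indicator (hE m)
  set a : ℤ → Lp ℂ 2 μ := fun m => (hmem m).toLp _ with ha
  have hcoe : ∀ m, ⇑(a m) =ᵐ[μ] (E m).indicator f := fun m => (hmem m).coeFn_toLp
  have hcoes : ∀ s : Finset ℤ, ⇑(∑ m ∈ s, a m) =ᵐ[μ] (⋃ m ∈ s, E m).indicator f := fun s => by
    refine (Lp.coeFn_finsetSum s a).trans ?_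
    have : ∀ᵐ x ∂μ, ∀ m ∈ s, a m x = (E m).indicator f x :=
      (ae_ball_iff s.countable_toSet).2 fun m _ => hcoe m
    filter_upwards [this] with x hx
    rw [Finset.sum_apply, Finset.sum_congr rfl hx,
      Finset.indicator_biUnion_apply _ _ fun i _ j _ hij => hdis hij]
  refine ⟨a, c, ?_, fun s => ?_, hc0, fun m => ?_, fun m => ?_, ?_⟩
  · rw [HasSum, SummationFilter.unconditional_filter, Lp.tendsto_Lp_iff_tendsto_eLpNorm']
    have h1 : ∀ s : Finset ℤ, eLpNorm (⇑(∑ m ∈ s, a m) - ⇑f) 2 μ =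
        (∫⁻ x, ‖(⋃ m ∈ s, E m).indicator f x - f x‖ₑ ^ (2 : ℝ) ∂μ) ^ (1 / 2 : ℝ) := fun s => by
      rw [eLpNorm_eq_lintegral_rpow_enorm_toReal (by norm_num) (by norm_num)]
      simp only [ENNReal.toReal_ofNat]
      congr 1
      refine lintegral_congr_ae ?_
      filter_upwards [hcoes s] with x hx
      simp only [Pi.sub_apply, hx]
    simp_rw [h1]
    have h2 : Tendsto (fun s : Finset ℤ =>
        ∫⁻ x, ‖(⋃ m ∈ s, E m).indicator f x - f x‖ₑ ^ (2 : ℝ) ∂μ) atTop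
        (nhds (∫⁻ x, 0 ∂μ)) := by
      refine tendsto_lintegral_filter_of_dominated_convergence (fun x => ‖f x‖ₑ ^ (2 : ℝ))
        ?_ ?_ ?_ ?_
      · refine Eventually.of_forall fun s => ?_
        have := (hfm.indicator (s.measurableSet_biUnion fun m _ => hE m)).measurable
        have h3 := hfm.measurable
        fun_prop
      · refine Eventually.of_forall fun s => Eventually.of_forall fun x => ?_
        rcases Set.indicator_eq_zero_or_self (⋃ m ∈ s, E m) f x with h | h <;> rw [h] <;> simp
      · have := (Lp.memLp f).eLpNorm_lt_top
        rw [eLpNorm_eq_lintegral_rpow_enorm_toReal (by norm_num) (by norm_num)] at this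
        simp only [ENNReal.toReal_ofNat] at this
        exact fun h => by
          rw [h, ENNReal.top_rpow_of_pos (by norm_num)] at this
          exact lt_irrefl _ this
      · filter_upwards [hcov] with x hx
        refine tendsto_const_nhds.congr' ?_
        by_cases h0 : f x = 0
        · refine Eventually.of_forall fun s => ?_
          have h1 : (⋃ m ∈ s, E m).indicator f x = 0 := Set.indicator_apply_eq_zero.2 fun _ => h0
          simp only [h1, h0]
          simp
        · obtain ⟨m, hm⟩ := hx (by simpa using h0)
          filter_upwards [eventually_ge_atTop {m}] with s hs
          rw [Set.indicator_of_mem]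
          · simp
          · exact Set.mem_biUnion (hs (Finset.mem_singleton_self m)) hm
    have h4 := h2.ennrpow_const (1 / 2 : ℝ)
    simpa using h4
  · rw [Lp.norm_def, Lp.norm_def]
    refine ENNReal.toReal_mono (Lp.eLpNorm_ne_top f) ?_
    rw [eLpNorm_congr_ae (hcoes s)]
    exact eLpNorm_indicator_le _
  · rw [eLpNorm_congr_ae (hcoe m), eLpNorm_one_eq_lintegral_enorm]
    calc ∫⁻ x, ‖(E m).indicator f x‖ₑ ∂μ
        = ∫⁻ x in E m, ‖f x‖ₑ ∂μ := by
          rw [← lintegral_indicator (hE m)]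
          refine lintegral_congr fun x => ?_
          rw [enorm_indicator_eq_indicator_enorm]
      _ ≤ ∫⁻ x in E m, ENNReal.ofReal (c m * 2 ^ (-(m / q) : ℝ)) ∂μ := by
          refine setLIntegral_mono' (hE m) fun x hx => ?_
          rw [← ofReal_norm]
          exact ENNReal.ofReal_le_ofReal (hcf m x hx)
      _ ≤ ENNReal.ofReal (c m * 2 ^ (-(m / q) : ℝ)) * ENNReal.ofReal (2 * 2 ^ (m : ℝ)) := by
          rw [setLIntegral_const]
          gcongr
          exact hμE m
      _ = _ := by
          rw [← ENNReal.ofReal_mul (mul_nonneg (hc0 m) (by positivity))]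
          congr 1
          rw [show (m * (1 - 1 / q) : ℝ) = -(m / q) + m by ring, Real.rpow_add (by norm_num)]
          ring
  · rw [Lp.enorm_def, eLpNorm_congr_ae (hcoe m),
      eLpNorm_eq_lintegral_rpow_enorm_toReal (by norm_num) (by norm_num)]
    simp only [ENNReal.toReal_ofNat]
    have hB : 0 ≤ c m * 2 ^ (-(m / q) : ℝ) := mul_nonneg (hc0 m) (by positivity)
    have : ∫⁻ x, ‖(E m).indicator f x‖ₑ ^ (2 : ℝ) ∂μ ≤
        ENNReal.ofReal ((2 * c m * 2 ^ (m * (1 / 2 - 1 / q) : ℝ)) ^ (2 : ℝ)) := by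
      calc ∫⁻ x, ‖(E m).indicator f x‖ₑ ^ (2 : ℝ) ∂μ
          = ∫⁻ x in E m, ‖f x‖ₑ ^ (2 : ℝ) ∂μ := by
            rw [← lintegral_indicator (hE m)]
            refine lintegral_congr fun x => ?_
            by_cases hx : x ∈ E m <;> simp [hx]
        _ ≤ ∫⁻ x in E m, ENNReal.ofReal (c m * 2 ^ (-(m / q) : ℝ)) ^ (2 : ℝ) ∂μ := by
            refine setLIntegral_mono' (hE m) fun x hx => ?_
            rw [← ofReal_norm]
            exact ENNReal.rpow_le_rpow (ENNReal.ofReal_le_ofReal (hcf m x hx)) (by norm_num)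
        _ ≤ ENNReal.ofReal (c m * 2 ^ (-(m / q) : ℝ)) ^ (2 : ℝ) *
              ENNReal.ofReal (2 * 2 ^ (m : ℝ)) := by
            rw [setLIntegral_const]
            gcongr
            exact hμE m
        _ ≤ _ := by
            rw [ENNReal.ofReal_rpow_of_nonneg hB (by norm_num),
              ← ENNReal.ofReal_mul (by positivity)]
            refine ENNReal.ofReal_le_ofReal ?_
            rw [Real.mul_rpow (hc0 m) (by positivity),
              Real.mul_rpow (mul_nonneg zero_le_two (hc0 m))
              (by positivity), Real.mul_rpow zero_le_two (hc0 m), ← Real.rpow_mul (by norm_num),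
              ← Real.rpow_mul (by norm_num),
              show (m * (1 / 2 - 1 / q) * 2 : ℝ) = -(m / q) * 2 + m by ring,
                Real.rpow_add (by norm_num)]
            have h5 : 0 ≤ c m ^ (2 : ℝ) * 2 ^ (-(m / q) * 2 : ℝ) * 2 ^ (m : ℝ) :=
              mul_nonneg (mul_nonneg (Real.rpow_nonneg (hc0 m) _) (by positivity)) (by positivity)
            norm_num at h5 ⊢
            linarith
    refine (ENNReal.rpow_le_rpow this (by norm_num)).trans (le_of_eq ?_)
    have h6 : 0 ≤ 2 * c m * 2 ^ (m * (1 / 2 - 1 / q) : ℝ) :=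
      mul_nonneg (mul_nonneg zero_le_two (hc0 m)) (by positivity)
    rw [ENNReal.ofReal_rpow_of_nonneg (by positivity) (by norm_num), ← Real.rpow_mul h6]
    norm_num
  · refine (ENNReal.rpow_le_rpow (tsum_sq_le hq0 hq2) (by norm_num)).trans ?_
    refine (ENNReal.rpow_le_rpow (ENNReal.rpow_le_rpow hsum (by positivity)) (by norm_num)).trans ?_
    rw [← ENNReal.rpow_mul, eLpNorm_ofReal_eq _ hq0, show 2 / q * (1 / 2) = 1 / q by ring,
      ENNReal.mul_rpow_of_nonneg _ _ (by positivity)]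
    gcongr
    nth_rw 2 [← ENNReal.rpow_one 2]
    refine ENNReal.rpow_le_rpow_of_exponent_le (by norm_num) ?_
    rw [div_le_one hq0]
    exact hq

theorem _root_.HasSum.enorm_le {ι E : Type*} [NormedAddCommGroup E] {f : ι → E} {a : E}
    (h : HasSum f a) : ‖a‖ₑ ≤ ∑' i, ‖f i‖ₑ := by
  refine le_of_tendsto h.enorm (Eventually.of_forall fun s => ?_)
  exact (enorm_sum_le _ _).trans (ENNReal.sum_le_tsum s)

theorem enorm_inner_le_tsum {ι κ H : Type*} [NormedAddCommGroup H] [InnerProductSpace ℂ H]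
    {u : ι → H} {v : κ → H} {x y : H} (hu : HasSum u x) (hv : HasSum v y) :
    ‖inner ℂ y x‖ₑ ≤ ∑' i, ∑' j, ‖inner ℂ (v j) (u i)‖ₑ := by
  have h1 : HasSum (fun i => inner ℂ y (u i)) (inner ℂ y x) := (innerSL ℂ y).hasSum hu
  refine h1.enorm_le.trans (ENNReal.tsum_le_tsum fun i => ?_)
  have h2 : HasSum (fun j => inner ℂ (u i) (v j)) (inner ℂ (u i) y) := (innerSL ℂ (u i)).hasSum hv
  have h3 : ∀ a b : H, ‖inner ℂ a b‖ₑ = ‖inner ℂ b a‖ₑ := fun a b => by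
    rw [← ofReal_norm, ← ofReal_norm, norm_inner_symm]
  rw [h3]
  refine h2.enorm_le.trans (ENNReal.tsum_le_tsum fun j => ?_)
  rw [h3]

theorem enorm_inner_le {H : Type*} [NormedAddCommGroup H] [InnerProductSpace ℂ H] (x y : H) :
    ‖inner ℂ x y‖ₑ ≤ ‖x‖ₑ * ‖y‖ₑ := by
  rw [← ofReal_norm, ← ofReal_norm, ← ofReal_norm, ← ENNReal.ofReal_mul (norm_nonneg _)]
  exact ENNReal.ofReal_le_ofReal (norm_inner_le_norm _ _)

theorem enorm_map_le {E H : Type*} [NormedAddCommGroup E] [NormedSpace ℂ E] [NormedAddCommGroup H]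
    [NormedSpace ℂ H] {S : E →L[ℂ] H} (hS : ∀ f, ‖S f‖ ≤ ‖f‖) (f : E) : ‖S f‖ₑ ≤ ‖f‖ₑ := by
  rw [← ofReal_norm, ← ofReal_norm]
  exact ENNReal.ofReal_le_ofReal (hS f)

/-- Interpolation between an `L^2` bound and an `L^1` bound for a sesquilinear form. -/
theorem interpolate_inner {θ : ℝ} (h0 : 0 ≤ θ) (h1 : θ ≤ 1) :
    ∃ C : ℝ≥0∞, C ≠ ∞ ∧ ∀ {X : Type} [MeasurableSpace X] {μ : Measure X} {H : Type}
      [NormedAddCommGroup H] [InnerProductSpace ℂ H] (S T : Lp ℂ 2 μ →L[ℂ] H)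
      (_ : ∀ f, ‖S f‖ ≤ ‖f‖) (_ : ∀ f, ‖T f‖ ≤ ‖f‖) (A : ℝ) (_ : 0 < A)
      (_ : ∀ f g, ‖inner ℂ (S g) (T f)‖ₑ ≤ ENNReal.ofReal A * (eLpNorm f 1 μ * eLpNorm g 1 μ))
      (f g : Lp ℂ 2 μ) (_ : eLpNorm f (ENNReal.ofReal (2 / (1 + θ))) μ ≠ ∞)
      (_ : eLpNorm g (ENNReal.ofReal (2 / (1 + θ))) μ ≠ ∞),
      ‖inner ℂ (S g) (T f)‖ₑ ≤ C * ENNReal.ofReal (A ^ θ) *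
        (eLpNorm f (ENNReal.ofReal (2 / (1 + θ))) μ *
          eLpNorm g (ENNReal.ofReal (2 / (1 + θ))) μ) := by
  rcases h0.eq_or_lt with rfl | h0
  · refine ⟨1, by simp, ?_⟩
    intro X _ μ H _ _ S T hS hT A hA hb f g hf hg
    simp only [add_zero, div_one, Real.rpow_zero, ENNReal.ofReal_one, mul_one, one_mul,
      ENNReal.ofReal_ofNat]
    rw [← Lp.enorm_def, ← Lp.enorm_def, mul_comm]
    exact (enorm_inner_le _ _).trans (mul_le_mul' (enorm_map_le hS g) (enorm_map_le hT f))
  rcases h1.eq_or_lt with rfl | h1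
  · refine ⟨1, by simp, ?_⟩
    intro X _ μ H _ _ S T hS hT A hA hb f g hf hg
    have : (2 : ℝ) / (1 + 1) = 1 := by norm_num
    simp only [this, Real.rpow_one, ENNReal.ofReal_one, one_mul]
    exact hb f g
  set q : ℝ := 2 / (1 + θ) with hq
  have hq1 : 1 ≤ q := by rw [hq, le_div_iff₀ (by linarith)]; linarith
  have hq2 : q ≤ 2 := by rw [hq, div_le_iff₀ (by linarith)]; linarith
  have hqi : 1 / q = (1 + θ) / 2 := by rw [hq, one_div_div]
  set ε := min θ (1 - θ) with hε
  have hε0 : 0 < ε := lt_min h0 (by linarith)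
  have hε1 : ε ≤ θ := min_le_left _ _
  have hε2 : ε ≤ 1 - θ := min_le_right _ _
  obtain ⟨C, hC, hsum⟩ := tsum_two_rpow_abs (half_pos hε0)
  refine ⟨16 * C, ENNReal.mul_ne_top (by norm_num) hC, ?_⟩
  intro X _ μ H _ _ S T hS hT A hA hb f g hf hg
  obtain ⟨a, c, hsa, -, hc0, ha1, ha2, hcs⟩ := exists_atoms hq1 hq2 f hf
  obtain ⟨b, d, hsb, -, hd0, hb1, hb2, hds⟩ := exists_atoms hq1 hq2 g hg
  rw [hqi] at ha1 ha2 hb1 hb2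
  set L := Real.logb 2 A with hL
  have hAL : A = 2 ^ L := (Real.rpow_logb (by norm_num) (by norm_num) hA).symm
  set w : ℤ → ℤ → ℝ≥0∞ := fun m n => ENNReal.ofReal (2 ^ (-(ε / 2 * |-(2 * L + n) - m|))) with hw
  have key : ∀ m n, ‖inner ℂ (S (b n)) (T (a m))‖ₑ ≤ 4 * ENNReal.ofReal (A ^ θ) *
      (w m n * ENNReal.ofReal (c m) * ENNReal.ofReal (d n)) := fun m n => by
    set z : ℝ := L + (m + n) / 2 with hz
    have habs : |-(2 * L + n) - m| = 2 * |z| := by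
      rw [show -(2 * L + n) - m = -(2 * z) by rw [hz]; ring, abs_neg, abs_mul]; norm_num
    have hcd : 0 ≤ c m * d n := mul_nonneg (hc0 m) (hd0 n)
    have hR : 4 * ENNReal.ofReal (A ^ θ) * (w m n * ENNReal.ofReal (c m) * ENNReal.ofReal (d n)) =
        ENNReal.ofReal (4 * (c m * d n) * 2 ^ (L * θ + -(ε * |z|))) := by
      rw [hw]
      simp only
      rw [habs, hAL, ← Real.rpow_mul (by norm_num), mul_assoc (ENNReal.ofReal _),
        ← ENNReal.ofReal_mul (hc0 m), ← ENNReal.ofReal_mul (by positivity),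
        show (4 : ℝ≥0∞) = ENNReal.ofReal 4 by norm_num, ← ENNReal.ofReal_mul (by norm_num),
        ← ENNReal.ofReal_mul (by positivity), Real.rpow_add (by norm_num)]
      congr 1
      rw [show ε / 2 * (2 * |z|) = ε * |z| by ring]
      ring
    rw [hR]
    rcases le_total 0 z with h | h
    · refine (enorm_inner_le _ _).trans ((mul_le_mul' ((enorm_map_le hS _).trans (hb2 n))
        ((enorm_map_le hT _).trans (ha2 m))).trans ?_)
      rw [← ENNReal.ofReal_mul (mul_nonneg (mul_nonneg zero_le_two (hd0 n)) (by positivity))]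
      refine ENNReal.ofReal_le_ofReal ?_
      rw [show ∀ x y : ℝ, 2 * d n * x * (2 * c m * y) = 4 * (c m * d n) * (x * y) by intros; ring,
        ← Real.rpow_add (by norm_num)]
      refine mul_le_mul_of_nonneg_left (Real.rpow_le_rpow_of_exponent_le (by norm_num) ?_)
        (mul_nonneg (by norm_num) hcd)
      rw [abs_of_nonneg h]
      have : ε * z ≤ θ * z := mul_le_mul_of_nonneg_right hε1 h
      rw [hz] at this ⊢
      linarith
    · refine (hb _ _).trans ((mul_le_mul_right (mul_le_mul' (ha1 m) (hb1 n)) _).trans ?_)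
      rw [← ENNReal.ofReal_mul (mul_nonneg (mul_nonneg zero_le_two (hc0 m)) (by positivity)),
        ← ENNReal.ofReal_mul hA.le]
      refine ENNReal.ofReal_le_ofReal ?_
      rw [show ∀ x y : ℝ, A * (2 * c m * x * (2 * d n * y)) = 4 * (c m * d n) * (A * (x * y)) by
        intros; ring, hAL, ← Real.rpow_add (by norm_num), ← Real.rpow_add (by norm_num)]
      refine mul_le_mul_of_nonneg_left (Real.rpow_le_rpow_of_exponent_le (by norm_num) ?_)
        (mul_nonneg (by norm_num) hcd)
      rw [abs_of_nonpos h]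
      have : (1 - θ) * z ≤ ε * z := mul_le_mul_of_nonpos_right hε2 h
      rw [hz] at this ⊢
      linarith
  calc ‖inner ℂ (S g) (T f)‖ₑ ≤ ∑' m, ∑' n, ‖inner ℂ (S (b n)) (T (a m))‖ₑ :=
        enorm_inner_le_tsum (T.hasSum hsa) (S.hasSum hsb)
    _ ≤ ∑' m, ∑' n, 4 * ENNReal.ofReal (A ^ θ) *
          (w m n * ENNReal.ofReal (c m) * ENNReal.ofReal (d n)) :=
        ENNReal.tsum_le_tsum fun m => ENNReal.tsum_le_tsum fun n => key m n
    _ = 4 * ENNReal.ofReal (A ^ θ) *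
          ∑' m, ∑' n, w m n * ENNReal.ofReal (c m) * ENNReal.ofReal (d n) := by
        simp_rw [ENNReal.tsum_mul_left]
    _ ≤ 4 * ENNReal.ofReal (A ^ θ) * (C * ((2 * eLpNorm f (ENNReal.ofReal q) μ) *
          (2 * eLpNorm g (ENNReal.ofReal q) μ))) := by
        refine mul_le_mul_right ((schur_tsum (fun m => ?_) fun n => hsum _).trans
          (mul_le_mul_right (mul_le_mul' hcs hds) _)) _
        refine le_trans (le_of_eq (tsum_congr fun n => ?_)) (hsum (-(2 * L + m)))
        rw [show -(2 * L + (n : ℝ)) - m = -(2 * L + m) - n by ring]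
    _ = _ := by ring

theorem lintegral_comp_abs (f : ℝ → ℝ≥0∞) :
    ∫⁻ x, f |x| = 2 * ∫⁻ x in Set.Ioi 0, f x := by
  have h1 : ∫⁻ x in Set.Ioi 0, f |x| = ∫⁻ x in Set.Ioi 0, f x :=
    setLIntegral_congr_fun measurableSet_Ioi fun x hx => by
      simp only [abs_of_pos (Set.mem_Ioi.1 hx)]
  have h2 : ∫⁻ x in Set.Iio 0, f |x| = ∫⁻ x in Set.Ioi 0, f x := by
    rw [← h1, ← lintegral_indicator measurableSet_Iio, ← lintegral_indicator measurableSet_Ioi,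
      ← lintegral_neg_eq_self]
    refine lintegral_congr fun x => ?_
    simp [Set.indicator]
  have h3 : ∫⁻ x, f |x| = (∫⁻ x in Set.Iio 0, f |x|) + ∫⁻ x in Set.Ici 0, f |x| := by
    rw [← Set.compl_Iio]
    exact (lintegral_add_compl (fun x => f |x|) measurableSet_Iio).symm
  have h4 : ∫⁻ x in Set.Ici 0, f |x| = ∫⁻ x in Set.Ioi 0, f x :=
    (setLIntegral_congr Ioi_ae_eq_Ici.symm).trans h1
  rw [h3, h2, h4, two_mul]

theorem lintegral_sub_abs (f : ℝ → ℝ≥0∞) (t : ℝ) :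
    ∫⁻ x, f |t - x| = 2 * ∫⁻ x in Set.Ioi 0, f x := by
  rw [← lintegral_comp_abs, lintegral_sub_left_eq_self (fun x => f |x|) t]

theorem lintegral_rpow_near {a δ : ℝ} (ha : a < 1) (hδ : 0 < δ) (t : ℝ) :
    ∫⁻ x, (if |t - x| ≤ δ then ENNReal.ofReal (|t - x| ^ (-a)) else 0) =
      ENNReal.ofReal (2 / (1 - a) * δ ^ (1 - a)) := by
  rw [lintegral_sub_abs (fun y => if y ≤ δ then ENNReal.ofReal (y ^ (-a)) else 0)]
  have h1 : ∫⁻ x in Set.Ioi 0, (if x ≤ δ then ENNReal.ofReal (x ^ (-a)) else 0) =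
      ∫⁻ x in Set.Ioc 0 δ, ENNReal.ofReal (x ^ (-a)) := by
    rw [← lintegral_indicator measurableSet_Ioi, ← lintegral_indicator measurableSet_Ioc]
    refine lintegral_congr fun x => ?_
    by_cases h : 0 < x <;> by_cases h' : x ≤ δ <;> simp [Set.indicator, h, h']
  have h2 := intervalIntegral.intervalIntegrable_rpow' (a := 0) (b := δ) (r := -a) (by linarith)
  rw [h1, ← ofReal_integral_eq_lintegral_ofReal
    ((intervalIntegrable_iff_integrableOn_Ioc_of_le hδ.le).1 h2),
    ← intervalIntegral.integral_of_le hδ.le, integral_rpow (Or.inl (by linarith)),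
    Real.zero_rpow (by linarith), show (2 : ℝ≥0∞) = ENNReal.ofReal 2 by norm_num,
    ← ENNReal.ofReal_mul (by norm_num)]
  · congr 1
    rw [show -a + 1 = 1 - a by ring]
    ring
  · filter_upwards [ae_restrict_mem measurableSet_Ioc] with x hx using Real.rpow_nonneg hx.1.le _

theorem lintegral_rpow_far {a δ : ℝ} (ha : 1 < a) (hδ : 0 < δ) (t : ℝ) :
    ∫⁻ x, (if δ < |t - x| then ENNReal.ofReal (|t - x| ^ (-a)) else 0) =
      ENNReal.ofReal (2 / (a - 1) * δ ^ (1 - a)) := by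
  rw [lintegral_sub_abs (fun y => if δ < y then ENNReal.ofReal (y ^ (-a)) else 0)]
  have h1 : ∫⁻ x in Set.Ioi 0, (if δ < x then ENNReal.ofReal (x ^ (-a)) else 0) =
      ∫⁻ x in Set.Ioi δ, ENNReal.ofReal (x ^ (-a)) := by
    rw [← lintegral_indicator measurableSet_Ioi, ← lintegral_indicator measurableSet_Ioi]
    refine lintegral_congr fun x => ?_
    by_cases h' : δ < x
    · simp [Set.indicator, hδ.trans h', h']
    · simp [Set.indicator, h']
  rw [h1, ← ofReal_integral_eq_lintegral_ofReal (integrableOn_Ioi_rpow_of_lt (by linarith) hδ),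
    integral_Ioi_rpow_of_lt (by linarith) hδ, show (2 : ℝ≥0∞) = ENNReal.ofReal 2 by norm_num,
    ← ENNReal.ofReal_mul (by norm_num)]
  · congr 1
    rw [show -a + 1 = 1 - a by ring, show a - 1 = -(1 - a) by ring, div_neg]
    ring
  · filter_upwards [ae_restrict_mem measurableSet_Ioi] with x hx using
      Real.rpow_nonneg (hδ.trans hx).le _

theorem setLIntegral_rpow_le {l : ℝ} (h0 : 0 < l) (h1 : l < 1) {E : Set ℝ} (m : ℤ)
    (hE : volume E ≤ ENNReal.ofReal (2 * 2 ^ (m : ℝ))) (t : ℝ) :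
    ∫⁻ x in E, ENNReal.ofReal (|t - x| ^ (-l)) ≤
      ENNReal.ofReal ((2 / (1 - l) + 2) * 2 ^ (m * (1 - l) : ℝ)) := by
  have hl : 0 < 1 - l := by linarith
  calc ∫⁻ x in E, ENNReal.ofReal (|t - x| ^ (-l))
      ≤ ∫⁻ x in E, ((if |t - x| ≤ 2 ^ (m : ℝ) then ENNReal.ofReal (|t - x| ^ (-l)) else 0) +
          ENNReal.ofReal ((2 ^ (m : ℝ)) ^ (-l))) := by
        refine lintegral_mono fun x => ?_
        split_ifs with h
        · exact le_self_add
        · rw [zero_add]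
          exact ENNReal.ofReal_le_ofReal
            (Real.rpow_le_rpow_of_nonpos (by positivity) (not_le.1 h).le (by linarith))
    _ ≤ ENNReal.ofReal (2 / (1 - l) * (2 ^ (m : ℝ)) ^ (1 - l)) +
          ENNReal.ofReal ((2 ^ (m : ℝ)) ^ (-l)) * ENNReal.ofReal (2 * 2 ^ (m : ℝ)) := by
        rw [lintegral_add_right _ measurable_const, setLIntegral_const]
        refine add_le_add ((setLIntegral_le_lintegral _ _).trans
          (lintegral_rpow_near h1 (by positivity) t).le) (by gcongr)
    _ = _ := by
        rw [← ENNReal.ofReal_mul (by positivity),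
          ← ENNReal.ofReal_add (by positivity) (by positivity)]
        congr 1
        rw [← Real.rpow_mul (by norm_num), ← Real.rpow_mul (by norm_num),
          show ((m : ℝ) * (1 - l)) = m * (-l) + m by ring, Real.rpow_add (by norm_num)]
        ring

theorem lintegral_lintegral_tsum_tsum {g : ℤ → ℤ → ℝ → ℝ → ℝ≥0∞}
    (hg : ∀ m n, Measurable (Function.uncurry (g m n))) :
    ∫⁻ t, ∫⁻ x, ∑' m, ∑' n, g m n t x = ∑' m, ∑' n, ∫⁻ t, ∫⁻ x, g m n t x := by
  have h1 : ∀ t, ∫⁻ x, ∑' m, ∑' n, g m n t x = ∑' m, ∑' n, ∫⁻ x, g m n t x := fun t => by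
    rw [lintegral_tsum fun m => (Measurable.tsum fun n =>
      (hg m n).of_uncurry_left).aemeasurable]
    exact tsum_congr fun m => lintegral_tsum fun n => (hg m n).of_uncurry_left.aemeasurable
  simp_rw [h1]
  rw [lintegral_tsum fun m => (Measurable.tsum fun n =>
    (hg m n).lintegral_prod_right).aemeasurable]
  exact tsum_congr fun m => lintegral_tsum fun n => (hg m n).lintegral_prod_right.aemeasurable

/-- Hardy–Littlewood–Sobolev inequality on the line, bilinear form. -/
theorem hardy_littlewood_sobolev {l : ℝ} (h0 : 0 < l) (h1 : l < 1) :
    ∃ C : ℝ≥0∞, C ≠ ∞ ∧ ∀ (q : ℝ) (_ : 1 / q = 1 - l / 2) (a b : ℝ → ℝ) (_ : ∀ x, 0 ≤ a x)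
      (_ : ∀ x, 0 ≤ b x) (_ : Measurable a) (_ : Measurable b)
      (_ : ∫⁻ x, ENNReal.ofReal (a x ^ q) ≠ ∞) (_ : ∫⁻ x, ENNReal.ofReal (b x ^ q) ≠ ∞),
      ∫⁻ t, ∫⁻ x, ENNReal.ofReal (|t - x| ^ (-l)) * (ENNReal.ofReal (a x) * ENNReal.ofReal (b t)) ≤
        C * ((∫⁻ x, ENNReal.ofReal (a x ^ q)) ^ (1 / q) *
          (∫⁻ x, ENNReal.ofReal (b x ^ q)) ^ (1 / q)) := by
  obtain ⟨C, hC, hsum⟩ := tsum_two_rpow_abs (half_pos h0)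
  set K : ℝ := 2 * (2 / (1 - l) + 2) with hK
  have hl : 0 < 1 - l := by linarith
  have hK0 : 0 < K := by positivity
  refine ⟨4 * (ENNReal.ofReal K * C), ENNReal.mul_ne_top (by norm_num)
    (ENNReal.mul_ne_top ENNReal.ofReal_ne_top hC), ?_⟩
  intro q hqi a b ha0 hb0 ha hb haq hbq
  have hq0 : 0 < q := by
    rw [← one_div_one_div q, hqi]; exact one_div_pos.2 (by linarith)
  have hq2 : q ≤ 2 := by
    rw [← one_div_one_div q, hqi, div_le_iff₀ (by linarith)]; linarith
  have hqi1 : 1 / q ≤ 1 := by rw [hqi]; linarith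
  obtain ⟨E, c, hE, -, hcovE, hc0, hac, hμE, hcs⟩ := exists_level_sets ha0 ha hq0 haq
  obtain ⟨G, d, hG, -, hcovG, hd0, hbd, hμG, hds⟩ := exists_level_sets hb0 hb hq0 hbq
  have hcov : ∀ {f : ℝ → ℝ} {E : ℤ → Set ℝ} {c : ℤ → ℝ}, (∀ᵐ x, f x ≠ 0 → ∃ m, x ∈ E m) →
      (∀ m, ∀ x ∈ E m, f x ≤ c m * 2 ^ (-(m / q) : ℝ)) → ∀ᵐ x, ENNReal.ofReal (f x) ≤
        ∑' m, (E m).indicator (fun _ => ENNReal.ofReal (c m * 2 ^ (-(m / q) : ℝ))) x := by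
    intro f E c hcov hfc
    filter_upwards [hcov] with x hx
    by_cases hf : f x = 0
    · simp [hf]
    obtain ⟨m, hm⟩ := hx hf
    refine le_trans ?_ (ENNReal.le_tsum m)
    rw [Set.indicator_of_mem hm]
    exact ENNReal.ofReal_le_ofReal (hfc m x hm)
  have hsq : ∀ {c : ℤ → ℝ} {I : ℝ≥0∞}, ∑' m, ENNReal.ofReal (c m) ^ q ≤ 2 * I →
      (∑' m, ENNReal.ofReal (c m) ^ (2 : ℝ)) ^ (1 / 2 : ℝ) ≤ 2 * I ^ (1 / q) := by
    intro c I h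
    refine (ENNReal.rpow_le_rpow (tsum_sq_le hq0 hq2) (by norm_num)).trans ?_
    refine (ENNReal.rpow_le_rpow (ENNReal.rpow_le_rpow h (by positivity)) (by norm_num)).trans ?_
    rw [← ENNReal.rpow_mul, show 2 / q * (1 / 2) = 1 / q by ring,
      ENNReal.mul_rpow_of_nonneg _ _ (by positivity)]
    gcongr
    nth_rw 2 [← ENNReal.rpow_one 2]
    exact ENNReal.rpow_le_rpow_of_exponent_le (by norm_num) hqi1
  set k : ℝ → ℝ → ℝ≥0∞ := fun t x => ENNReal.ofReal (|t - x| ^ (-l)) with hk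
  have hkm : Measurable (Function.uncurry k) := by
    have : Measurable fun p : ℝ × ℝ => ENNReal.ofReal (|p.1 - p.2| ^ (-l)) := by fun_prop
    exact this
  have hks : ∀ t x, k t x = k x t := fun t x => by simp only [hk, abs_sub_comm]
  set e : (ℤ → ℝ) → ℤ → ℝ≥0∞ := fun c m => ENNReal.ofReal (c m * 2 ^ (-(m / q) : ℝ)) with he
  have hJ : ∀ m n, ∫⁻ t in G n, ∫⁻ x in E m, k t x ≤
      ENNReal.ofReal ((2 / (1 - l) + 2) * 2 ^ (m * (1 - l) : ℝ)) *
        ENNReal.ofReal (2 * 2 ^ (n : ℝ)) :=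
    fun m n => by
      refine (lintegral_mono fun t => setLIntegral_rpow_le h0 h1 m (hμE m) t).trans ?_
      rw [setLIntegral_const]
      gcongr
      exact hμG n
  have hJ' : ∀ m n, ∫⁻ t in G n, ∫⁻ x in E m, k t x ≤
      ENNReal.ofReal ((2 / (1 - l) + 2) * 2 ^ (n * (1 - l) : ℝ)) *
        ENNReal.ofReal (2 * 2 ^ (m : ℝ)) :=
    fun m n => by
      rw [lintegral_lintegral_swap hkm.aemeasurable]
      simp_rw [hks]
      refine (lintegral_mono fun t => setLIntegral_rpow_le h0 h1 n (hμG n) t).trans ?_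
      rw [setLIntegral_const]
      gcongr
      exact hμE m
  set w : ℤ → ℤ → ℝ≥0∞ := fun m n => ENNReal.ofReal (2 ^ (-(l / 2 * |(n : ℝ) - m|))) with hw
  have key : ∀ m n, e c m * e d n * ∫⁻ t in G n, ∫⁻ x in E m, k t x ≤
      ENNReal.ofReal K * (w m n * ENNReal.ofReal (c m) * ENNReal.ofReal (d n)) := fun m n => by
    have hcd : 0 ≤ c m * d n := mul_nonneg (hc0 m) (hd0 n)
    have hR : ENNReal.ofReal K * (w m n * ENNReal.ofReal (c m) * ENNReal.ofReal (d n)) =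
        ENNReal.ofReal (K * (c m * d n) * 2 ^ (-(l / 2 * |(n : ℝ) - m|))) := by
      rw [mul_assoc (w m n), ← ENNReal.ofReal_mul (hc0 m), ← ENNReal.ofReal_mul (by positivity),
        ← ENNReal.ofReal_mul hK0.le]
      congr 1
      ring
    have hgen : ∀ x y : ℝ, -(m / q) + -(n / q) + (x * (1 - l) + y) ≤ -(l / 2 * |(n : ℝ) - m|) →
        e c m * e d n * (ENNReal.ofReal ((2 / (1 - l) + 2) * 2 ^ (x * (1 - l))) *
          ENNReal.ofReal (2 * 2 ^ y)) ≤
          ENNReal.ofReal (K * (c m * d n) * 2 ^ (-(l / 2 * |(n : ℝ) - m|))) := fun x y hxy => by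
      rw [he]
      simp only
      rw [← ENNReal.ofReal_mul (mul_nonneg (hc0 m) (by positivity)),
        ← ENNReal.ofReal_mul (by positivity), ← ENNReal.ofReal_mul (mul_nonneg
          (mul_nonneg (hc0 m) (by positivity)) (mul_nonneg (hd0 n) (by positivity)))]
      refine ENNReal.ofReal_le_ofReal (le_trans (le_of_eq ?_) (mul_le_mul_of_nonneg_left
        (Real.rpow_le_rpow_of_exponent_le (by norm_num) hxy) (mul_nonneg hK0.le hcd)))
      rw [Real.rpow_add (by norm_num), Real.rpow_add (by norm_num), Real.rpow_add (by norm_num)]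
      ring
    rw [hR]
    have hqm : ∀ z : ℝ, z / q = z * (1 - l / 2) := fun z => by rw [← hqi]; ring
    rcases le_total (m : ℝ) n with h | h
    · refine (mul_le_mul_right (hJ' m n) _).trans (hgen n m ?_)
      rw [abs_of_nonneg (by linarith), hqm, hqm]
      linarith
    · refine (mul_le_mul_right (hJ m n) _).trans (hgen m n ?_)
      rw [abs_of_nonpos (by linarith), hqm, hqm]
      linarith
  have hind : ∀ {E : ℤ → Set ℝ} {c : ℤ → ℝ} (_ : ∀ m, MeasurableSet (E m)) (m : ℤ),
      Measurable ((E m).indicator fun _ : ℝ => e c m) :=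
    fun hE m => measurable_const.indicator (hE m)
  calc ∫⁻ t, ∫⁻ x, k t x * (ENNReal.ofReal (a x) * ENNReal.ofReal (b t))
      ≤ ∫⁻ t, ∫⁻ x, k t x * ((∑' m, (E m).indicator (fun _ => e c m) x) *
          ∑' n, (G n).indicator (fun _ => e d n) t) := by
        refine lintegral_mono_ae ?_
        filter_upwards [hcov hcovG hbd] with t ht
        refine lintegral_mono_ae ?_
        filter_upwards [hcov hcovE hac] with x hx
        exact mul_le_mul_right (mul_le_mul' hx ht) _
    _ = ∑' m, ∑' n, ∫⁻ t, ∫⁻ x, k t x * ((E m).indicator (fun _ => e c m) x *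
          (G n).indicator (fun _ => e d n) t) := by
        simp_rw [← ENNReal.tsum_mul_left, ← ENNReal.tsum_mul_right, ← ENNReal.tsum_mul_left]
        have hmeas : ∀ m n, Measurable (Function.uncurry fun t x =>
            k t x * ((E m).indicator (fun _ => e c m) x * (G n).indicator (fun _ => e d n) t)) :=
          fun m n => hkm.mul (((hind hE m).comp measurable_snd).mul
            ((hind hG n).comp measurable_fst))
        have hmeas' : ∀ m n t, Measurable fun x =>
            k t x * ((E m).indicator (fun _ => e c m) x * (G n).indicator (fun _ => e d n) t) :=
          fun m n t => (hmeas m n).of_uncurry_left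
        rw [← lintegral_lintegral_tsum_tsum hmeas]
        refine lintegral_congr fun t => lintegral_congr fun x => ?_
        rw [ENNReal.tsum_comm]
    _ = ∑' m, ∑' n, e c m * e d n * ∫⁻ t in G n, ∫⁻ x in E m, k t x := by
        refine tsum_congr fun m => tsum_congr fun n => ?_
        have hkt : ∀ t, Measurable (k t) := fun t => hkm.of_uncurry_left
        have hkE : Measurable fun t => ∫⁻ x in E m, k t x := hkm.lintegral_prod_right'
        rw [← lintegral_const_mul _ hkE, ← lintegral_indicator (hG n)]
        refine lintegral_congr fun t => ?_
        by_cases ht : t ∈ G n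
        · rw [Set.indicator_of_mem ht, Set.indicator_of_mem ht, ← lintegral_const_mul _ (hkt t),
            ← lintegral_indicator (hE m)]
          refine lintegral_congr fun x => ?_
          by_cases hx : x ∈ E m
          · simp only [Set.indicator_of_mem hx]; ring
          · simp only [Set.indicator_of_notMem hx, zero_mul, mul_zero]
        · simp only [Set.indicator_of_notMem ht, mul_zero, lintegral_zero]
    _ ≤ ∑' m, ∑' n, ENNReal.ofReal K * (w m n * ENNReal.ofReal (c m) * ENNReal.ofReal (d n)) :=
        ENNReal.tsum_le_tsum fun m => ENNReal.tsum_le_tsum fun n => key m n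
    _ = ENNReal.ofReal K * ∑' m, ∑' n, w m n * ENNReal.ofReal (c m) * ENNReal.ofReal (d n) := by
        simp_rw [ENNReal.tsum_mul_left]
    _ ≤ ENNReal.ofReal K * (C * ((2 * (∫⁻ x, ENNReal.ofReal (a x ^ q)) ^ (1 / q)) *
          (2 * (∫⁻ x, ENNReal.ofReal (b x ^ q)) ^ (1 / q)))) := by
        refine mul_le_mul_right ((schur_tsum (fun m => ?_) fun n => hsum _).trans
          (mul_le_mul_right (mul_le_mul' (hsq hcs) (hsq hds)) _)) _
        refine le_trans (le_of_eq (tsum_congr fun n => ?_)) (hsum m)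
        rw [abs_sub_comm]
    _ = _ := by ring

section DecayingFamilies

variable {X : Type} [MeasurableSpace X] {μ : Measure X} {H : Type} [NormedAddCommGroup H]
  [InnerProductSpace ℂ H]

/-- A continuous family of contractions `L² → H` whose Gram kernel decays like `|t - s|^{-σ}` as a
bilinear form on `L¹`. -/
structure Decays (σ D : ℝ) (T : ℝ → Lp ℂ 2 μ →L[ℂ] H) : Prop where
  contr : ∀ s f, ‖T s f‖ ≤ ‖f‖
  cont : ∀ f, Continuous fun s => T s f
  decay : ∀ s t f g, s ≠ t → ‖inner ℂ (T t g) (T s f)‖ₑ ≤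
    ENNReal.ofReal (D * |t - s| ^ (-σ)) * (eLpNorm f 1 μ * eLpNorm g 1 μ)

/-- Simple functions of time with bounded support and values in `L² ∩ L^q`. -/
structure IsTest (q : ℝ) (Φ : SimpleFunc ℝ (Lp ℂ 2 μ)) : Prop where
  bdd : ∃ R : ℝ, ∀ τ, R < |τ| → Φ τ = 0
  fin : ∀ τ, eLpNorm (Φ τ) (ENNReal.ofReal q) μ ≠ ∞

variable {σ D : ℝ} {T : ℝ → Lp ℂ 2 μ →L[ℂ] H} {q : ℝ}

theorem Decays.reflect (h : Decays σ D T) : Decays σ D fun s => T (-s) where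
  contr s f := h.contr _ f
  cont f := (h.cont f).comp continuous_neg
  decay s t f g hst := by
    have := h.decay (-s) (-t) f g (by simpa using hst)
    rwa [show -t - -s = -(t - s) by ring, abs_neg] at this

theorem Decays.stronglyMeasurable (h : Decays σ D T) {Φ : ℝ → Lp ℂ 2 μ}
    (hΦ : StronglyMeasurable Φ) : StronglyMeasurable fun τ => T τ (Φ τ) := by
  have hc : Continuous fun p : ℝ × Lp ℂ 2 μ => T p.1 p.2 :=
    continuous_prod_of_continuous_lipschitzWith' _ 1 (fun s =>
      AddMonoidHomClass.lipschitz_of_bound_nnnorm (T s) 1 fun f => by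
        rw [one_mul]; exact h.contr s f) fun f => h.cont f
  exact hc.comp_stronglyMeasurable (stronglyMeasurable_id.prodMk hΦ)

theorem integrable_of_bdd {E : Type*} [NormedAddCommGroup E] {u : ℝ → E} {R C : ℝ}
    (hu : StronglyMeasurable u) (hC : ∀ τ, ‖u τ‖ ≤ C) (hR : ∀ τ, R < |τ| → u τ = 0) :
    Integrable u := by
  have : IntegrableOn u (Set.Icc (-R) R) :=
    Measure.integrableOn_of_bounded (M := C) measure_Icc_lt_top.ne hu.aestronglyMeasurable
      (ae_of_all _ hC)
  refine (integrableOn_iff_integrable_of_support_subset fun τ hτ => ?_).1 this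
  by_contra h
  exact hτ (hR τ (not_le.1 fun h' => h (abs_le.1 h')))

theorem Decays.integrable (h : Decays σ D T) {Φ : SimpleFunc ℝ (Lp ℂ 2 μ)}
    (hΦ : ∃ R : ℝ, ∀ τ, R < |τ| → Φ τ = 0) : Integrable fun τ => T τ (Φ τ) := by
  obtain ⟨R, hR⟩ := hΦ
  obtain ⟨C, hC⟩ := Φ.exists_forall_norm_le
  exact integrable_of_bdd (h.stronglyMeasurable Φ.stronglyMeasurable)
    (fun τ => (h.contr τ _).trans (hC τ)) fun τ hτ => by rw [hR τ hτ, map_zero]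

theorem IsTest.restrict {Φ : SimpleFunc ℝ (Lp ℂ 2 μ)} (hΦ : IsTest q Φ) {S : Set ℝ}
    (hS : MeasurableSet S) : IsTest q (Φ.restrict S) := by
  classical
  obtain ⟨R, hR⟩ := hΦ.bdd
  refine ⟨⟨R, fun τ hτ => ?_⟩, fun τ => ?_⟩
  · rw [SimpleFunc.restrict_apply _ hS, Set.indicator_apply, hR τ hτ, ite_self]
  · rw [SimpleFunc.restrict_apply _ hS, Set.indicator_apply]
    split_ifs
    · exact hΦ.fin τ
    · rw [eLpNorm_congr_ae (Lp.coeFn_zero ℂ 2 μ)]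
      simp

theorem measurable_eLpNorm_simple (Φ : SimpleFunc ℝ (Lp ℂ 2 μ)) (p : ℝ≥0∞) :
    Measurable fun τ => eLpNorm (Φ τ) p μ :=
  (Φ.map fun f : Lp ℂ 2 μ => eLpNorm f p μ).measurable

theorem IsTest.exists_bound {Φ : SimpleFunc ℝ (Lp ℂ 2 μ)} (hΦ : IsTest q Φ) :
    ∃ C : ℝ, 0 ≤ C ∧ ∀ τ, eLpNorm (Φ τ) (ENNReal.ofReal q) μ ≤ ENNReal.ofReal C := by
  obtain ⟨C, hC⟩ :=
    (Φ.map fun f : Lp ℂ 2 μ => (eLpNorm f (ENNReal.ofReal q) μ).toReal).exists_forall_norm_le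
  refine ⟨C, (norm_nonneg _).trans (hC 0), fun τ => ?_⟩
  rw [← ENNReal.ofReal_toReal (hΦ.fin τ)]
  exact ENNReal.ofReal_le_ofReal ((le_abs_self _).trans (hC τ))

theorem eLpNorm_coe_zero (p : ℝ≥0∞) : eLpNorm ((0 : Lp ℂ 2 μ) : X → ℂ) p μ = 0 := by
  rw [eLpNorm_congr_ae (Lp.coeFn_zero ℂ 2 μ)]
  simp

theorem IsTest.lintegral_ne_top {Φ : SimpleFunc ℝ (Lp ℂ 2 μ)} (hΦ : IsTest q Φ) {ρ : ℝ}
    (hρ : 0 < ρ) : ∫⁻ τ, eLpNorm (Φ τ) (ENNReal.ofReal q) μ ^ ρ ≠ ∞ := by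
  obtain ⟨R, hR⟩ := hΦ.bdd
  obtain ⟨C, -, hC⟩ := hΦ.exists_bound
  refine ne_top_of_le_ne_top (b := ∫⁻ τ in Set.Icc (-R) R, ENNReal.ofReal C ^ ρ) ?_ ?_
  · rw [setLIntegral_const]
    exact ENNReal.mul_ne_top (ENNReal.rpow_ne_top_of_nonneg hρ.le ENNReal.ofReal_ne_top)
      measure_Icc_lt_top.ne
  · rw [← lintegral_indicator measurableSet_Icc]
    refine lintegral_mono fun τ => ?_
    by_cases h : τ ∈ Set.Icc (-R) R
    · rw [Set.indicator_of_mem h]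
      exact ENNReal.rpow_le_rpow (hC τ) hρ.le
    · rw [hR τ (not_le.1 fun h' => h (abs_le.1 h')), eLpNorm_coe_zero, ENNReal.zero_rpow_of_pos hρ]
      exact zero_le

variable [CompleteSpace H]

theorem integral_integral_inner {ν κ : Measure ℝ} {u v : ℝ → H} (hu : Integrable u ν)
    (hv : Integrable v κ) :
    inner ℂ (∫ t, v t ∂κ) (∫ τ, u τ ∂ν) = ∫ t, ∫ τ, inner ℂ (v t) (u τ) ∂ν ∂κ := by
  simp_rw [integral_inner hu]
  rw [← inner_conj_symm, ← integral_inner hv, ← integral_conj]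
  simp_rw [inner_conj_symm]

theorem enorm_inner_integral_le {ν κ : Measure ℝ} {u v : ℝ → H} (hu : Integrable u ν)
    (hv : Integrable v κ) :
    ‖inner ℂ (∫ t, v t ∂κ) (∫ τ, u τ ∂ν)‖ₑ ≤ ∫⁻ t, ∫⁻ τ, ‖inner ℂ (v t) (u τ)‖ₑ ∂ν ∂κ := by
  rw [integral_integral_inner hu hv]
  exact (enorm_integral_le_lintegral_enorm _).trans
    (lintegral_mono fun t => enorm_integral_le_lintegral_enorm _)

end DecayingFamilies

section

/-- The tent function supported on `[1, 3]` with peak `tent 2 = 1`. -/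
def tent (z : ℝ) : ℝ := min 1 (z - 1) - max 0 (z - 2)

/-- The normalizing constant of the Whitney decomposition of `{τ < t}`. -/
noncomputable def tentMass : ℝ≥0∞ := ∫⁻ y : ℝ, ENNReal.ofReal (tent (2 ^ y))

theorem continuous_tent_two_rpow : Continuous fun y : ℝ => tent (2 ^ y) := by
  have : Continuous fun y : ℝ => (2 : ℝ) ^ y := Real.continuous_const_rpow (by norm_num)
  unfold tent
  fun_prop

theorem tentMass_ne_top : tentMass ≠ ∞ := by
  refine ne_top_of_le_ne_top (b := volume (Set.Icc (0 : ℝ) 2)) measure_Icc_lt_top.ne ?_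
  rw [← lintegral_indicator_one measurableSet_Icc]
  refine lintegral_mono fun y => ?_
  by_cases h : y ∈ Set.Icc (0 : ℝ) 2
  · rw [Set.indicator_of_mem h, Pi.one_apply, ← ENNReal.ofReal_one]
    refine ENNReal.ofReal_le_ofReal ?_
    have h1 : min 1 ((2 : ℝ) ^ y - 1) ≤ 1 := min_le_left _ _
    have h2 : 0 ≤ max 0 ((2 : ℝ) ^ y - 2) := le_max_left _ _
    unfold tent; linarith
  · rw [Set.indicator_of_notMem h, nonpos_iff_eq_zero, ENNReal.ofReal_eq_zero]
    unfold tent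
    have h1 := min_le_left 1 ((2 : ℝ) ^ y - 1)
    have h2 := min_le_right 1 ((2 : ℝ) ^ y - 1)
    have h3 := le_max_left 0 ((2 : ℝ) ^ y - 2)
    have h4 := le_max_right 0 ((2 : ℝ) ^ y - 2)
    rcases lt_or_ge y 0 with h' | h'
    · have := Real.rpow_le_one_of_one_le_of_nonpos (x := 2) (by norm_num) h'.le
      linarith
    · have h5 : 2 < y := not_le.1 fun h'' => h ⟨h', h''⟩
      have := Real.rpow_le_rpow_of_exponent_le (x := 2) (by norm_num) h5.le
      norm_num at this
      linarith

theorem tentMass_ne_zero : tentMass ≠ 0 := by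
  intro h
  rw [tentMass, lintegral_eq_zero_iff (by
    exact (continuous_tent_two_rpow.measurable).ennreal_ofReal)] at h
  have hU : IsOpen {y : ℝ | 0 < tent (2 ^ y)} := isOpen_lt continuous_const continuous_tent_two_rpow
  refine (hU.measure_pos volume ⟨1, ?_⟩).ne' ?_
  · norm_num [tent]
  · refine measure_mono_null (fun y hy => ?_) h
    simpa using hy

theorem lintegral_whitney (t τ : ℝ) :
    ∫⁻ y : ℝ, ∫⁻ x : ℝ, ENNReal.ofReal (2 ^ (-y)) *
      ((Set.Icc (x - 2 ^ y) x).indicator 1 τ *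
        (Set.Icc (x + 2 ^ y) (x + 2 * 2 ^ y)).indicator 1 t) =
      if τ < t then tentMass else 0 := by
  have h1 : ∀ y : ℝ, ∫⁻ x : ℝ, ENNReal.ofReal (2 ^ (-y)) * ((Set.Icc (x - 2 ^ y) x).indicator 1 τ *
      (Set.Icc (x + 2 ^ y) (x + 2 * 2 ^ y)).indicator 1 t) =
        ENNReal.ofReal (tent ((t - τ) * 2 ^ (-y))) := fun y => by
    have h2 : ∀ x : ℝ, ((Set.Icc (x - 2 ^ y) x).indicator 1 τ *
        (Set.Icc (x + 2 ^ y) (x + 2 * 2 ^ y)).indicator 1 t : ℝ≥0∞) =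
          (Set.Icc (max τ (t - 2 * 2 ^ y)) (min (τ + 2 ^ y) (t - 2 ^ y))).indicator 1 x :=
        fun x => by
      by_cases ha : τ ∈ Set.Icc (x - 2 ^ y) x
      · by_cases hb : t ∈ Set.Icc (x + 2 ^ y) (x + 2 * 2 ^ y)
        · rw [Set.indicator_of_mem ha, Set.indicator_of_mem hb, Set.indicator_of_mem]
          · simp
          · obtain ⟨a1, a2⟩ := ha
            obtain ⟨b1, b2⟩ := hb
            exact ⟨max_le (by linarith) (by linarith), le_min (by linarith) (by linarith)⟩
        · rw [Set.indicator_of_notMem hb, mul_zero, Set.indicator_of_notMem]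
          rintro ⟨h1, h2⟩
          have := (max_le_iff.1 h1).2
          have := (le_min_iff.1 h2).2
          exact hb ⟨by linarith, by linarith⟩
      · rw [Set.indicator_of_notMem ha, zero_mul, Set.indicator_of_notMem]
        rintro ⟨h1, h2⟩
        have := (max_le_iff.1 h1).1
        have := (le_min_iff.1 h2).1
        exact ha ⟨by linarith, by linarith⟩
    simp_rw [h2]
    rw [lintegral_const_mul _ (measurable_one.indicator measurableSet_Icc),
      lintegral_indicator_one measurableSet_Icc, Real.volume_Icc,
      ← ENNReal.ofReal_mul (by positivity)]
    congr 1
    have hp : (0 : ℝ) < 2 ^ y := by positivity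
    have h3 : (2 : ℝ) ^ (-y) = (2 ^ y)⁻¹ := Real.rpow_neg (by norm_num) y
    rw [h3, tent]
    have e1 : min (τ + 2 ^ y) (t - 2 ^ y) = τ + 2 ^ y * min 1 ((t - τ) * (2 ^ y)⁻¹ - 1) := by
      rw [mul_min_of_nonneg _ _ hp.le, ← min_add_add_left]
      congr 1
      · ring
      · field_simp; ring
    have e2 : max τ (t - 2 * 2 ^ y) = τ + 2 ^ y * max 0 ((t - τ) * (2 ^ y)⁻¹ - 2) := by
      rw [mul_max_of_nonneg _ _ hp.le, ← max_add_add_left]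
      congr 1
      · ring
      · field_simp; ring
    rw [e1, e2]
    field_simp
    ring
  simp_rw [h1]
  split_ifs with h
  · have hδ : t - τ = 2 ^ Real.logb 2 (t - τ) :=
      (Real.rpow_logb (by norm_num) (by norm_num) (by linarith)).symm
    rw [tentMass, ← lintegral_sub_left_eq_self (fun y : ℝ => ENNReal.ofReal (tent (2 ^ y)))
      (Real.logb 2 (t - τ))]
    refine lintegral_congr fun y => ?_
    rw [sub_eq_add_neg (Real.logb _ _), Real.rpow_add (by norm_num), ← hδ]
  · rw [lintegral_eq_zero_iff' (by
      have : Continuous fun y : ℝ => tent ((t - τ) * 2 ^ (-y)) := by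
        have : Continuous fun y : ℝ => (2 : ℝ) ^ y := Real.continuous_const_rpow (by norm_num)
        have := this.comp continuous_neg
        unfold tent
        fun_prop
      exact this.measurable.ennreal_ofReal.aemeasurable)]
    refine ae_of_all _ fun y => ENNReal.ofReal_eq_zero.2 ?_
    have h2 : (t - τ) * 2 ^ (-y) ≤ 0 :=
      mul_nonpos_of_nonpos_of_nonneg (by linarith) (by positivity)
    have h1 := min_le_right 1 ((t - τ) * 2 ^ (-y) - 1)
    have h3 := le_max_left 0 ((t - τ) * 2 ^ (-y) - 2)
    unfold tent; linarith

variable {H : Type} [NormedAddCommGroup H] [InnerProductSpace ℂ H] [CompleteSpace H]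

/-- Whitney decomposition of a retarded bilinear form. -/
theorem enorm_retarded_le {u v : ℝ → H} (hu : Integrable u) (hv : Integrable v) :
    ‖∫ t, inner ℂ (v t) (∫ τ in Set.Iio t, u τ)‖ₑ ≤ tentMass⁻¹ * ∫⁻ y : ℝ, ∫⁻ x : ℝ,
      ENNReal.ofReal (2 ^ (-y)) * ‖inner ℂ (∫ t in Set.Icc (x + 2 ^ y) (x + 2 * 2 ^ y), v t)
        (∫ τ in Set.Icc (x - 2 ^ y) x, u τ)‖ₑ := by
  set A : Set ((ℝ × ℝ) × ℝ × ℝ) := {z | z.1.2 ∈ Set.Icc (z.2.2 - 2 ^ z.2.1) z.2.2 ∧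
    z.1.1 ∈ Set.Icc (z.2.2 + 2 ^ z.2.1) (z.2.2 + 2 * 2 ^ z.2.1)} with hA
  have h2y : Measurable fun z : (ℝ × ℝ) × ℝ × ℝ => (2 : ℝ) ^ z.2.1 := by fun_prop
  have hAm : MeasurableSet A := by
    have m1 : MeasurableSet {z : (ℝ × ℝ) × ℝ × ℝ | z.2.2 - 2 ^ z.2.1 ≤ z.1.2} :=
      measurableSet_le (by fun_prop) (by fun_prop)
    have m2 : MeasurableSet {z : (ℝ × ℝ) × ℝ × ℝ | z.1.2 ≤ z.2.2} :=
      measurableSet_le (by fun_prop) (by fun_prop)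
    have m3 : MeasurableSet {z : (ℝ × ℝ) × ℝ × ℝ | z.2.2 + 2 ^ z.2.1 ≤ z.1.1} :=
      measurableSet_le (by fun_prop) (by fun_prop)
    have m4 : MeasurableSet {z : (ℝ × ℝ) × ℝ × ℝ | z.1.1 ≤ z.2.2 + 2 * 2 ^ z.2.1} :=
      measurableSet_le (by fun_prop) (by fun_prop)
    exact (m1.inter m2).inter (m3.inter m4)
  set f : ℝ × ℝ → ℂ := fun p => inner ℂ (v p.1) (u p.2) with hf
  have hfi : Integrable f (volume.prod volume) :=
    Integrable.mono' (hv.norm.mul_prod hu.norm) ((hv.1.comp_fst).inner (hu.1.comp_snd))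
      (ae_of_all _ fun p => norm_inner_le_norm _ _)
  set w : (ℝ × ℝ) × ℝ × ℝ → ℝ := A.indicator fun z => 2 ^ (-z.2.1) with hw
  have hwm : Measurable w := (by fun_prop : Measurable fun z : (ℝ × ℝ) × ℝ × ℝ =>
    (2 : ℝ) ^ (-z.2.1)).indicator hAm
  have hw0 : ∀ z, 0 ≤ w z := fun z => Set.indicator_nonneg (fun z _ => by positivity) z
  have hwe : ∀ p z, ‖w (p, z)‖ₑ = ENNReal.ofReal (2 ^ (-z.1)) *
      ((Set.Icc (z.2 - 2 ^ z.1) z.2).indicator 1 p.2 *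
        (Set.Icc (z.2 + 2 ^ z.1) (z.2 + 2 * 2 ^ z.1)).indicator 1 p.1) := fun p z => by
    rw [Real.enorm_eq_ofReal (hw0 _), hw]
    by_cases h1 : p.2 ∈ Set.Icc (z.2 - 2 ^ z.1) z.2
    · by_cases h2 : p.1 ∈ Set.Icc (z.2 + 2 ^ z.1) (z.2 + 2 * 2 ^ z.1)
      · rw [Set.indicator_of_mem h1, Set.indicator_of_mem h2,
          Set.indicator_of_mem (show (p, z) ∈ A from ⟨h1, h2⟩)]
        simp
      · rw [Set.indicator_of_notMem h2, Set.indicator_of_notMem fun h : (p, z) ∈ A => h2 h.2]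
        simp
    · rw [Set.indicator_of_notMem h1, Set.indicator_of_notMem fun h : (p, z) ∈ A => h1 h.1]
      simp
  have hwI : ∀ p : ℝ × ℝ, ∫⁻ z, ‖w (p, z)‖ₑ ∂(volume.prod volume) =
      if p.2 < p.1 then tentMass else 0 := fun p => by
    rw [lintegral_prod _ (by fun_prop), ← lintegral_whitney]
    simp_rw [hwe]
  have hwf : Integrable (fun z : (ℝ × ℝ) × ℝ × ℝ => w z • f z.1)
      ((volume.prod volume).prod (volume.prod volume)) := by
    have hm : AEStronglyMeasurable (fun z : (ℝ × ℝ) × ℝ × ℝ => w z • f z.1)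
        ((volume.prod volume).prod (volume.prod volume)) :=
      hwm.aestronglyMeasurable.smul (hfi.1.comp_fst (ν := volume.prod volume))
    refine ⟨hm, ?_⟩
    rw [HasFiniteIntegral, lintegral_prod _ hm.enorm]
    simp only [enorm_smul]
    have : ∀ p : ℝ × ℝ, ∫⁻ z, ‖w (p, z)‖ₑ * ‖f p‖ₑ ∂(volume.prod volume) ≤
        tentMass * ‖f p‖ₑ := fun p => by
      rw [lintegral_mul_const _ (by fun_prop), hwI]
      gcongr
      split_ifs
      · exact le_rfl
      · exact zero_le
    refine (lintegral_mono this).trans_lt ?_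
    rw [lintegral_const_mul' _ _ tentMass_ne_top]
    exact ENNReal.mul_lt_top tentMass_ne_top.lt_top hfi.2
  have hLHS : ∫ t, inner ℂ (v t) (∫ τ in Set.Iio t, u τ) =
      ∫ p, {p : ℝ × ℝ | p.2 < p.1}.indicator f p ∂(volume.prod volume) := by
    have hS : MeasurableSet {p : ℝ × ℝ | p.2 < p.1} :=
      measurableSet_lt measurable_snd measurable_fst
    rw [integral_prod _ (hfi.indicator hS)]
    refine integral_congr_ae (ae_of_all _ fun t => ?_)
    simp only
    rw [← integral_inner hu.integrableOn, ← integral_indicator measurableSet_Iio]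
    rfl
  have hkey : (tentMass.toReal : ℝ) • ∫ t, inner ℂ (v t) (∫ τ in Set.Iio t, u τ) =
      ∫ z : ℝ × ℝ, ((2 : ℝ) ^ (-z.1)) •
        inner ℂ (∫ t in Set.Icc (z.2 + 2 ^ z.1) (z.2 + 2 * 2 ^ z.1), v t)
          (∫ τ in Set.Icc (z.2 - 2 ^ z.1) z.2, u τ) ∂(volume.prod volume) := by
    rw [hLHS, ← integral_smul]
    calc ∫ p, tentMass.toReal • {p : ℝ × ℝ | p.2 < p.1}.indicator f p ∂(volume.prod volume)
        = ∫ p, ∫ z, w (p, z) • f p ∂(volume.prod volume) ∂(volume.prod volume) := by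
          refine integral_congr_ae (ae_of_all _ fun p => ?_)
          simp only
          rw [integral_smul_const, integral_eq_lintegral_of_nonneg_ae (ae_of_all _ fun z => hw0 _)
            (hwm.comp measurable_prodMk_left).aestronglyMeasurable]
          simp_rw [← Real.enorm_eq_ofReal (hw0 _)]
          rw [hwI]
          by_cases h : p.2 < p.1
          · rw [if_pos h, Set.indicator_of_mem (show p ∈ {p : ℝ × ℝ | p.2 < p.1} from h)]
          · rw [if_neg h, Set.indicator_of_notMem (show p ∉ {p : ℝ × ℝ | p.2 < p.1} from h)]
            simp
      _ = ∫ z, ∫ p, w (p, z) • f p ∂(volume.prod volume) ∂(volume.prod volume) :=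
          integral_integral_swap hwf
      _ = _ := by
          refine integral_congr_ae (ae_of_all _ fun z => ?_)
          simp only
          rw [integral_integral_inner hu.integrableOn hv.integrableOn,
            ← setIntegral_prod f hfi.integrableOn, ← integral_indicator
              (measurableSet_Icc.prod measurableSet_Icc), ← integral_smul]
          refine integral_congr_ae (ae_of_all _ fun p => ?_)
          simp only [hw]
          by_cases h : (p, z) ∈ A
          · rw [Set.indicator_of_mem h, Set.indicator_of_mem (Set.mk_mem_prod h.2 h.1)]
          · rw [Set.indicator_of_notMem h, Set.indicator_of_notMem fun h' => h ⟨h'.2, h'.1⟩]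
            simp
  have h3 := congrArg (fun z => ‖z‖ₑ) hkey
  simp only [enorm_smul] at h3
  rw [Real.enorm_eq_ofReal ENNReal.toReal_nonneg, ENNReal.ofReal_toReal tentMass_ne_top] at h3
  rw [← ENNReal.mul_le_iff_le_inv tentMass_ne_zero tentMass_ne_top, h3]
  refine (enorm_integral_le_lintegral_enorm _).trans ((lintegral_prod_le _).trans (le_of_eq ?_))
  refine lintegral_congr fun y => lintegral_congr fun x => ?_
  rw [enorm_smul, Real.enorm_eq_ofReal (by positivity)]

end

/-- `2 ^ p` as an extended nonnegative real. -/
noncomputable def pow2 (p : ℝ) : ℝ≥0∞ := ENNReal.ofReal (2 ^ p)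

theorem pow2_add (p r : ℝ) : pow2 (p + r) = pow2 p * pow2 r := by
  rw [pow2, Real.rpow_add (by norm_num), ENNReal.ofReal_mul (by positivity)]
  rfl

theorem pow2_rpow (p r : ℝ) : pow2 p ^ r = pow2 (p * r) := by
  rw [pow2, ENNReal.ofReal_rpow_of_pos (by positivity), ← Real.rpow_mul (by norm_num)]
  rfl

theorem pow2_mono {p r : ℝ} (h : p ≤ r) : pow2 p ≤ pow2 r :=
  ENNReal.ofReal_le_ofReal (Real.rpow_le_rpow_of_exponent_le (by norm_num) h)

theorem measurable_pow2 : Measurable pow2 :=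
  (Real.continuous_const_rpow (by norm_num)).measurable.ennreal_ofReal

theorem two_mul_pow2_mul {x : ℝ} (hx : 0 ≤ x) (p : ℝ) :
    2 * pow2 p * ENNReal.ofReal x = ENNReal.ofReal (2 * x * 2 ^ p) := by
  rw [show (2 : ℝ≥0∞) = ENNReal.ofReal 2 by norm_num, pow2, ← ENNReal.ofReal_mul (by norm_num),
    ← ENNReal.ofReal_mul (by positivity)]
  congr 1; ring

/-- The `L²` norm of a nonnegative function on a set. -/
noncomputable def nrm2 (c : ℝ → ℝ≥0∞) (S : Set ℝ) : ℝ≥0∞ :=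
  (∫⁻ τ in S, c τ ^ (2 : ℝ)) ^ (1 / 2 : ℝ)

theorem setLIntegral_le_nrm2 {c : ℝ → ℝ≥0∞} (hc : Measurable c) (S : Set ℝ) :
    ∫⁻ τ in S, c τ ≤ volume S ^ (1 / 2 : ℝ) * nrm2 c S := by
  have := ENNReal.lintegral_mul_le_Lp_mul_Lq (volume.restrict S)
    (Real.HolderConjugate.two_two) (f := fun _ => 1) (g := c) aemeasurable_const hc.aemeasurable
  simpa [nrm2] using this

section DecayingFamilies

variable {X : Type} [MeasurableSpace X] {μ : Measure X} {H : Type} [NormedAddCommGroup H]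
  [InnerProductSpace ℂ H] {σ D : ℝ} {T : ℝ → Lp ℂ 2 μ →L[ℂ] H} {q : ℝ}

/-- Atomic decomposition of a test function, pointwise in time. -/
theorem IsTest.exists_atoms (hq : 1 ≤ q) (hq2 : q ≤ 2) {Φ : SimpleFunc ℝ (Lp ℂ 2 μ)}
    (hΦ : IsTest q Φ) :
    ∃ (A : ℤ → SimpleFunc ℝ (Lp ℂ 2 μ)) (c : ℤ → ℝ → ℝ≥0∞), (∀ τ, HasSum (fun k => A k τ) (Φ τ)) ∧
      (∀ (s : Finset ℤ) τ, ‖∑ k ∈ s, A k τ‖ ≤ ‖Φ τ‖) ∧ (∀ k, Measurable (c k)) ∧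
      (∀ k τ, eLpNorm (A k τ) 1 μ ≤ 2 * pow2 (k * (1 - 1 / q)) * c k τ) ∧
      (∀ k τ, ‖A k τ‖ₑ ≤ 2 * pow2 (k * (1 / 2 - 1 / q)) * c k τ) ∧
      (∑' k, nrm2 (c k) Set.univ ^ (2 : ℝ)) ^ (1 / 2 : ℝ) ≤
        2 * (∫⁻ τ, eLpNorm (Φ τ) (ENNReal.ofReal q) μ ^ (2 : ℝ)) ^ (1 / 2 : ℝ) := by
  have key : ∀ f : Lp ℂ 2 μ, ∃ (a : ℤ → Lp ℂ 2 μ) (c : ℤ → ℝ),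
      eLpNorm f (ENNReal.ofReal q) μ ≠ ∞ → HasSum a f ∧ (∀ s : Finset ℤ, ‖∑ m ∈ s, a m‖ ≤ ‖f‖) ∧
      (∀ m, 0 ≤ c m) ∧
      (∀ m, eLpNorm (a m) 1 μ ≤ ENNReal.ofReal (2 * c m * 2 ^ (m * (1 - 1 / q) : ℝ))) ∧
      (∀ m, ‖a m‖ₑ ≤ ENNReal.ofReal (2 * c m * 2 ^ (m * (1 / 2 - 1 / q) : ℝ))) ∧
      (∑' m, ENNReal.ofReal (c m) ^ (2 : ℝ)) ^ (1 / 2 : ℝ) ≤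
        2 * eLpNorm f (ENNReal.ofReal q) μ := fun f => by
    by_cases hf : eLpNorm f (ENNReal.ofReal q) μ = ∞
    · exact ⟨0, 0, fun h => absurd hf h⟩
    · obtain ⟨a, c, h⟩ := Strichartz.exists_atoms hq hq2 f hf
      exact ⟨a, c, fun _ => h⟩
  choose a c hac using key
  have hcm : ∀ k, Measurable fun τ => ENNReal.ofReal (c (Φ τ) k) := fun k =>
    (Φ.map fun f => ENNReal.ofReal (c f k)).measurable
  refine ⟨fun k => Φ.map fun f => a f k, fun k τ => ENNReal.ofReal (c (Φ τ) k),
    fun τ => (hac _ (hΦ.fin τ)).1, fun s τ => (hac _ (hΦ.fin τ)).2.1 s, hcm,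
    fun k τ => ?_, fun k τ => ?_, ?_⟩
  · refine ((hac _ (hΦ.fin τ)).2.2.2.1 k).trans (le_of_eq ?_)
    exact (two_mul_pow2_mul ((hac _ (hΦ.fin τ)).2.2.1 k) _).symm
  · refine ((hac _ (hΦ.fin τ)).2.2.2.2.1 k).trans (le_of_eq ?_)
    exact (two_mul_pow2_mul ((hac _ (hΦ.fin τ)).2.2.1 k) _).symm
  · have h3 : ∀ τ, ∑' k, ENNReal.ofReal (c (Φ τ) k) ^ (2 : ℝ) ≤
        2 ^ (2 : ℝ) * eLpNorm (Φ τ) (ENNReal.ofReal q) μ ^ (2 : ℝ) := fun τ => by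
      have := ENNReal.rpow_le_rpow (hac _ (hΦ.fin τ)).2.2.2.2.2 (zero_le_two (α := ℝ))
      rwa [← ENNReal.rpow_mul, one_div, inv_mul_cancel₀ (by norm_num), ENNReal.rpow_one,
        ENNReal.mul_rpow_of_nonneg _ _ (by norm_num)] at this
    simp_rw [nrm2, ← ENNReal.rpow_mul, Measure.restrict_univ]
    rw [show (1 / 2 : ℝ) * 2 = 1 by norm_num]
    simp_rw [ENNReal.rpow_one]
    rw [← lintegral_tsum fun k => ((hcm k).pow_const _).aemeasurable]
    refine (ENNReal.rpow_le_rpow (lintegral_mono h3) (by norm_num)).trans (le_of_eq ?_)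
    rw [lintegral_const_mul _ ((measurable_eLpNorm_simple Φ _).pow_const _),
      ENNReal.mul_rpow_of_nonneg _ _ (by norm_num), ← ENNReal.rpow_mul]
    norm_num

theorem Decays.hasSum_setIntegral (h : Decays σ D T) {Φ : SimpleFunc ℝ (Lp ℂ 2 μ)}
    (hΦ : ∃ R : ℝ, ∀ τ, R < |τ| → Φ τ = 0) {A : ℤ → SimpleFunc ℝ (Lp ℂ 2 μ)}
    (hA : ∀ τ, HasSum (fun k => A k τ) (Φ τ)) (hAb : ∀ (s : Finset ℤ) τ, ‖∑ k ∈ s, A k τ‖ ≤ ‖Φ τ‖)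
    (S : Set ℝ) : HasSum (fun k => ∫ τ in S, T τ (A k τ)) (∫ τ in S, T τ (Φ τ)) := by
  obtain ⟨R, hR⟩ := hΦ
  have hAi : ∀ k, Integrable fun τ => T τ (A k τ) := fun k => h.integrable ⟨R, fun τ hτ => by
    have := hAb {k} τ
    rw [Finset.sum_singleton, hR τ hτ, norm_zero] at this
    exact norm_le_zero_iff.1 this⟩
  have hi : Integrable fun τ => ‖Φ τ‖ := by
    obtain ⟨C, hC⟩ := Φ.exists_forall_norm_le
    exact (integrable_of_bdd Φ.stronglyMeasurable hC hR).norm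
  have : Tendsto (fun s : Finset ℤ => ∫ τ in S, ∑ k ∈ s, T τ (A k τ)) atTop
      (nhds (∫ τ in S, T τ (Φ τ))) := by
    refine tendsto_integral_filter_of_dominated_convergence (fun τ => ‖Φ τ‖)
      (Eventually.of_forall fun s => ?_) (Eventually.of_forall fun s => ae_of_all _ fun τ => ?_)
      hi.integrableOn (ae_of_all _ fun τ => (T τ).hasSum (hA τ))
    · exact (integrable_finsetSum s fun k _ => (hAi k).integrableOn).1
    · rw [← map_sum]
      exact (h.contr τ _).trans (hAb s τ)
  refine this.congr fun s => ?_
  exact integral_finsetSum s fun k _ => (hAi k).integrableOn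

theorem Decays.enorm_setIntegral_le (h : Decays σ D T) {A : SimpleFunc ℝ (Lp ℂ 2 μ)}
    {c : ℝ → ℝ≥0∞} (hc : Measurable c) {a : ℝ≥0∞}
    (hAc : ∀ τ, ‖A τ‖ₑ ≤ a * c τ) (S : Set ℝ) :
    ‖∫ τ in S, T τ (A τ)‖ₑ ≤ a * volume S ^ (1 / 2 : ℝ) * nrm2 c S := by
  refine (enorm_integral_le_lintegral_enorm _).trans ?_
  refine (lintegral_mono fun τ => (enorm_le_iff_norm_le.2 (h.contr τ _)).trans (hAc τ)).trans ?_
  rw [lintegral_const_mul _ hc, mul_assoc]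
  gcongr
  exact setLIntegral_le_nrm2 hc S

variable [CompleteSpace H]

theorem Decays.far_bound (h : Decays σ D T) (hσ : 0 < σ) (hD : 0 < D)
    {A B : SimpleFunc ℝ (Lp ℂ 2 μ)}
    (hA : ∃ R : ℝ, ∀ τ, R < |τ| → A τ = 0) (hB : ∃ R : ℝ, ∀ τ, R < |τ| → B τ = 0)
    {c d : ℝ → ℝ≥0∞} (hc : Measurable c) (hd : Measurable d) {a b : ℝ≥0∞}
    (hAc : ∀ τ, eLpNorm (A τ) 1 μ ≤ a * c τ) (hBd : ∀ τ, eLpNorm (B τ) 1 μ ≤ b * d τ) (x y : ℝ) :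
    ‖inner ℂ (∫ t in Set.Icc (x + 2 ^ y) (x + 2 * 2 ^ y), T t (B t))
      (∫ τ in Set.Icc (x - 2 ^ y) x, T τ (A τ))‖ₑ ≤
      ENNReal.ofReal D * pow2 (y * (1 - σ)) * (a * b) *
        (nrm2 c (Set.Icc (x - 2 ^ y) x) * nrm2 d (Set.Icc (x + 2 ^ y) (x + 2 * 2 ^ y))) := by
  set I := Set.Icc (x - 2 ^ y) x with hI
  set J := Set.Icc (x + 2 ^ y) (x + 2 * 2 ^ y) with hJ
  have hy : (0 : ℝ) < 2 ^ y := by positivity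
  have hvI : volume I = pow2 y := by
    rw [hI, Real.volume_Icc, pow2]; congr 1; ring
  have hvJ : volume J = pow2 y := by
    rw [hJ, Real.volume_Icc, pow2]; congr 1; ring
  have hp : ∀ t ∈ J, ∀ τ ∈ I, ‖inner ℂ (T t (B t)) (T τ (A τ))‖ₑ ≤
      (ENNReal.ofReal D * pow2 (y * -σ) * (a * b)) * d t * c τ := by
    intro t ht τ hτ
    have h1 : 2 ^ y ≤ t - τ := by linarith [ht.1, hτ.2]
    have hne : τ ≠ t := fun h' => by rw [h', sub_self] at h1; exact absurd h1 (not_le.2 hy)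
    refine (h.decay τ t (A τ) (B t) hne).trans ?_
    have h2 : ENNReal.ofReal (D * |t - τ| ^ (-σ)) ≤ ENNReal.ofReal D * pow2 (y * -σ) := by
      rw [ENNReal.ofReal_mul hD.le, pow2, Real.rpow_mul (by norm_num)]
      refine mul_le_mul' le_rfl (ENNReal.ofReal_le_ofReal ?_)
      exact Real.rpow_le_rpow_of_nonpos hy (h1.trans (le_abs_self _)) (neg_nonpos.2 hσ.le)
    refine (mul_le_mul' h2 (mul_le_mul' (hAc τ) (hBd t))).trans (le_of_eq ?_)
    ring
  refine (enorm_inner_integral_le (h.integrable hA).integrableOn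
    (h.integrable hB).integrableOn).trans ?_
  refine (setLIntegral_mono' measurableSet_Icc fun t ht =>
    setLIntegral_mono' measurableSet_Icc fun τ hτ => hp t ht τ hτ).trans ?_
  simp_rw [lintegral_const_mul _ hc]
  rw [lintegral_mul_const _ (by fun_prop), lintegral_const_mul _ hd]
  refine (mul_le_mul' (mul_le_mul' le_rfl (setLIntegral_le_nrm2 hd J))
    (setLIntegral_le_nrm2 hc I)).trans (le_of_eq ?_)
  rw [hvI, hvJ, pow2_rpow, show y * (1 - σ) = y * -σ + (y * (1 / 2) + y * (1 / 2)) by ring,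
    pow2_add, pow2_add]
  ring

theorem Decays.enorm_setIntegral_atom_le (h : Decays σ D T) (hσ : 1 < σ) (hD : 0 < D)
    {A : SimpleFunc ℝ (Lp ℂ 2 μ)} (hA : ∃ R : ℝ, ∀ τ, R < |τ| → A τ = 0) {c : ℝ → ℝ≥0∞}
    (hc : Measurable c) (k : ℤ)
    (h1 : ∀ τ, eLpNorm (A τ) 1 μ ≤ 2 * pow2 (k * ((σ - 1) / (2 * σ))) * c τ)
    (h2 : ∀ τ, ‖A τ‖ₑ ≤ 2 * pow2 (k * (-1 / (2 * σ))) * c τ) {S : Set ℝ} (hS : MeasurableSet S) :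
    ‖∫ τ in S, T τ (A τ)‖ₑ ≤ ENNReal.ofReal (8 + 8 * D / (σ - 1)) ^ (1 / 2 : ℝ) * nrm2 c S := by
  have hσ0 : 0 < σ := by linarith
  have hσ1 : 0 < σ - 1 := by linarith
  set δ : ℝ := 2 ^ (k / σ : ℝ) with hδ
  have hδ0 : 0 < δ := by positivity
  set κ : ℝ → ℝ → ℝ≥0∞ := fun t τ => 4 * pow2 (k * (-1 / σ)) *
      (if |t - τ| ≤ δ then ENNReal.ofReal (|t - τ| ^ (-(0 : ℝ))) else 0) +
    4 * ENNReal.ofReal D * pow2 (k * ((σ - 1) / σ)) *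
      (if δ < |t - τ| then ENNReal.ofReal (|t - τ| ^ (-σ)) else 0) with hκ
  have hκm : Measurable (Function.uncurry κ) := by
    have m1 : MeasurableSet {p : ℝ × ℝ | |p.1 - p.2| ≤ δ} :=
      measurableSet_le (by fun_prop) (by fun_prop)
    have m2 : MeasurableSet {p : ℝ × ℝ | δ < |p.1 - p.2|} :=
      measurableSet_lt (by fun_prop) (by fun_prop)
    exact (Measurable.const_mul (Measurable.ite m1 (by fun_prop) measurable_const) _).add
      (Measurable.const_mul (Measurable.ite m2 (by fun_prop) measurable_const) _)
  have hκs : ∀ t τ, κ t τ = κ τ t := fun t τ => by simp only [hκ, abs_sub_comm]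
  have hκ1 : ∀ t, ∫⁻ τ, κ t τ ≤ ENNReal.ofReal (8 + 8 * D / (σ - 1)) := fun t => by
    have m1 : MeasurableSet {τ : ℝ | |t - τ| ≤ δ} :=
      measurableSet_le (by fun_prop) (by fun_prop)
    have m2 : MeasurableSet {τ : ℝ | δ < |t - τ|} :=
      measurableSet_lt (by fun_prop) (by fun_prop)
    have n1 : Measurable fun τ : ℝ =>
        (if |t - τ| ≤ δ then ENNReal.ofReal (|t - τ| ^ (-(0 : ℝ))) else 0 : ℝ≥0∞) :=
      Measurable.ite m1 (by fun_prop) measurable_const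
    have n2 : Measurable fun τ : ℝ =>
        (if δ < |t - τ| then ENNReal.ofReal (|t - τ| ^ (-σ)) else 0 : ℝ≥0∞) :=
      Measurable.ite m2 (by fun_prop) measurable_const
    simp only [hκ]
    rw [lintegral_add_left (n1.const_mul _), lintegral_const_mul _ n1, lintegral_const_mul _ n2,
      lintegral_rpow_near (by norm_num) hδ0, lintegral_rpow_far hσ hδ0]
    refine le_of_eq ?_
    have e4 : (4 : ℝ≥0∞) = ENNReal.ofReal 4 := by norm_num
    rw [e4, pow2, pow2, ← ENNReal.ofReal_mul (by positivity), ← ENNReal.ofReal_mul (by positivity),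
      ← ENNReal.ofReal_mul (by positivity), ← ENNReal.ofReal_mul (by positivity),
      ← ENNReal.ofReal_mul (by positivity), ← ENNReal.ofReal_add (by positivity) (by positivity)]
    congr 1
    have e1 : (2 : ℝ) ^ (k * (-1 / σ) : ℝ) * δ ^ (1 - (0 : ℝ)) = 1 := by
      rw [sub_zero, Real.rpow_one, hδ, ← Real.rpow_add (by norm_num),
        show (k * (-1 / σ) + k / σ : ℝ) = 0 by ring, Real.rpow_zero]
    have e2 : (2 : ℝ) ^ (k * ((σ - 1) / σ) : ℝ) * δ ^ (1 - σ) = 1 := by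
      rw [hδ, ← Real.rpow_mul (by norm_num), ← Real.rpow_add (by norm_num),
        show (k * ((σ - 1) / σ) + k / σ * (1 - σ) : ℝ) = 0 by field_simp; ring, Real.rpow_zero]
    calc _ = 8 * ((2 : ℝ) ^ (k * (-1 / σ) : ℝ) * δ ^ (1 - (0 : ℝ))) +
          8 * D / (σ - 1) * ((2 : ℝ) ^ (k * ((σ - 1) / σ) : ℝ) * δ ^ (1 - σ)) := by ring
      _ = _ := by rw [e1, e2, mul_one, mul_one]
  have hp : ∀ t τ, t ≠ τ → ‖inner ℂ (T t (A t)) (T τ (A τ))‖ₑ ≤ κ t τ * c t * c τ := by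
    intro t τ htτ
    simp only [hκ]
    by_cases hle : |t - τ| ≤ δ
    · rw [if_pos hle, if_neg (not_lt.2 hle), neg_zero, Real.rpow_zero, ENNReal.ofReal_one, mul_one,
        mul_zero, add_zero]
      refine (enorm_inner_le _ _).trans ((mul_le_mul' ((enorm_le_iff_norm_le.2 (h.contr t _)).trans
        (h2 t)) ((enorm_le_iff_norm_le.2 (h.contr τ _)).trans (h2 τ))).trans (le_of_eq ?_))
      rw [show (k * (-1 / σ) : ℝ) = k * (-1 / (2 * σ)) + k * (-1 / (2 * σ)) by field_simp; ring,
        pow2_add]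
      ring
    · rw [if_neg hle, if_pos (not_le.1 hle), mul_zero, zero_add]
      refine (h.decay τ t _ _ htτ.symm).trans ((mul_le_mul' le_rfl
        (mul_le_mul' (h1 τ) (h1 t))).trans (le_of_eq ?_))
      rw [show (k * ((σ - 1) / σ) : ℝ) = k * ((σ - 1) / (2 * σ)) + k * ((σ - 1) / (2 * σ)) by
        field_simp; ring, pow2_add, ENNReal.ofReal_mul hD.le]
      ring
  have hsq : ‖∫ τ in S, T τ (A τ)‖ₑ ^ (2 : ℝ) ≤
      ENNReal.ofReal (8 + 8 * D / (σ - 1)) * (nrm2 c S * nrm2 c S) := by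
    have e0 : ‖∫ τ in S, T τ (A τ)‖ₑ ^ (2 : ℝ) =
        ‖inner ℂ (∫ τ in S, T τ (A τ)) (∫ τ in S, T τ (A τ))‖ₑ := by
      rw [inner_self_eq_norm_sq_to_K, enorm_pow, ENNReal.rpow_ofNat]
      congr 1
      rw [← ofReal_norm, ← ofReal_norm]
      simp
    rw [e0]
    refine (enorm_inner_integral_le (h.integrable hA).integrableOn
      (h.integrable hA).integrableOn).trans ?_
    refine le_trans (lintegral_mono fun t => lintegral_mono_ae ?_) (schur_test hκm hc hc
      (fun t => (setLIntegral_le_lintegral _ _).trans (hκ1 t)) fun t => ?_)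
    · filter_upwards [ae_restrict_of_ae (Measure.ae_ne volume t)] with τ hτ using hp t τ hτ.symm
    · simp_rw [fun x => hκs x t]
      exact (setLIntegral_le_lintegral _ _).trans (hκ1 t)
  have := ENNReal.rpow_le_rpow hsq (show (0 : ℝ) ≤ 1 / 2 by norm_num)
  rw [← ENNReal.rpow_mul, show (2 : ℝ) * (1 / 2) = 1 by norm_num, ENNReal.rpow_one,
    ENNReal.mul_rpow_of_nonneg _ _ (by norm_num), ← sq, ← ENNReal.rpow_natCast,
    ← ENNReal.rpow_mul] at this
  norm_num at this ⊢
  exact this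

end DecayingFamilies

theorem measurable_setLIntegral_Icc {f : ℝ → ℝ≥0∞} (hf : Measurable f) {Y : Type*}
    [MeasurableSpace Y] {a b : Y → ℝ} (ha : Measurable a) (hb : Measurable b) :
    Measurable fun y => ∫⁻ τ in Set.Icc (a y) (b y), f τ := by
  have : ∀ y, ∫⁻ τ in Set.Icc (a y) (b y), f τ =
      ∫⁻ τ, {p : Y × ℝ | a p.1 ≤ p.2 ∧ p.2 ≤ b p.1}.indicator (fun p => f p.2) (y, τ) := fun y => by
    rw [← lintegral_indicator measurableSet_Icc]
    exact lintegral_congr fun τ => by simp [Set.indicator_apply]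
  simp_rw [this]
  have m1 : MeasurableSet {p : Y × ℝ | a p.1 ≤ p.2} := measurableSet_le (by fun_prop) (by fun_prop)
  have m2 : MeasurableSet {p : Y × ℝ | p.2 ≤ b p.1} := measurableSet_le (by fun_prop) (by fun_prop)
  exact (Measurable.indicator (f := fun p : Y × ℝ => f p.2) (by fun_prop)
    (m1.inter m2)).lintegral_prod_right'

theorem lintegral_window {f : ℝ → ℝ≥0∞} (hf : Measurable f) (a b : ℝ) :
    ∫⁻ x, ∫⁻ τ in Set.Icc (x + a) (x + b), f τ = ENNReal.ofReal (b - a) * ∫⁻ τ, f τ := by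
  have h1 : ∀ x, ∫⁻ τ in Set.Icc (x + a) (x + b), f τ =
      ∫⁻ τ, f τ * (Set.Icc a b).indicator 1 (τ - x) := fun x => by
    rw [← lintegral_indicator measurableSet_Icc]
    refine lintegral_congr fun τ => ?_
    by_cases h : τ ∈ Set.Icc (x + a) (x + b)
    · rw [Set.indicator_of_mem h, Set.indicator_of_mem, Pi.one_apply, mul_one]
      exact ⟨by linarith [h.1], by linarith [h.2]⟩
    · rw [Set.indicator_of_notMem h, Set.indicator_of_notMem, mul_zero]
      exact fun h' => h ⟨by linarith [h'.1], by linarith [h'.2]⟩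
  have hi : Measurable ((Set.Icc a b).indicator (1 : ℝ → ℝ≥0∞)) :=
    measurable_one.indicator measurableSet_Icc
  simp_rw [h1]
  rw [lintegral_lintegral_swap]
  · have h2 : ∀ τ, ∫⁻ x, f τ * (Set.Icc a b).indicator 1 (τ - x) = f τ * ENNReal.ofReal (b - a) :=
      fun τ => by
        rw [lintegral_const_mul _ (by fun_prop),
          lintegral_sub_left_eq_self (fun x => (Set.Icc a b).indicator (1 : ℝ → ℝ≥0∞) x) τ,
          lintegral_indicator_one measurableSet_Icc, Real.volume_Icc]
    simp_rw [h2]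
    rw [lintegral_mul_const _ hf, mul_comm]
  · exact Measurable.aemeasurable (by fun_prop)

theorem measurable_nrm2 {c : ℝ → ℝ≥0∞} (hc : Measurable c) {Y : Type*}
    [MeasurableSpace Y] {a b : Y → ℝ} (ha : Measurable a) (hb : Measurable b) :
    Measurable fun y => nrm2 c (Set.Icc (a y) (b y)) :=
  (measurable_setLIntegral_Icc (hc.pow_const _) ha hb).pow_const _

theorem lintegral_nrm2_window {c : ℝ → ℝ≥0∞} (hc : Measurable c) (a b : ℝ) :
    (∫⁻ x, nrm2 c (Set.Icc (x + a) (x + b)) ^ (2 : ℝ)) ^ (1 / 2 : ℝ) =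
      ENNReal.ofReal (b - a) ^ (1 / 2 : ℝ) * nrm2 c Set.univ := by
  simp_rw [nrm2, ← ENNReal.rpow_mul, show (1 / 2 : ℝ) * 2 = 1 by norm_num, ENNReal.rpow_one]
  rw [lintegral_window (hc.pow_const _), ENNReal.mul_rpow_of_nonneg _ _ (by norm_num),
    Measure.restrict_univ]

theorem lintegral_nrm2_mul_nrm2 {c d : ℝ → ℝ≥0∞} (hc : Measurable c) (hd : Measurable d) (y : ℝ) :
    ∫⁻ x, nrm2 c (Set.Icc (x - 2 ^ y) x) * nrm2 d (Set.Icc (x + 2 ^ y) (x + 2 * 2 ^ y)) ≤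
      pow2 y * (nrm2 c Set.univ * nrm2 d Set.univ) := by
  have h0 : ∀ x : ℝ, Set.Icc (x - 2 ^ y) x = Set.Icc (x + -2 ^ y) (x + 0) := fun x => by
    rw [add_zero, sub_eq_add_neg]
  simp_rw [h0]
  refine (ENNReal.lintegral_mul_le_Lp_mul_Lq volume Real.HolderConjugate.two_two
    (measurable_nrm2 hc (by fun_prop) (by fun_prop)).aemeasurable
    (measurable_nrm2 hd (by fun_prop) (by fun_prop)).aemeasurable).trans (le_of_eq ?_)
  rw [lintegral_nrm2_window hc, lintegral_nrm2_window hd, sub_neg_eq_add, zero_add,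
    show (2 * 2 ^ y - 2 ^ y : ℝ) = 2 ^ y by ring, mul_mul_mul_comm]
  congr 1
  rw [← ENNReal.rpow_add_of_nonneg _ _ (by norm_num) (by norm_num)]
  norm_num [pow2]

theorem lintegral_pow2_abs_ne_top {ε : ℝ} (hε : 0 < ε) :
    ∃ C : ℝ≥0∞, C ≠ ∞ ∧ ∀ a : ℝ, ∫⁻ y, pow2 (-(ε * |a - y|)) = C := by
  refine ⟨2 * ∫⁻ x in Set.Ioi 0, pow2 (-(ε * x)), ENNReal.mul_ne_top (by norm_num) ?_, fun a =>
    lintegral_sub_abs (fun x => pow2 (-(ε * x))) a⟩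
  have := (integrableOn_exp_mul_Ioi (a := -(Real.log 2 * ε))
    (neg_lt_zero.2 (mul_pos (Real.log_pos (by norm_num)) hε)) 0)
  have h2 : ∀ x : ℝ, pow2 (-(ε * x)) = ENNReal.ofReal (Real.exp (-(Real.log 2 * ε) * x)) :=
    fun x => by
      rw [pow2, Real.rpow_def_of_pos (by norm_num)]
      congr 2; ring
  simp_rw [h2]
  exact this.lintegral_lt_top.ne

theorem min_exponent_le {σ a b : ℝ} (hσ : 1 < σ) :
    min ((σ - 1) / 2 * (a + b)) (-(max a 0 / 2) + -(max b 0 / 2)) ≤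
      -((σ - 1) / (4 * σ) * |a|) + -((σ - 1) / (4 * σ) * |b|) := by
  have hσ0 : 0 < σ := by linarith
  set η : ℝ := 1 / (2 * σ) with hη
  have hησ : η * σ = 1 / 2 := by rw [hη]; field_simp
  have hη0 : 0 < η := by positivity
  have hη1 : η ≤ 1 := by nlinarith
  have hε : (σ - 1) / (4 * σ) = η * (σ - 1) / 2 := by rw [hη]; field_simp; ring
  have key : ∀ x : ℝ, η * ((σ - 1) / 2 * x) + (1 - η) * -(max x 0 / 2) ≤
      -((σ - 1) / (4 * σ) * |x|) := fun x => by
    rw [hε]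
    rcases le_total x 0 with h | h
    · rw [max_eq_right h, abs_of_nonpos h]; linarith
    · rw [max_eq_left h, abs_of_nonneg h]; nlinarith
  have h1 := min_le_left ((σ - 1) / 2 * (a + b)) (-(max a 0 / 2) + -(max b 0 / 2))
  have h2 := min_le_right ((σ - 1) / 2 * (a + b)) (-(max a 0 / 2) + -(max b 0 / 2))
  nlinarith [key a, key b, mul_le_mul_of_nonneg_left h1 hη0.le,
    mul_le_mul_of_nonneg_left h2 (sub_nonneg.2 hη1)]

section DecayingFamilies

variable {X : Type} [MeasurableSpace X] {μ : Measure X} {H : Type} [NormedAddCommGroup H]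
  [InnerProductSpace ℂ H] {σ D : ℝ} {T : ℝ → Lp ℂ 2 μ →L[ℂ] H} {q : ℝ}

/-- The constant in the bilinear estimate for a pair of atoms. -/
noncomputable def atomConst (σ D : ℝ) : ℝ≥0∞ :=
  4 * ENNReal.ofReal D + (2 + ENNReal.ofReal (8 + 8 * D / (σ - 1)) ^ (1 / 2 : ℝ)) ^ 2

theorem atomConst_ne_top (σ D : ℝ) : atomConst σ D ≠ ∞ := by
  unfold atomConst
  finiteness

theorem Decays.enorm_inner_atoms_le [CompleteSpace H] (h : Decays σ D T) (hσ : 1 < σ) (hD : 0 < D)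
    {A B : SimpleFunc ℝ (Lp ℂ 2 μ)} (hA : ∃ R : ℝ, ∀ τ, R < |τ| → A τ = 0)
    (hB : ∃ R : ℝ, ∀ τ, R < |τ| → B τ = 0) {c d : ℝ → ℝ≥0∞}
    (hc : Measurable c) (hd : Measurable d) (k l : ℤ)
    (hA1 : ∀ τ, eLpNorm (A τ) 1 μ ≤ 2 * pow2 (k * ((σ - 1) / (2 * σ))) * c τ)
    (hA2 : ∀ τ, ‖A τ‖ₑ ≤ 2 * pow2 (k * (-1 / (2 * σ))) * c τ)
    (hB1 : ∀ τ, eLpNorm (B τ) 1 μ ≤ 2 * pow2 (l * ((σ - 1) / (2 * σ))) * d τ)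
    (hB2 : ∀ τ, ‖B τ‖ₑ ≤ 2 * pow2 (l * (-1 / (2 * σ))) * d τ) (x y : ℝ) :
    ‖inner ℂ (∫ t in Set.Icc (x + 2 ^ y) (x + 2 * 2 ^ y), T t (B t))
      (∫ τ in Set.Icc (x - 2 ^ y) x, T τ (A τ))‖ₑ ≤
      atomConst σ D * (pow2 (-((σ - 1) / (4 * σ) * |k / σ - y|)) *
        pow2 (-((σ - 1) / (4 * σ) * |l / σ - y|))) *
        (nrm2 c (Set.Icc (x - 2 ^ y) x) * nrm2 d (Set.Icc (x + 2 ^ y) (x + 2 * 2 ^ y))) := by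
  have hσ0 : 0 < σ := by linarith
  set I := Set.Icc (x - 2 ^ y) x with hI
  set J := Set.Icc (x + 2 ^ y) (x + 2 * 2 ^ y) with hJ
  have hvI : volume I = pow2 y := by
    rw [hI, Real.volume_Icc, pow2]; congr 1; ring
  have hvJ : volume J = pow2 y := by
    rw [hJ, Real.volume_Icc, pow2]; congr 1; ring
  set M1 : ℝ≥0∞ := 2 + ENNReal.ofReal (8 + 8 * D / (σ - 1)) ^ (1 / 2 : ℝ) with hM1
  have near : ∀ {E : SimpleFunc ℝ (Lp ℂ 2 μ)} {e : ℝ → ℝ≥0∞} {m : ℤ} {S : Set ℝ},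
      (∃ R : ℝ, ∀ τ, R < |τ| → E τ = 0) → Measurable e →
      (∀ τ, eLpNorm (E τ) 1 μ ≤ 2 * pow2 (m * ((σ - 1) / (2 * σ))) * e τ) →
      (∀ τ, ‖E τ‖ₑ ≤ 2 * pow2 (m * (-1 / (2 * σ))) * e τ) → MeasurableSet S →
      volume S = pow2 y →
      ‖∫ τ in S, T τ (E τ)‖ₑ ≤ M1 * pow2 (-(max (m / σ - y) 0 / 2)) * nrm2 e S := by
    intro E e m S hE he hE1 hE2 hS hv
    rcases le_total (m / σ - y) 0 with h0 | h0
    · rw [max_eq_right h0, zero_div, neg_zero, show pow2 0 = 1 by simp [pow2], mul_one]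
      refine (h.enorm_setIntegral_atom_le hσ hD hE he m hE1 hE2 hS).trans ?_
      gcongr
      exact le_add_self
    · rw [max_eq_left h0]
      refine (h.enorm_setIntegral_le he hE2 S).trans ?_
      rw [hv, pow2_rpow, mul_assoc 2, ← pow2_add,
        show (m * (-1 / (2 * σ)) + y * (1 / 2) : ℝ) = -((m / σ - y) / 2) by field_simp; ring]
      gcongr
      exact le_self_add
  set N := nrm2 c I * nrm2 d J with hN
  have far : ‖inner ℂ (∫ t in J, T t (B t)) (∫ τ in I, T τ (A τ))‖ₑ ≤
      atomConst σ D * pow2 ((σ - 1) / 2 * ((k / σ - y) + (l / σ - y))) * N := by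
    refine (h.far_bound hσ0 hD hA hB hc hd hA1 hB1 x y).trans ?_
    rw [← hI, ← hJ, ← hN]
    refine mul_le_mul' ?_ le_rfl
    have : ENNReal.ofReal D * pow2 (y * (1 - σ)) *
        (2 * pow2 (k * ((σ - 1) / (2 * σ))) * (2 * pow2 (l * ((σ - 1) / (2 * σ))))) =
        4 * ENNReal.ofReal D * pow2 ((σ - 1) / 2 * ((k / σ - y) + (l / σ - y))) := by
      rw [show (σ - 1) / 2 * ((k / σ - y) + (l / σ - y)) = y * (1 - σ) +
        (k * ((σ - 1) / (2 * σ)) + l * ((σ - 1) / (2 * σ))) by field_simp; ring, pow2_add, pow2_add]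
      ring
    rw [this]
    exact mul_le_mul' le_self_add le_rfl
  have near2 : ‖inner ℂ (∫ t in J, T t (B t)) (∫ τ in I, T τ (A τ))‖ₑ ≤
      atomConst σ D * pow2 (-(max (k / σ - y) 0 / 2) + -(max (l / σ - y) 0 / 2)) * N := by
    refine (enorm_inner_le _ _).trans ((mul_le_mul' (near hB hd hB1 hB2 measurableSet_Icc hvJ)
      (near hA hc hA1 hA2 measurableSet_Icc hvI)).trans ?_)
    rw [pow2_add]
    calc _ = M1 ^ 2 * (pow2 (-(max (k / σ - y) 0 / 2)) * pow2 (-(max (l / σ - y) 0 / 2))) * N := by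
          ring
      _ ≤ _ := mul_le_mul' (mul_le_mul' le_add_self le_rfl) le_rfl
  have hmin := min_exponent_le (a := k / σ - y) (b := l / σ - y) hσ
  rw [← pow2_add]
  rcases min_choice ((σ - 1) / 2 * ((k / σ - y) + (l / σ - y)))
    (-(max (k / σ - y) 0 / 2) + -(max (l / σ - y) 0 / 2)) with h' | h' <;> rw [h'] at hmin
  · exact far.trans (mul_le_mul' (mul_le_mul' le_rfl (pow2_mono hmin)) le_rfl)
  · exact near2.trans (mul_le_mul' (mul_le_mul' le_rfl (pow2_mono hmin)) le_rfl)

end DecayingFamilies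

/-- The `L^ρ` norm in time of the `L^q` norm in space. -/
noncomputable def mixNorm {X : Type} [MeasurableSpace X] {μ : Measure X} (ρ q : ℝ)
    (Φ : ℝ → Lp ℂ 2 μ) : ℝ≥0∞ :=
  (∫⁻ τ, eLpNorm (Φ τ) (ENNReal.ofReal q) μ ^ ρ) ^ (1 / ρ)

theorem exists_sum_kernel_bound {σ : ℝ} (hσ : 1 < σ) : ∃ C : ℝ≥0∞, C ≠ ∞ ∧ ∀ k : ℤ,
    ∑' l : ℤ, ∫⁻ y, pow2 (-((σ - 1) / (4 * σ) * |k / σ - y|)) *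
        pow2 (-((σ - 1) / (4 * σ) * |l / σ - y|)) ≤ C := by
  have hσ0 : 0 < σ := by linarith
  have hε : 0 < (σ - 1) / (4 * σ) := div_pos (by linarith) (by linarith)
  set ε := (σ - 1) / (4 * σ)
  obtain ⟨C1, hC1, h1⟩ := tsum_two_rpow_abs (div_pos hε hσ0)
  obtain ⟨C2, hC2, h2⟩ := lintegral_pow2_abs_ne_top hε
  have hm : ∀ k : ℤ, Measurable fun y : ℝ => pow2 (-(ε * |k / σ - y|)) := fun k =>
    measurable_pow2.comp (by fun_prop)
  refine ⟨C2 * C1, ENNReal.mul_ne_top hC2 hC1, fun k => ?_⟩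
  have hkl : ∀ l : ℤ, Measurable fun y => pow2 (-(ε * |k / σ - y|)) * pow2 (-(ε * |l / σ - y|)) :=
    fun l => (hm k).mul (hm l)
  rw [← lintegral_tsum fun l => (hkl l).aemeasurable]
  simp_rw [ENNReal.tsum_mul_left]
  rw [← h2 (k / σ), ← lintegral_mul_const _ (hm k)]
  refine lintegral_mono fun y => mul_le_mul' le_rfl (le_trans (le_of_eq ?_) (h1 (σ * y)))
  refine tsum_congr fun l => ?_
  rw [pow2, show ε * |l / σ - y| = ε / σ * |σ * y - l| by
    rw [abs_sub_comm, show y - l / σ = (σ * y - l) / σ by field_simp, abs_div, abs_of_pos hσ0]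
    ring]

/-- The endpoint retarded estimate of Keel and Tao. -/
theorem exists_endpoint_retarded {σ D : ℝ} (hσ : 1 < σ) (hD : 0 < D) : ∃ C : ℝ≥0∞, C ≠ ∞ ∧
    ∀ {X : Type} [MeasurableSpace X] {μ : Measure X} {H : Type} [NormedAddCommGroup H]
      [InnerProductSpace ℂ H] [CompleteSpace H] {T : ℝ → Lp ℂ 2 μ →L[ℂ] H}, Decays σ D T →
    ∀ {Φ Γ : SimpleFunc ℝ (Lp ℂ 2 μ)}, IsTest (2 / (1 + 1 / σ)) Φ → IsTest (2 / (1 + 1 / σ)) Γ →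
    ‖∫ t, inner ℂ (T t (Γ t)) (∫ τ in Set.Iio t, T τ (Φ τ))‖ₑ ≤
      C * (mixNorm 2 (2 / (1 + 1 / σ)) Φ * mixNorm 2 (2 / (1 + 1 / σ)) Γ) := by
  have hσ0 : 0 < σ := by linarith
  obtain ⟨C, hC, hk⟩ := exists_sum_kernel_bound hσ
  refine ⟨tentMass⁻¹ * (atomConst σ D * (C * (2 * 2))), ENNReal.mul_ne_top
    (ENNReal.inv_ne_top.2 tentMass_ne_zero) (ENNReal.mul_ne_top (atomConst_ne_top _ _)
      (ENNReal.mul_ne_top hC (by norm_num))), ?_⟩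
  intro X _ μ H _ _ _ T h Φ Γ hΦ hΓ
  have hs1 : 1 / σ < 1 := by rw [div_lt_one hσ0]; exact hσ
  have hs0 : 0 < 1 / σ := by positivity
  have hq1 : 1 ≤ 2 / (1 + 1 / σ) := by rw [le_div_iff₀ (by linarith)]; linarith
  have hq2 : 2 / (1 + 1 / σ) ≤ 2 := by rw [div_le_iff₀ (by linarith)]; linarith
  have e1 : 1 - 1 / (2 / (1 + 1 / σ)) = (σ - 1) / (2 * σ) := by field_simp; ring
  have e2 : 1 / 2 - 1 / (2 / (1 + 1 / σ)) = -1 / (2 * σ) := by field_simp; ring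
  obtain ⟨A, c, hA, hAs, hc, hA1, hA2, hAn⟩ := hΦ.exists_atoms hq1 hq2
  obtain ⟨B, d, hB, hBs, hd, hB1, hB2, hBn⟩ := hΓ.exists_atoms hq1 hq2
  rw [e1] at hA1 hB1
  rw [e2] at hA2 hB2
  have bdd : ∀ {Ψ : SimpleFunc ℝ (Lp ℂ 2 μ)} {E : ℤ → SimpleFunc ℝ (Lp ℂ 2 μ)},
      IsTest (2 / (1 + 1 / σ)) Ψ → (∀ (s : Finset ℤ) τ, ‖∑ k ∈ s, E k τ‖ ≤ ‖Ψ τ‖) →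
      ∀ k, ∃ R : ℝ, ∀ τ, R < |τ| → E k τ = 0 := by
    intro Ψ E hΨ hE k
    obtain ⟨R, hR⟩ := hΨ.bdd
    refine ⟨R, fun τ hτ => ?_⟩
    have := hE {k} τ
    rw [Finset.sum_singleton, hR τ hτ, norm_zero] at this
    exact norm_le_zero_iff.1 this
  set K : ℤ → ℝ → ℝ≥0∞ := fun k y => pow2 (-((σ - 1) / (4 * σ) * |k / σ - y|)) with hK
  have hKm : ∀ k, Measurable (K k) := fun k => measurable_pow2.comp (by fun_prop)
  set n : ℤ → ℤ → ℝ → ℝ → ℝ≥0∞ := fun k l y x => nrm2 (c k) (Set.Icc (x - 2 ^ y) x) *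
    nrm2 (d l) (Set.Icc (x + 2 ^ y) (x + 2 * 2 ^ y)) with hn
  have hnm : ∀ k l, Measurable (Function.uncurry (n k l)) := fun k l =>
    (measurable_nrm2 (hc k) (by fun_prop) (by fun_prop)).mul
      (measurable_nrm2 (hd l) (by fun_prop) (by fun_prop))
  have step1 : ‖∫ t, inner ℂ (T t (Γ t)) (∫ τ in Set.Iio t, T τ (Φ τ))‖ₑ ≤
      tentMass⁻¹ * ∫⁻ y : ℝ, ∫⁻ x : ℝ, ∑' k, ∑' l,
        pow2 (-y) * (atomConst σ D * (K k y * K l y) * n k l y x) := by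
    refine (enorm_retarded_le (h.integrable hΦ.bdd) (h.integrable hΓ.bdd)).trans ?_
    gcongr with y x
    simp_rw [ENNReal.tsum_mul_left]
    refine mul_le_mul' le_rfl ((enorm_inner_le_tsum (h.hasSum_setIntegral hΦ.bdd hA hAs _)
      (h.hasSum_setIntegral hΓ.bdd hB hBs _)).trans ?_)
    exact ENNReal.tsum_le_tsum fun k => ENNReal.tsum_le_tsum fun l =>
      h.enorm_inner_atoms_le hσ hD (bdd hΦ hAs k) (bdd hΓ hBs l) (hc k) (hd l) k l
        (hA1 k) (hA2 k) (hB1 l) (hB2 l) x y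
  have hgm : ∀ k l, Measurable (Function.uncurry fun y x : ℝ =>
      pow2 (-y) * (atomConst σ D * (K k y * K l y) * n k l y x)) := fun k l => by
    have m1 : Measurable fun p : ℝ × ℝ => pow2 (-p.1) := measurable_pow2.comp (by fun_prop)
    exact m1.mul ((((hKm k).comp measurable_fst).mul ((hKm l).comp measurable_fst)).const_mul _
      |>.mul (hnm k l))
  rw [lintegral_lintegral_tsum_tsum hgm] at step1
  have step2 : ∀ k l, ∫⁻ y, ∫⁻ x, pow2 (-y) * (atomConst σ D * (K k y * K l y) * n k l y x) ≤
      atomConst σ D * ((∫⁻ y, K k y * K l y) * nrm2 (c k) Set.univ * nrm2 (d l) Set.univ) := by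
    intro k l
    calc _ = ∫⁻ y, pow2 (-y) * (atomConst σ D * (K k y * K l y) * ∫⁻ x, n k l y x) := by
          refine lintegral_congr fun y => ?_
          rw [lintegral_const_mul _ ((hnm k l).of_uncurry_left.const_mul _),
            lintegral_const_mul _ (hnm k l).of_uncurry_left]
      _ ≤ ∫⁻ y, atomConst σ D * (nrm2 (c k) Set.univ * nrm2 (d l) Set.univ) * (K k y * K l y) := by
          refine lintegral_mono fun y => ?_
          refine (mul_le_mul' le_rfl (mul_le_mul' le_rfl
            (lintegral_nrm2_mul_nrm2 (hc k) (hd l) y))).trans (le_of_eq ?_)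
          have : pow2 (-y) * pow2 y = 1 := by rw [← pow2_add]; simp [pow2]
          calc _ = (pow2 (-y) * pow2 y) * (atomConst σ D *
                (nrm2 (c k) Set.univ * nrm2 (d l) Set.univ) * (K k y * K l y)) := by ring
            _ = _ := by rw [this, one_mul]
      _ = _ := by
          have : Measurable fun y => K k y * K l y := (hKm k).mul (hKm l)
          rw [lintegral_const_mul _ this]
          ring
  have hsym : ∀ k l, ∫⁻ y, K k y * K l y = ∫⁻ y, K l y * K k y := fun k l =>
    lintegral_congr fun y => mul_comm _ _
  have step3 := schur_tsum (w := fun k l => ∫⁻ y, K k y * K l y) (C := C)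
    (a := fun k => nrm2 (c k) Set.univ) (b := fun l => nrm2 (d l) Set.univ) hk
    (fun l => by simp_rw [fun k => hsym k l]; exact hk l)
  refine step1.trans ?_
  calc _ ≤ tentMass⁻¹ * ∑' k, ∑' l, atomConst σ D *
        ((∫⁻ y, K k y * K l y) * nrm2 (c k) Set.univ * nrm2 (d l) Set.univ) := by
        gcongr with k l
        exact step2 k l
    _ ≤ tentMass⁻¹ * (atomConst σ D * (C * ((2 * mixNorm 2 (2 / (1 + 1 / σ)) Φ) *
          (2 * mixNorm 2 (2 / (1 + 1 / σ)) Γ)))) := by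
        simp_rw [ENNReal.tsum_mul_left]
        gcongr
        refine step3.trans ?_
        gcongr
        · exact hAn
        · exact hBn
    _ = _ := by ring

theorem integral_advanced_eq {H : Type} [NormedAddCommGroup H] [InnerProductSpace ℂ H]
    (u v : ℝ → H) :
    ∫ t, inner ℂ (v t) (∫ τ in Set.Ioi t, u τ) =
      ∫ t, inner ℂ (v (-t)) (∫ τ in Set.Iio t, u (-τ)) := by
  rw [← integral_neg_eq_self]
  refine integral_congr_ae (ae_of_all _ fun t => ?_)
  simp only
  rw [← integral_Iic_eq_integral_Iio, integral_comp_neg_Iic]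

section Primitives

variable {H : Type} [NormedAddCommGroup H] [InnerProductSpace ℂ H]

theorem continuous_setIntegral_Iio {u : ℝ → H} (hu : Integrable u) :
    Continuous fun t => ∫ τ in Set.Iio t, u τ := by
  have h : ∀ t, ∫ τ in Set.Iio t, u τ = (∫ τ in Set.Iic 0, u τ) + ∫ τ in (0 : ℝ)..t, u τ :=
    fun t => by
      rw [← integral_Iic_eq_integral_Iio, ← intervalIntegral.integral_Iic_sub_Iic
        hu.integrableOn hu.integrableOn]
      abel
  simp_rw [h]
  exact continuous_const.add (hu.continuous_primitive 0)

theorem integrable_inner_of_continuous {v w : ℝ → H} (hv : Integrable v) (hw : Continuous w)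
    {C : ℝ} (hC : ∀ t, ‖w t‖ ≤ C) : Integrable fun t => inner ℂ (v t) (w t) := by
  refine (hv.norm.mul_const C).mono' (hv.1.inner hw.aestronglyMeasurable)
    (ae_of_all _ fun t => (norm_inner_le_norm _ _).trans ?_)
  gcongr
  exact hC t

theorem norm_setIntegral_le_integral_norm {u : ℝ → H} (hu : Integrable u) (S : Set ℝ) :
    ‖∫ τ in S, u τ‖ ≤ ∫ τ, ‖u τ‖ :=
  (norm_integral_le_integral_norm _).trans (setIntegral_le_integral hu.norm
    (ae_of_all _ fun _ => norm_nonneg _))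

theorem integrable_inner_Iio {u v : ℝ → H} (hu : Integrable u) (hv : Integrable v) :
    Integrable fun t => inner ℂ (v t) (∫ τ in Set.Iio t, u τ) :=
  integrable_inner_of_continuous hv (continuous_setIntegral_Iio hu)
    fun _ => norm_setIntegral_le_integral_norm hu _

theorem setIntegral_Ioi_eq {u : ℝ → H} (hu : Integrable u) (t : ℝ) :
    ∫ τ in Set.Ioi t, u τ = (∫ τ, u τ) - ∫ τ in Set.Iio t, u τ := by
  rw [← integral_Iic_eq_integral_Iio, ← Set.compl_Iic, eq_sub_iff_add_eq, add_comm]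
  exact integral_add_compl measurableSet_Iic hu

theorem integrable_inner_Ioi {u v : ℝ → H} (hu : Integrable u) (hv : Integrable v) :
    Integrable fun t => inner ℂ (v t) (∫ τ in Set.Ioi t, u τ) := by
  refine integrable_inner_of_continuous hv ?_ fun _ => norm_setIntegral_le_integral_norm hu _
  simp_rw [setIntegral_Ioi_eq hu]
  exact continuous_const.sub (continuous_setIntegral_Iio hu)

variable [CompleteSpace H]

theorem inner_integral_eq_retarded_add {u v : ℝ → H} (hu : Integrable u) (hv : Integrable v) :
    inner ℂ (∫ t, v t) (∫ τ, u τ) = (∫ t, inner ℂ (v t) (∫ τ in Set.Iio t, u τ)) +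
      ∫ t, inner ℂ (v t) (∫ τ in Set.Ioi t, u τ) := by
  rw [integral_integral_inner hu hv, ← integral_add (integrable_inner_Iio hu hv)
    (integrable_inner_Ioi hu hv)]
  refine integral_congr_ae (ae_of_all _ fun t => ?_)
  simp only
  rw [integral_inner hu, ← inner_add_right, setIntegral_Ioi_eq hu, add_sub_cancel]

end Primitives

section DecayingFamilies

variable {X : Type} [MeasurableSpace X] {μ : Measure X} {H : Type} [NormedAddCommGroup H]
  [InnerProductSpace ℂ H] {σ D : ℝ} {T : ℝ → Lp ℂ 2 μ →L[ℂ] H} {q : ℝ}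

theorem IsTest.neg {Φ : SimpleFunc ℝ (Lp ℂ 2 μ)} (hΦ : IsTest q Φ) :
    IsTest q (Φ.comp Neg.neg measurable_neg) where
  bdd := by
    obtain ⟨R, hR⟩ := hΦ.bdd
    exact ⟨R, fun τ hτ => hR (-τ) (by rwa [abs_neg])⟩
  fin := fun τ => hΦ.fin (-τ)

theorem mixNorm_neg (ρ q : ℝ) (Φ : SimpleFunc ℝ (Lp ℂ 2 μ)) :
    mixNorm ρ q (Φ.comp Neg.neg measurable_neg) = mixNorm ρ q Φ := by
  unfold mixNorm
  congr 1
  exact lintegral_neg_eq_self (fun τ => eLpNorm (Φ τ) (ENNReal.ofReal q) μ ^ ρ)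

theorem mixNorm_restrict {ρ : ℝ} (hρ : 0 < ρ) (q : ℝ) (Φ : SimpleFunc ℝ (Lp ℂ 2 μ)) {S : Set ℝ}
    (hS : MeasurableSet S) : mixNorm ρ q (Φ.restrict S) =
      (∫⁻ τ in S, eLpNorm (Φ τ) (ENNReal.ofReal q) μ ^ ρ) ^ (1 / ρ) := by
  unfold mixNorm
  congr 1
  rw [← lintegral_indicator hS]
  refine lintegral_congr fun τ => ?_
  rw [SimpleFunc.restrict_apply _ hS]
  by_cases h : τ ∈ S
  · simp [h]
  · rw [Set.indicator_of_notMem h, Set.indicator_of_notMem h, eLpNorm_coe_zero,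
      ENNReal.zero_rpow_of_pos hρ]

theorem mixNorm_restrict_le {ρ : ℝ} (hρ : 0 < ρ) (q : ℝ) (Φ : SimpleFunc ℝ (Lp ℂ 2 μ)) {S : Set ℝ}
    (hS : MeasurableSet S) : mixNorm ρ q (Φ.restrict S) ≤ mixNorm ρ q Φ := by
  rw [mixNorm_restrict hρ q Φ hS]
  exact ENNReal.rpow_le_rpow (setLIntegral_le_lintegral _ _) (by positivity)

/-- The dual Strichartz norm with spatial exponent `2 / (1 + θ)`. -/
noncomputable def admNorm (σ θ : ℝ) (Φ : SimpleFunc ℝ (Lp ℂ 2 μ)) : ℝ≥0∞ :=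
  mixNorm (2 / (2 - σ * θ)) (2 / (1 + θ)) Φ

theorem enorm_le_of_sq_le {E : Type*} [NormedAddCommGroup E] [InnerProductSpace ℂ E] {x : E}
    {C N : ℝ≥0∞} (h : ‖inner ℂ x x‖ₑ ≤ C * (N * N)) : ‖x‖ₑ ≤ C ^ (1 / 2 : ℝ) * N := by
  have e0 : ‖inner ℂ x x‖ₑ = ‖x‖ₑ ^ (2 : ℝ) := by
    rw [inner_self_eq_norm_sq_to_K, enorm_pow, ENNReal.rpow_ofNat]
    congr 1
    rw [← ofReal_norm, ← ofReal_norm]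
    simp
  rw [e0] at h
  have := ENNReal.rpow_le_rpow h (show (0 : ℝ) ≤ 1 / 2 by norm_num)
  rwa [← ENNReal.rpow_mul, show (2 : ℝ) * (1 / 2) = 1 by norm_num, ENNReal.rpow_one,
    ENNReal.mul_rpow_of_nonneg _ _ (by norm_num), ← sq, ← ENNReal.rpow_natCast,
    ← ENNReal.rpow_mul, show ((2 : ℕ) : ℝ) * (1 / 2) = 1 by norm_num, ENNReal.rpow_one] at this

/-- The homogeneous dual Strichartz estimate away from the endpoint. -/
theorem exists_homogeneous_of_lt {θ : ℝ} (hD : 0 < D) (hσ : 0 < σ) (h0 : 0 < θ) (h1 : θ ≤ 1)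
    (hl : σ * θ < 1) : ∃ C : ℝ≥0∞, C ≠ ∞ ∧
    ∀ {X : Type} [MeasurableSpace X] {μ : Measure X} {H : Type} [NormedAddCommGroup H]
      [InnerProductSpace ℂ H] [CompleteSpace H] {T : ℝ → Lp ℂ 2 μ →L[ℂ] H}, Decays σ D T →
    ∀ {Φ : SimpleFunc ℝ (Lp ℂ 2 μ)}, IsTest (2 / (1 + θ)) Φ →
    ‖∫ τ, T τ (Φ τ)‖ₑ ≤ C * admNorm σ θ Φ := by
  obtain ⟨C1, hC1, hint⟩ := interpolate_inner h0.le h1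
  obtain ⟨C2, hC2, hls⟩ := hardy_littlewood_sobolev (mul_pos hσ h0) hl
  refine ⟨(C1 * ENNReal.ofReal (D ^ θ) * C2) ^ (1 / 2 : ℝ), by finiteness, ?_⟩
  intro X _ μ H _ _ _ T h Φ hΦ
  have hu := h.integrable hΦ.bdd
  set q := 2 / (1 + θ) with hq
  set ρ := 2 / (2 - σ * θ) with hρ
  have hρ0 : 0 < ρ := div_pos (by norm_num) (by linarith)
  set a : ℝ → ℝ := fun τ => (eLpNorm (Φ τ) (ENNReal.ofReal q) μ).toReal with ha
  have haE : ∀ τ, ENNReal.ofReal (a τ) = eLpNorm (Φ τ) (ENNReal.ofReal q) μ := fun τ =>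
    ENNReal.ofReal_toReal (hΦ.fin τ)
  have ham : Measurable a := (measurable_eLpNorm_simple Φ _).ennreal_toReal
  have hae : ∀ τ, ENNReal.ofReal (a τ ^ ρ) = eLpNorm (Φ τ) (ENNReal.ofReal q) μ ^ ρ := fun τ => by
    rw [← haE, ENNReal.ofReal_rpow_of_nonneg ENNReal.toReal_nonneg hρ0.le]
  have hfin : ∫⁻ x, ENNReal.ofReal (a x ^ ρ) ≠ ∞ := by
    simp_rw [hae]
    exact hΦ.lintegral_ne_top hρ0
  have hk := hls ρ (by rw [hρ]; field_simp) a a (fun _ => ENNReal.toReal_nonneg)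
    (fun _ => ENNReal.toReal_nonneg) ham ham hfin hfin
  refine enorm_le_of_sq_le ((enorm_inner_integral_le hu hu).trans ?_)
  have hp : ∀ t τ, τ ≠ t → ‖inner ℂ (T t (Φ t)) (T τ (Φ τ))‖ₑ ≤ C1 * ENNReal.ofReal (D ^ θ) *
      (ENNReal.ofReal (|t - τ| ^ (-(σ * θ))) * (ENNReal.ofReal (a τ) * ENNReal.ofReal (a t))) := by
    intro t τ hne
    have hpos : 0 < |t - τ| := abs_pos.2 (sub_ne_zero.2 hne.symm)
    refine (hint (T t) (T τ) (h.contr t) (h.contr τ) (D * |t - τ| ^ (-σ)) (by positivity)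
      (fun f g => h.decay τ t f g hne) (Φ τ) (Φ t) (hΦ.fin τ) (hΦ.fin t)).trans (le_of_eq ?_)
    rw [haE, haE, Real.mul_rpow hD.le (by positivity), ← Real.rpow_mul hpos.le, neg_mul,
      ENNReal.ofReal_mul (by positivity)]
    ring
  have hg : Measurable (Function.uncurry fun t τ : ℝ => ENNReal.ofReal (|t - τ| ^ (-(σ * θ))) *
      (ENNReal.ofReal (a τ) * ENNReal.ofReal (a t))) := by
    unfold Function.uncurry
    fun_prop
  calc _ ≤ ∫⁻ t, ∫⁻ τ, C1 * ENNReal.ofReal (D ^ θ) * (ENNReal.ofReal (|t - τ| ^ (-(σ * θ))) *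
        (ENNReal.ofReal (a τ) * ENNReal.ofReal (a t))) := by
        refine lintegral_mono fun t => lintegral_mono_ae ?_
        filter_upwards [Measure.ae_ne volume t] with τ hτ using hp t τ hτ
    _ = C1 * ENNReal.ofReal (D ^ θ) * ∫⁻ t, ∫⁻ τ, (ENNReal.ofReal (|t - τ| ^ (-(σ * θ))) *
        (ENNReal.ofReal (a τ) * ENNReal.ofReal (a t))) := by
        rw [← lintegral_const_mul _ hg.lintegral_prod_right]
        exact lintegral_congr fun t => lintegral_const_mul _ hg.of_uncurry_left
    _ ≤ _ := (mul_le_mul' le_rfl hk).trans (le_of_eq (by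
        simp_rw [hae]
        rw [admNorm, mixNorm]
        ring))

/-- The homogeneous dual Strichartz estimate. -/
theorem exists_homogeneous {θ : ℝ} (hD : 0 < D) (hσ : 0 < σ) (hσ1 : σ ≠ 1) (h0 : 0 ≤ θ)
    (h1 : θ ≤ 1) (hl : σ * θ ≤ 1) : ∃ C : ℝ≥0∞, C ≠ ∞ ∧
    ∀ {X : Type} [MeasurableSpace X] {μ : Measure X} {H : Type} [NormedAddCommGroup H]
      [InnerProductSpace ℂ H] [CompleteSpace H] {T : ℝ → Lp ℂ 2 μ →L[ℂ] H}, Decays σ D T →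
    ∀ {Φ : SimpleFunc ℝ (Lp ℂ 2 μ)}, IsTest (2 / (1 + θ)) Φ →
    ‖∫ τ, T τ (Φ τ)‖ₑ ≤ C * admNorm σ θ Φ := by
  rcases h0.eq_or_lt with h0' | h0'
  · subst h0'
    refine ⟨1, by norm_num, ?_⟩
    intro X _ μ H _ _ _ T h Φ hΦ
    refine (enorm_integral_le_lintegral_enorm _).trans ?_
    rw [admNorm, mixNorm, one_mul, mul_zero, sub_zero, add_zero, div_one, div_self two_ne_zero,
      div_one, ENNReal.rpow_one]
    refine lintegral_mono fun τ => (enorm_le_iff_norm_le.2 (h.contr τ _)).trans ?_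
    rw [Lp.enorm_def, ENNReal.rpow_one, ENNReal.ofReal_ofNat]
  rcases hl.lt_or_eq with hl | hl
  · exact exists_homogeneous_of_lt hD hσ h0' h1 hl
  · have hσ2 : 1 < σ := by
      refine lt_of_le_of_ne ?_ hσ1.symm
      nlinarith
    have hθ : θ = 1 / σ := by field_simp; linarith
    obtain ⟨C, hC, hb⟩ := exists_endpoint_retarded hσ2 hD
    refine ⟨(2 * C) ^ (1 / 2 : ℝ), by finiteness, ?_⟩
    intro X _ μ H _ _ _ T h Φ hΦ
    have hu := h.integrable hΦ.bdd
    have e1 : admNorm σ θ Φ = mixNorm 2 (2 / (1 + 1 / σ)) Φ := by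
      rw [admNorm, hl, hθ]; norm_num
    rw [hθ] at hΦ
    refine enorm_le_of_sq_le ?_
    rw [inner_integral_eq_retarded_add hu hu, integral_advanced_eq]
    refine (enorm_add_le _ _).trans ((add_le_add (hb h hΦ hΦ) (hb h.reflect hΦ.neg hΦ.neg)).trans
      (le_of_eq ?_))
    rw [mixNorm_neg, e1]
    ring

end DecayingFamilies

theorem add_rpow_le_two_rpow_mul {s b c : ℝ} (hs : 0 < s) (hs1 : s ≤ 1) (hb : 0 ≤ b) (hc : 0 ≤ c) :
    b ^ s + c ^ s ≤ 2 ^ (1 - s) * (b + c) ^ s := by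
  obtain ⟨-, h⟩ := Real.concaveOn_rpow hs.le hs1
  replace h := h (Set.mem_Ici.2 hb) (Set.mem_Ici.2 hc) (show (0 : ℝ) ≤ 1 / 2 by norm_num)
    (show (0 : ℝ) ≤ 1 / 2 by norm_num) (by norm_num)
  simp only [smul_eq_mul] at h
  rw [← mul_add, ← mul_add, Real.mul_rpow (by norm_num) (by positivity), one_div,
    Real.inv_rpow (by norm_num)] at h
  rw [Real.rpow_sub (by norm_num), Real.rpow_one]
  calc b ^ s + c ^ s = 2 * (2⁻¹ * (b ^ s + c ^ s)) := by ring
    _ ≤ 2 * ((2 ^ s)⁻¹ * (b + c) ^ s) := by linarith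
    _ = _ := by ring

section ChristKiselev

variable {H : Type} [NormedAddCommGroup H] [InnerProductSpace ℂ H] [CompleteSpace H]

/-- The retarded bilinear form on the interval `[x, y]`. -/
noncomputable def retardedForm (u v : ℝ → H) (x y : ℝ) : ℂ :=
  ∫ t in x..y, inner ℂ (v t) (∫ τ in x..t, u τ)

theorem retardedForm_split {u v : ℝ → H} (hu : Integrable u) (hv : Integrable v) (x m y : ℝ) :
    retardedForm u v x y = retardedForm u v x m + retardedForm u v m y +
      inner ℂ (∫ t in m..y, v t) (∫ τ in x..m, u τ) := by
  have hb : ∀ a : ℝ, ∀ t, ‖∫ τ in a..t, u τ‖ ≤ ∫ τ, ‖u τ‖ := fun a t => by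
    rw [intervalIntegral.norm_intervalIntegral_eq]
    exact norm_setIntegral_le_integral_norm hu _
  have hi : ∀ a : ℝ, Integrable fun t => inner ℂ (v t) (∫ τ in a..t, u τ) := fun a =>
    integrable_inner_of_continuous hv (hu.continuous_primitive a) (hb a)
  have hc : Integrable fun t => inner ℂ (v t) (∫ τ in x..m, u τ) :=
    integrable_inner_of_continuous hv continuous_const fun _ => le_rfl
  have h1 : inner ℂ (∫ t in m..y, v t) (∫ τ in x..m, u τ) =
      ∫ t in m..y, inner ℂ (v t) (∫ τ in x..m, u τ) := by
    set c := ∫ τ in x..m, u τ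
    rw [← inner_conj_symm, intervalIntegral, intervalIntegral, inner_sub_right, map_sub,
      ← integral_inner hv.integrableOn, ← integral_inner hv.integrableOn, ← integral_conj,
      ← integral_conj]
    simp_rw [inner_conj_symm]
  rw [h1, retardedForm, ← intervalIntegral.integral_add_adjacent_intervals
    (hi x).intervalIntegrable (hi x).intervalIntegrable (b := m), retardedForm, retardedForm,
    add_assoc, ← intervalIntegral.integral_add (hi m).intervalIntegrable hc.intervalIntegrable]
  congr 1
  refine intervalIntegral.integral_congr fun t _ => ?_
  rw [← inner_add_right, add_comm, intervalIntegral.integral_add_adjacent_intervals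
    hu.intervalIntegrable hu.intervalIntegrable]

/-- A bilinear form of the Christ–Kiselev lemma. -/
theorem christ_kiselev {u v : ℝ → H} (hu : Integrable u) (hv : Integrable v) {α β : ℝ → ℝ}
    (hα : Integrable α) (hβ : Integrable β) (hα0 : ∀ t, 0 ≤ α t) (hβ0 : ∀ t, 0 ≤ β t)
    {s₁ s₂ C₁ C₂ Λ : ℝ} (h₁ : 0 < s₁) (h₂ : 0 < s₂) (h₂' : s₂ ≤ 1) (hs : 1 < s₁ + s₂)
    (hC₁ : 0 ≤ C₁) (hC₂ : 0 ≤ C₂)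
    (hu2 : ∀ x y, x ≤ y → ‖∫ τ in x..y, u τ‖ ≤ C₁ * (∫ τ in x..y, α τ) ^ s₁)
    (hv2 : ∀ x y, x ≤ y → ‖∫ τ in x..y, v τ‖ ≤ C₂ * (∫ τ in x..y, β τ) ^ s₂)
    (hΛ : ∀ x y, x ≤ y → ‖retardedForm u v x y‖ ≤
      Λ * ((∫ τ in x..y, α τ) ^ s₁ * (∫ τ in x..y, β τ) ^ s₂)) (x y : ℝ) (hxy : x ≤ y) :
    ‖retardedForm u v x y‖ ≤ C₁ * C₂ / (1 - 2 ^ (1 - s₁ - s₂)) *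
      ((∫ τ in x..y, α τ) ^ s₁ * (∫ τ in x..y, β τ) ^ s₂) := by
  set ρ : ℝ := 2 ^ (1 - s₁ - s₂) with hρ
  have hρ0 : 0 < ρ := by positivity
  have hρ1 : ρ < 1 := Real.rpow_lt_one_of_one_lt_of_neg (by norm_num) (by linarith)
  set L : ℝ := C₁ * C₂ / (1 - ρ) with hL
  have hLe : ρ * L + C₁ * C₂ = L := by
    have : 1 - ρ ≠ 0 := by linarith
    rw [hL]; field_simp; ring
  have iα : ∀ x y, IntervalIntegrable α volume x y := fun x y => hα.intervalIntegrable
  have iβ : ∀ x y, IntervalIntegrable β volume x y := fun x y => hβ.intervalIntegrable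
  have step : ∀ M : ℝ, (∀ x y, x ≤ y → ‖retardedForm u v x y‖ ≤
      M * ((∫ τ in x..y, α τ) ^ s₁ * (∫ τ in x..y, β τ) ^ s₂)) → ∀ x y, x ≤ y →
      ‖retardedForm u v x y‖ ≤ (ρ * M + C₁ * C₂) *
        ((∫ τ in x..y, α τ) ^ s₁ * (∫ τ in x..y, β τ) ^ s₂) := by
    intro M hM x y hxy
    set a := ∫ τ in x..y, α τ with ha
    set b := ∫ τ in x..y, β τ with hb
    have ha0 : 0 ≤ a := intervalIntegral.integral_nonneg hxy fun t _ => hα0 t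
    have hb0 : 0 ≤ b := intervalIntegral.integral_nonneg hxy fun t _ => hβ0 t
    obtain ⟨m, hm, hma⟩ : ∃ m ∈ Set.Icc x y, ∫ τ in x..m, α τ = a / 2 := by
      have := intermediate_value_Icc hxy (hα.continuous_primitive x).continuousOn
      refine this ⟨?_, ?_⟩
      · rw [intervalIntegral.integral_same]; linarith
      · rw [← ha]; linarith
    have hma2 : ∫ τ in m..y, α τ = a / 2 := by
      have := intervalIntegral.integral_add_adjacent_intervals (iα x m) (iα m y)
      rw [hma, ← ha] at this; linarith
    set b1 := ∫ τ in x..m, β τ with hb1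
    set b2 := ∫ τ in m..y, β τ with hb2
    have hb10 : 0 ≤ b1 := intervalIntegral.integral_nonneg hm.1 fun t _ => hβ0 t
    have hb20 : 0 ≤ b2 := intervalIntegral.integral_nonneg hm.2 fun t _ => hβ0 t
    have hbb : b1 + b2 = b := intervalIntegral.integral_add_adjacent_intervals (iβ x m) (iβ m y)
    have hM0 : 0 ≤ M * (a ^ s₁ * b ^ s₂) := (norm_nonneg _).trans (hM x y hxy)
    rw [retardedForm_split hu hv x m y]
    have e1 := hM x m hm.1
    have e2 := hM m y hm.2
    have e3 : ‖inner ℂ (∫ t in m..y, v t) (∫ τ in x..m, u τ)‖ ≤ C₁ * C₂ * (a ^ s₁ * b ^ s₂) := by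
      refine (norm_inner_le_norm _ _).trans ((mul_le_mul (hv2 m y hm.2) (hu2 x m hm.1)
        (norm_nonneg _) (by positivity)).trans ?_)
      rw [hma, ← hb2]
      have f1 : b2 ^ s₂ ≤ b ^ s₂ := Real.rpow_le_rpow hb20 (by linarith) h₂.le
      have f2 : (a / 2) ^ s₁ ≤ a ^ s₁ := Real.rpow_le_rpow (by linarith) (by linarith) h₁.le
      calc _ = C₁ * C₂ * ((a / 2) ^ s₁ * b2 ^ s₂) := by ring
        _ ≤ _ := by gcongr
    rw [hma, ← hb1] at e1
    rw [hma2, ← hb2] at e2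
    have e4 : (a / 2) ^ s₁ * b1 ^ s₂ + (a / 2) ^ s₁ * b2 ^ s₂ ≤ ρ * (a ^ s₁ * b ^ s₂) := by
      rw [← mul_add, Real.div_rpow ha0 (by norm_num)]
      have := add_rpow_le_two_rpow_mul h₂ h₂' hb10 hb20
      rw [hbb] at this
      calc _ ≤ a ^ s₁ / 2 ^ s₁ * (2 ^ (1 - s₂) * b ^ s₂) := by gcongr
        _ = _ := by
          rw [hρ, show 1 - s₁ - s₂ = (1 - s₂) - s₁ by ring,
            Real.rpow_sub (by norm_num) (1 - s₂) s₁]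
          ring
    rcases le_or_gt 0 M with hMs | hMs
    · calc _ ≤ M * ((a / 2) ^ s₁ * b1 ^ s₂) + M * ((a / 2) ^ s₁ * b2 ^ s₂) +
            C₁ * C₂ * (a ^ s₁ * b ^ s₂) := by
            refine (norm_add_le _ _).trans (add_le_add ((norm_add_le _ _).trans ?_) e3)
            exact add_le_add e1 e2
        _ ≤ _ := by nlinarith
    · have hz : a ^ s₁ * b ^ s₂ = 0 := by
        refine le_antisymm ?_ (by positivity)
        nlinarith [show 0 ≤ a ^ s₁ * b ^ s₂ by positivity]
      have e5 := hM x y hxy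
      rw [retardedForm_split hu hv x m y, ← ha, ← hb, hz, mul_zero] at e5
      rwa [hz, mul_zero]
  have iter : ∀ n : ℕ, ∀ x y, x ≤ y → ‖retardedForm u v x y‖ ≤
      (ρ ^ n * (Λ - L) + L) * ((∫ τ in x..y, α τ) ^ s₁ * (∫ τ in x..y, β τ) ^ s₂) := by
    intro n
    induction n with
    | zero => simpa using hΛ
    | succ n ih =>
      have := step _ ih
      rwa [show ρ * (ρ ^ n * (Λ - L) + L) + C₁ * C₂ = ρ ^ (n + 1) * (Λ - L) + L by
        rw [pow_succ]; linarith] at this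
  have hlim : Tendsto (fun n : ℕ => (ρ ^ n * (Λ - L) + L) *
      ((∫ τ in x..y, α τ) ^ s₁ * (∫ τ in x..y, β τ) ^ s₂)) atTop
      (nhds ((0 * (Λ - L) + L) * ((∫ τ in x..y, α τ) ^ s₁ * (∫ τ in x..y, β τ) ^ s₂))) :=
    (((tendsto_pow_atTop_nhds_zero_of_lt_one hρ0.le hρ1).mul_const _).add_const _).mul_const _
  rw [zero_mul, zero_add] at hlim
  exact ge_of_tendsto' hlim fun n => iter n x y hxy

end ChristKiselev

section

variable {X : Type} [MeasurableSpace X] {μ : Measure X} {H : Type} [NormedAddCommGroup H]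
  [InnerProductSpace ℂ H] {σ D : ℝ} {T : ℝ → Lp ℂ 2 μ →L[ℂ] H} {q ρ : ℝ}

/-- The integrand of the mixed norm as a real function. -/
noncomputable def dens (ρ q : ℝ) (Φ : SimpleFunc ℝ (Lp ℂ 2 μ)) (τ : ℝ) : ℝ :=
  (eLpNorm (Φ τ) (ENNReal.ofReal q) μ).toReal ^ ρ

theorem dens_nonneg (ρ q : ℝ) (Φ : SimpleFunc ℝ (Lp ℂ 2 μ)) (τ : ℝ) : 0 ≤ dens ρ q Φ τ :=
  Real.rpow_nonneg ENNReal.toReal_nonneg _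

theorem IsTest.ofReal_dens {Φ : SimpleFunc ℝ (Lp ℂ 2 μ)} (hΦ : IsTest q Φ) (hρ : 0 < ρ) (τ : ℝ) :
    ENNReal.ofReal (dens ρ q Φ τ) = eLpNorm (Φ τ) (ENNReal.ofReal q) μ ^ ρ := by
  rw [dens, ← ENNReal.ofReal_rpow_of_nonneg ENNReal.toReal_nonneg hρ.le,
    ENNReal.ofReal_toReal (hΦ.fin τ)]

theorem measurable_dens (ρ q : ℝ) (Φ : SimpleFunc ℝ (Lp ℂ 2 μ)) : Measurable (dens ρ q Φ) :=
  (measurable_eLpNorm_simple Φ _).ennreal_toReal.pow_const _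

theorem IsTest.integrable_dens {Φ : SimpleFunc ℝ (Lp ℂ 2 μ)} (hΦ : IsTest q Φ) (hρ : 0 < ρ) :
    Integrable (dens ρ q Φ) := by
  refine ⟨(measurable_dens ρ q Φ).aestronglyMeasurable, ?_⟩
  rw [hasFiniteIntegral_iff_ofReal (ae_of_all _ fun _ => dens_nonneg _ _ _ _)]
  simp_rw [hΦ.ofReal_dens hρ]
  exact (hΦ.lintegral_ne_top hρ).lt_top

theorem IsTest.mixNorm_restrict {Φ : SimpleFunc ℝ (Lp ℂ 2 μ)} (hΦ : IsTest q Φ) (hρ : 0 < ρ)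
    {S : Set ℝ} (hS : MeasurableSet S) :
    mixNorm ρ q (Φ.restrict S) = ENNReal.ofReal ((∫ τ in S, dens ρ q Φ τ) ^ (1 / ρ)) := by
  rw [Strichartz.mixNorm_restrict hρ q Φ hS, ← ENNReal.ofReal_rpow_of_nonneg
    (integral_nonneg fun _ => dens_nonneg _ _ _ _) (by positivity),
    ofReal_integral_eq_lintegral_ofReal (hΦ.integrable_dens hρ).integrableOn
    (ae_of_all _ fun _ => dens_nonneg _ _ _ _)]
  simp_rw [hΦ.ofReal_dens hρ]

theorem IsTest.mixNorm_eq {Φ : SimpleFunc ℝ (Lp ℂ 2 μ)} (hΦ : IsTest q Φ) (hρ : 0 < ρ) :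
    mixNorm ρ q Φ = ENNReal.ofReal ((∫ τ, dens ρ q Φ τ) ^ (1 / ρ)) := by
  have := hΦ.mixNorm_restrict hρ MeasurableSet.univ
  rwa [SimpleFunc.restrict_univ, Measure.restrict_univ] at this

theorem IsTest.exists_norm_le_dens {Φ : SimpleFunc ℝ (Lp ℂ 2 μ)} (hΦ : IsTest q Φ) (hq : 0 < q) :
    ∃ K, 0 ≤ K ∧ ∀ τ, ‖Φ τ‖ ≤ K * dens ρ q Φ τ := by
  set N : Lp ℂ 2 μ → ℝ := fun f => (eLpNorm f (ENNReal.ofReal q) μ).toReal ^ ρ with hN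
  have hN0 : ∀ f, 0 ≤ N f := fun f => Real.rpow_nonneg ENNReal.toReal_nonneg _
  refine ⟨∑ f ∈ Φ.range, ‖f‖ / N f, Finset.sum_nonneg fun f _ => div_nonneg (norm_nonneg _) (hN0 f),
    fun τ => ?_⟩
  change ‖Φ τ‖ ≤ _ * N (Φ τ)
  by_cases h0 : Φ τ = 0
  · rw [h0, norm_zero]
    exact mul_nonneg (Finset.sum_nonneg fun f _ => div_nonneg (norm_nonneg _) (hN0 f)) (hN0 _)
  · have hpos : 0 < N (Φ τ) := by
      refine Real.rpow_pos_of_pos (ENNReal.toReal_pos (fun h => h0 ?_) (hΦ.fin τ)) _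
      rw [eLpNorm_eq_zero_iff (Lp.aestronglyMeasurable _) (by simpa using hq)] at h
      exact Lp.eq_zero_iff_ae_eq_zero.2 h
    calc ‖Φ τ‖ = ‖Φ τ‖ / N (Φ τ) * N (Φ τ) := by field_simp
      _ ≤ _ := by
        refine mul_le_mul_of_nonneg_right ?_ (hN0 _)
        exact Finset.single_le_sum (f := fun f => ‖f‖ / N f)
          (fun f _ => div_nonneg (norm_nonneg _) (hN0 f)) (Φ.mem_range_self τ)

theorem Decays.setIntegral_restrict (h : Decays σ D T) (Φ : SimpleFunc ℝ (Lp ℂ 2 μ)) {S : Set ℝ}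
    (hS : MeasurableSet S) : ∫ τ, T τ (Φ.restrict S τ) = ∫ τ in S, T τ (Φ τ) := by
  rw [← integral_indicator hS]
  refine integral_congr_ae (ae_of_all _ fun τ => ?_)
  simp only
  rw [SimpleFunc.restrict_apply _ hS]
  by_cases h : τ ∈ S <;> simp [h]

theorem retarded_eq_retardedForm {u v : ℝ → H} (hu : Integrable u) {R : ℝ}
    (hR : ∀ τ, R < |τ| → u τ = 0) (hR' : ∀ τ, R < |τ| → v τ = 0) :
    ∫ t, inner ℂ (v t) (∫ τ in Set.Iio t, u τ) = retardedForm u v (-(|R| + 1)) (|R| + 1) := by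
  have hRR := le_abs_self R
  have h0 := abs_nonneg R
  rw [retardedForm]
  have h1 : ∀ t, ∫ τ in -(|R| + 1)..t, u τ = ∫ τ in Set.Iio t, u τ := fun t => by
    rw [← integral_Iic_eq_integral_Iio, ← intervalIntegral.integral_Iic_sub_Iic
        hu.integrableOn hu.integrableOn, sub_eq_self]
    refine setIntegral_eq_zero_of_forall_eq_zero fun τ hτ => hR τ ?_
    rw [abs_of_nonpos (by linarith [Set.mem_Iic.1 hτ])]
    linarith [Set.mem_Iic.1 hτ]
  simp_rw [h1]
  refine (intervalIntegral.integral_eq_integral_of_support_subset fun t ht => ?_).symm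
  by_contra hcon
  refine ht ?_
  simp only
  rw [hR' t, inner_zero_left]
  by_contra hle
  have := abs_le.1 (not_lt.1 hle)
  exact hcon ⟨by linarith [this.1], by linarith [this.2]⟩

theorem norm_retardedForm_le {u v : ℝ → H} (hu : Integrable u) (hv : Integrable v) {x y : ℝ}
    (hxy : x ≤ y) : ‖retardedForm u v x y‖ ≤ (∫ τ in x..y, ‖u τ‖) * ∫ t in x..y, ‖v t‖ := by
  rw [retardedForm, mul_comm, ← intervalIntegral.integral_mul_const]
  refine intervalIntegral.norm_integral_le_of_norm_le hxy (ae_of_all _ fun t ht => ?_)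
    (hv.norm.mul_const _).intervalIntegrable
  refine (norm_inner_le_norm _ _).trans (mul_le_mul_of_nonneg_left ?_ (norm_nonneg _))
  refine (intervalIntegral.norm_integral_le_integral_norm ht.1.le).trans ?_
  exact intervalIntegral.integral_mono_interval le_rfl ht.1.le ht.2
    (ae_of_all _ fun _ => norm_nonneg _) hu.norm.intervalIntegrable

variable [CompleteSpace H]

/-- The retarded bilinear Strichartz estimate. -/
theorem exists_retarded {θ₁ θ₂ : ℝ} (hD : 0 < D) (hσ : 0 < σ) (hσ1 : σ ≠ 1) (h0 : 0 ≤ θ₁)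
    (h1 : θ₁ ≤ 1) (hl : σ * θ₁ ≤ 1) (h0' : 0 ≤ θ₂) (h1' : θ₂ ≤ 1) (hl' : σ * θ₂ ≤ 1) :
    ∃ C : ℝ≥0∞, C ≠ ∞ ∧
    ∀ {X : Type} [MeasurableSpace X] {μ : Measure X} {H : Type} [NormedAddCommGroup H]
      [InnerProductSpace ℂ H] [CompleteSpace H] {T : ℝ → Lp ℂ 2 μ →L[ℂ] H}, Decays σ D T →
    ∀ {Φ Γ : SimpleFunc ℝ (Lp ℂ 2 μ)}, IsTest (2 / (1 + θ₁)) Φ → IsTest (2 / (1 + θ₂)) Γ →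
    ‖∫ t, inner ℂ (T t (Γ t)) (∫ τ in Set.Iio t, T τ (Φ τ))‖ₑ ≤
      C * (admNorm σ θ₁ Φ * admNorm σ θ₂ Γ) := by
  by_cases hend : σ * θ₁ = 1 ∧ σ * θ₂ = 1
  · obtain ⟨he, he'⟩ := hend
    have hσ2 : 1 < σ := by
      refine lt_of_le_of_ne ?_ hσ1.symm
      nlinarith
    have hθ : θ₁ = 1 / σ := by field_simp; linarith
    have hθ' : θ₂ = 1 / σ := by field_simp; linarith
    obtain ⟨C, hC, hb⟩ := exists_endpoint_retarded hσ2 hD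
    refine ⟨C, hC, ?_⟩
    intro X _ μ H _ _ _ T h Φ Γ hΦ hΓ
    rw [admNorm, admNorm, he, he', hθ, hθ', show (2 : ℝ) / (2 - 1) = 2 by norm_num]
    rw [hθ] at hΦ
    rw [hθ'] at hΓ
    exact hb h hΦ hΓ
  obtain ⟨C₁, hC₁, hom₁⟩ := exists_homogeneous hD hσ hσ1 h0 h1 hl
  obtain ⟨C₂, hC₂, hom₂⟩ := exists_homogeneous hD hσ hσ1 h0' h1' hl'
  set s₁ : ℝ := 1 - σ * θ₁ / 2 with hs₁
  set s₂ : ℝ := 1 - σ * θ₂ / 2 with hs₂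
  have hs : 1 < s₁ + s₂ := by
    rcases not_and_or.1 hend with h | h
    · have := lt_of_le_of_ne hl h; linarith
    · have := lt_of_le_of_ne hl' h; linarith
  have hs₁0 : 0 < s₁ := by linarith
  have hs₂0 : 0 < s₂ := by linarith
  have hs₁1 : s₁ ≤ 1 := by have := mul_nonneg hσ.le h0; linarith
  have hs₂1 : s₂ ≤ 1 := by have := mul_nonneg hσ.le h0'; linarith
  have hex : ∀ θ : ℝ, (1 : ℝ) / (2 / (2 - σ * θ)) = 1 - σ * θ / 2 := fun θ => by
    rw [one_div_div]; ring
  refine ⟨ENNReal.ofReal (C₁.toReal * C₂.toReal / (1 - 2 ^ (1 - s₁ - s₂))),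
    ENNReal.ofReal_ne_top, ?_⟩
  intro X _ μ H _ _ _ T h Φ Γ hΦ hΓ
  have hL0 : 0 ≤ C₁.toReal * C₂.toReal / (1 - 2 ^ (1 - s₁ - s₂)) := by
    refine div_nonneg (by positivity) (sub_nonneg.2 ?_)
    exact (Real.rpow_lt_one_of_one_lt_of_neg (by norm_num) (by linarith)).le
  have hom : ∀ {θ : ℝ} {C : ℝ≥0∞} {Ψ : SimpleFunc ℝ (Lp ℂ 2 μ)}, C ≠ ∞ → σ * θ ≤ 1 →
      IsTest (2 / (1 + θ)) Ψ → (∀ {Ξ : SimpleFunc ℝ (Lp ℂ 2 μ)}, IsTest (2 / (1 + θ)) Ξ →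
        ‖∫ τ, T τ (Ξ τ)‖ₑ ≤ C * admNorm σ θ Ξ) → ∀ x y, x ≤ y → ‖∫ τ in x..y, T τ (Ψ τ)‖ ≤
      C.toReal * (∫ τ in x..y, dens (2 / (2 - σ * θ)) (2 / (1 + θ)) Ψ τ) ^ (1 - σ * θ / 2) := by
    intro θ C Ψ hC hlθ hΨ hb x y hxy
    have hρ : 0 < 2 / (2 - σ * θ) := div_pos (by norm_num) (by linarith)
    have := hb (hΨ.restrict (measurableSet_Ioc (a := x) (b := y)))
    rw [h.setIntegral_restrict Ψ measurableSet_Ioc, admNorm,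
      hΨ.mixNorm_restrict hρ measurableSet_Ioc,
      hex, ← ofReal_norm, ← ENNReal.ofReal_toReal hC,
      ← ENNReal.ofReal_mul ENNReal.toReal_nonneg] at this
    rw [intervalIntegral.integral_of_le hxy, intervalIntegral.integral_of_le hxy]
    refine (ENNReal.ofReal_le_ofReal_iff ?_).1 this
    exact mul_nonneg ENNReal.toReal_nonneg
      (Real.rpow_nonneg (integral_nonneg fun _ => dens_nonneg _ _ _ _) _)
  have qual : ∀ {θ : ℝ} {Ψ : SimpleFunc ℝ (Lp ℂ 2 μ)}, 0 ≤ θ → σ * θ ≤ 1 →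
      IsTest (2 / (1 + θ)) Ψ → ∃ K, 0 ≤ K ∧ ∀ x y, x ≤ y → ∫ τ in x..y, ‖T τ (Ψ τ)‖ ≤
      K * (∫ τ in x..y, dens (2 / (2 - σ * θ)) (2 / (1 + θ)) Ψ τ) ^ (1 - σ * θ / 2) := by
    intro θ Ψ h0θ hlθ hΨ
    have hρ : 0 < 2 / (2 - σ * θ) := div_pos (by norm_num) (by linarith)
    obtain ⟨K, hK, hb⟩ := hΨ.exists_norm_le_dens (ρ := 2 / (2 - σ * θ)) (by positivity)
    have hi := hΨ.integrable_dens hρ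
    set α := dens (2 / (2 - σ * θ)) (2 / (1 + θ)) Ψ with hα
    have hs0 : 0 ≤ σ * θ / 2 := by positivity
    refine ⟨K * (∫ τ, α τ) ^ (σ * θ / 2), by
      have : 0 ≤ ∫ τ, α τ := integral_nonneg fun _ => dens_nonneg _ _ _ _
      positivity, fun x y hxy => ?_⟩
    have hA0 : 0 ≤ ∫ τ in x..y, α τ :=
      intervalIntegral.integral_nonneg hxy fun t _ => dens_nonneg _ _ _ _
    have hA1 : ∫ τ in x..y, α τ ≤ ∫ τ, α τ := by
      rw [intervalIntegral.integral_of_le hxy]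
      exact setIntegral_le_integral hi (ae_of_all _ fun _ => dens_nonneg _ _ _ _)
    calc _ ≤ ∫ τ in x..y, K * α τ := by
          refine intervalIntegral.integral_mono_on hxy
            (h.integrable hΨ.bdd).norm.intervalIntegrable
            (hi.const_mul K).intervalIntegrable fun τ _ => (h.contr τ _).trans (hb τ)
      _ = K * ((∫ τ in x..y, α τ) ^ (σ * θ / 2) * (∫ τ in x..y, α τ) ^ (1 - σ * θ / 2)) := by
          rw [intervalIntegral.integral_const_mul, ← Real.rpow_add_of_nonneg hA0 hs0 (by linarith),
            add_sub_cancel, Real.rpow_one]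
      _ ≤ _ := by
          rw [← mul_assoc]
          gcongr
  have hu := h.integrable hΦ.bdd
  have hv := h.integrable hΓ.bdd
  have hρ₁ : 0 < 2 / (2 - σ * θ₁) := div_pos (by norm_num) (by linarith)
  have hρ₂ : 0 < 2 / (2 - σ * θ₂) := div_pos (by norm_num) (by linarith)
  obtain ⟨K₁, hK₁, q₁⟩ := qual h0 hl hΦ
  obtain ⟨K₂, hK₂, q₂⟩ := qual h0' hl' hΓ
  have iα := hΦ.integrable_dens hρ₁
  have iβ := hΓ.integrable_dens hρ₂
  set α := dens (2 / (2 - σ * θ₁)) (2 / (1 + θ₁)) Φ with hα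
  set β := dens (2 / (2 - σ * θ₂)) (2 / (1 + θ₂)) Γ with hβ
  have ck := christ_kiselev hu hv iα iβ (dens_nonneg _ _ _) (dens_nonneg _ _ _) hs₁0 hs₂0 hs₂1 hs
    ENNReal.toReal_nonneg ENNReal.toReal_nonneg (hom hC₁ hl hΦ fun hΞ => hom₁ h hΞ)
    (hom hC₂ hl' hΓ fun hΞ => hom₂ h hΞ) (Λ := K₁ * K₂) (fun x y hxy => by
      refine (norm_retardedForm_le hu hv hxy).trans ((mul_le_mul (q₁ x y hxy) (q₂ x y hxy)
        (intervalIntegral.integral_nonneg hxy fun _ _ => norm_nonneg _)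
        (mul_nonneg hK₁ (Real.rpow_nonneg
          (intervalIntegral.integral_nonneg hxy fun _ _ => dens_nonneg _ _ _ _) _))).trans
        (le_of_eq ?_))
      ring)
  obtain ⟨R, hR⟩ := hΦ.bdd
  obtain ⟨R', hR'⟩ := hΓ.bdd
  rw [retarded_eq_retardedForm hu (R := max R R')
    (fun τ hτ => by rw [hR τ ((le_max_left _ _).trans_lt hτ), map_zero])
    (fun τ hτ => by rw [hR' τ ((le_max_right _ _).trans_lt hτ), map_zero])]
  set Y := |max R R'| + 1 with hY
  have hY0 : -Y ≤ Y := by have := abs_nonneg (max R R'); linarith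
  have tot : ∀ {g : ℝ → ℝ} {s : ℝ}, 0 ≤ s → Integrable g → (∀ τ, 0 ≤ g τ) →
      (∫ τ in -Y..Y, g τ) ^ s ≤ (∫ τ, g τ) ^ s := by
    intro g s hs hg hg0
    refine Real.rpow_le_rpow (intervalIntegral.integral_nonneg hY0 fun τ _ => hg0 τ) ?_ hs
    rw [intervalIntegral.integral_of_le hY0]
    exact setIntegral_le_integral hg (ae_of_all _ hg0)
  rw [admNorm, admNorm, hΦ.mixNorm_eq hρ₁, hΓ.mixNorm_eq hρ₂, hex, hex, ← ofReal_norm,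
    ← ENNReal.ofReal_mul (Real.rpow_nonneg (integral_nonneg fun _ => dens_nonneg _ _ _ _) _),
    ← ENNReal.ofReal_mul hL0]
  refine ENNReal.ofReal_le_ofReal ((ck _ _ hY0).trans (mul_le_mul_of_nonneg_left ?_ hL0))
  exact mul_le_mul (tot hs₁0.le iα (dens_nonneg _ _ _)) (tot hs₂0.le iβ (dens_nonneg _ _ _))
    (Real.rpow_nonneg (intervalIntegral.integral_nonneg hY0 fun _ _ => dens_nonneg _ _ _ _) _)
    (Real.rpow_nonneg (integral_nonneg fun _ => dens_nonneg _ _ _ _) _)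

/-- The bilinear form of the Duhamel operator. -/
noncomputable def duhamelForm (T : ℝ → Lp ℂ 2 μ →L[ℂ] H) (Φ Γ : SimpleFunc ℝ (Lp ℂ 2 μ)) : ℂ :=
  ∫ t, inner ℂ (T t (Γ t)) (∫ τ in (0 : ℝ)..t, T τ (Φ τ))

theorem duhamelForm_eq_sub {T : ℝ → Lp ℂ 2 μ →L[ℂ] H} (h : Decays σ D T) {q₁ q₂ : ℝ}
    {Φ Γ : SimpleFunc ℝ (Lp ℂ 2 μ)} (hΦ : IsTest q₁ Φ) (hΓ : IsTest q₂ Γ) :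
    duhamelForm T Φ Γ =
      (∫ t, inner ℂ (T t (Γ.restrict (Set.Ioi 0) t))
        (∫ τ in Set.Iio t, T τ (Φ.restrict (Set.Ioi 0) τ))) -
      ∫ t, inner ℂ (T t (Γ.restrict (Set.Iic 0) t))
        (∫ τ in Set.Ioi t, T τ (Φ.restrict (Set.Iic 0) τ)) := by
  have mI : MeasurableSet (Set.Ioi (0 : ℝ)) := measurableSet_Ioi
  have mJ : MeasurableSet (Set.Iic (0 : ℝ)) := measurableSet_Iic
  rw [duhamelForm, ← integral_sub
    (integrable_inner_Iio (h.integrable (hΦ.restrict mI).bdd) (h.integrable (hΓ.restrict mI).bdd))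
    (integrable_inner_Ioi (h.integrable (hΦ.restrict mJ).bdd) (h.integrable (hΓ.restrict mJ).bdd))]
  refine integral_congr_ae (ae_of_all _ fun t => ?_)
  have hres : ∀ S : Set ℝ, MeasurableSet S → ∀ U : Set ℝ, MeasurableSet U →
      ∫ τ in U, T τ (Φ.restrict S τ) = ∫ τ in U ∩ S, T τ (Φ τ) := fun S hS U hU => by
    rw [← integral_indicator hU, ← integral_indicator (hU.inter hS)]
    refine integral_congr_ae (ae_of_all _ fun τ => ?_)
    simp only [SimpleFunc.restrict_apply _ hS]
    by_cases h1 : τ ∈ U <;> by_cases h2 : τ ∈ S <;> simp [h1, h2]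
  simp only
  rw [hres _ mI _ measurableSet_Iio, hres _ mJ _ measurableSet_Ioi,
    SimpleFunc.restrict_apply _ mI, SimpleFunc.restrict_apply _ mJ]
  rcases lt_or_ge 0 t with ht | ht
  · rw [Set.indicator_of_mem (Set.mem_Ioi.2 ht), Set.indicator_of_notMem (by simpa using ht),
      map_zero, inner_zero_left, sub_zero, intervalIntegral.integral_of_le ht.le,
      integral_Ioc_eq_integral_Ioo, Set.inter_comm, Set.Ioi_inter_Iio]
  · rw [Set.indicator_of_notMem (by simpa using ht), Set.indicator_of_mem (Set.mem_Iic.2 ht),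
      map_zero, inner_zero_left, zero_sub, intervalIntegral.integral_of_ge ht,
      Set.Ioi_inter_Iic, inner_neg_right]

/-- The bilinear inhomogeneous Strichartz estimate for simple functions. -/
theorem exists_duhamelForm_le {θ₁ θ₂ : ℝ} (hD : 0 < D) (hσ : 0 < σ) (hσ1 : σ ≠ 1) (h0 : 0 ≤ θ₁)
    (h1 : θ₁ ≤ 1) (hl : σ * θ₁ ≤ 1) (h0' : 0 ≤ θ₂) (h1' : θ₂ ≤ 1) (hl' : σ * θ₂ ≤ 1) :
    ∃ C : ℝ≥0∞, C ≠ ∞ ∧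
    ∀ {X : Type} [MeasurableSpace X] {μ : Measure X} {H : Type} [NormedAddCommGroup H]
      [InnerProductSpace ℂ H] [CompleteSpace H] {T : ℝ → Lp ℂ 2 μ →L[ℂ] H}, Decays σ D T →
    ∀ {Φ Γ : SimpleFunc ℝ (Lp ℂ 2 μ)}, IsTest (2 / (1 + θ₁)) Φ → IsTest (2 / (1 + θ₂)) Γ →
    ‖duhamelForm T Φ Γ‖ₑ ≤ C * (admNorm σ θ₁ Φ * admNorm σ θ₂ Γ) := by
  obtain ⟨C, hC, hb⟩ := exists_retarded hD hσ hσ1 h0 h1 hl h0' h1' hl'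
  refine ⟨2 * C, by finiteness, ?_⟩
  intro X _ μ H _ _ _ T h Φ Γ hΦ hΓ
  have hu := h.integrable hΦ.bdd
  have hv := h.integrable hΓ.bdd
  have hρ₁ : 0 < 2 / (2 - σ * θ₁) := div_pos (by norm_num) (by linarith)
  have hρ₂ : 0 < 2 / (2 - σ * θ₂) := div_pos (by norm_num) (by linarith)
  have mI : MeasurableSet (Set.Ioi (0 : ℝ)) := measurableSet_Ioi
  have mJ : MeasurableSet (Set.Iic (0 : ℝ)) := measurableSet_Iic
  rw [duhamelForm_eq_sub h hΦ hΓ, integral_advanced_eq]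
  refine (enorm_sub_le).trans ((add_le_add (hb h (hΦ.restrict mI) (hΓ.restrict mI))
    (hb h.reflect (hΦ.restrict mJ).neg (hΓ.restrict mJ).neg)).trans ?_)
  rw [admNorm, admNorm, admNorm, admNorm, mixNorm_neg, mixNorm_neg, two_mul, add_mul]
  exact add_le_add
    (mul_le_mul' le_rfl (mul_le_mul' (mixNorm_restrict_le hρ₁ _ _ mI)
      (mixNorm_restrict_le hρ₂ _ _ mI)))
    (mul_le_mul' le_rfl (mul_le_mul' (mixNorm_restrict_le hρ₁ _ _ mJ)
      (mixNorm_restrict_le hρ₂ _ _ mJ)))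

end

section Duality

variable {Y : Type} [MeasurableSpace Y] {ν : Measure Y}

/-- Converse of Hölder's inequality, tested on bounded simple functions. -/
theorem eLpNorm_le_of_forall_simpleFunc [SigmaFinite ν] {p : ℝ≥0∞} {q : ℝ} (hq : 1 ≤ q)
    (hpq : p⁻¹ + (ENNReal.ofReal q)⁻¹ = 1) {g : Y → ℝ≥0∞} (hg : Measurable g) {Z : ℕ → Set Y}
    (hZ : ∀ n, MeasurableSet (Z n)) (hmono : Monotone Z) (hfin : ∀ n, ν (Z n) ≠ ∞)
    (hbd : ∀ n, ∀ x ∈ Z n, g x ≤ n) (hun : ∀ x, ∃ n, x ∈ Z n) {K : ℝ≥0∞}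
    (H : ∀ n (b : SimpleFunc Y ℝ≥0∞), (∀ x, b x ≠ ∞) → (∀ x ∉ Z n, b x = 0) →
      ∫⁻ x, b x * g x ∂ν ≤ K * (∫⁻ x, b x ^ q ∂ν) ^ (1 / q)) : eLpNorm g p ν ≤ K := by
  rcases hq.eq_or_lt with rfl | hq1
  · have hp : p = ∞ := by
      rw [ENNReal.ofReal_one, inv_one] at hpq
      have := ENNReal.eq_sub_of_add_eq (by simp) hpq
      simpa using this
    rw [hp, eLpNorm_exponent_top]
    refine eLpNormEssSup_le_of_ae_enorm_bound ?_
    have key : ∀ n, ∀ᵐ x ∂ν, (Z n).indicator g x ≤ K := fun n => by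
      refine ae_le_of_forall_setLIntegral_le_of_sigmaFinite (hg.indicator (hZ n)) fun s hs _ => ?_
      rw [setLIntegral_indicator (hZ n), setLIntegral_const]
      have h1 := H n ((SimpleFunc.const Y (1 : ℝ≥0∞)).restrict (Z n ∩ s)) (fun x => by
        rw [SimpleFunc.restrict_apply _ ((hZ n).inter hs)]
        by_cases h : x ∈ Z n ∩ s <;> simp [h]) (fun x hx => by
        rw [SimpleFunc.restrict_apply _ ((hZ n).inter hs)]
        exact Set.indicator_of_notMem (fun h => hx h.1) _)
      have e1 : ∀ x, (SimpleFunc.const Y (1 : ℝ≥0∞)).restrict (Z n ∩ s) x * g x =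
          (Z n ∩ s).indicator g x := fun x => by
        rw [SimpleFunc.restrict_apply _ ((hZ n).inter hs)]
        by_cases h : x ∈ Z n ∩ s <;> simp [h]
      have e2 : ∀ x, (SimpleFunc.const Y (1 : ℝ≥0∞)).restrict (Z n ∩ s) x ^ (1 : ℝ) =
          (Z n ∩ s).indicator 1 x := fun x => by
        rw [SimpleFunc.restrict_apply _ ((hZ n).inter hs), ENNReal.rpow_one]
        by_cases h : x ∈ Z n ∩ s <;> simp [h]
      simp only [e1, e2] at h1
      rw [lintegral_indicator ((hZ n).inter hs), lintegral_indicator_one ((hZ n).inter hs),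
        one_div_one, ENNReal.rpow_one] at h1
      exact h1.trans (by gcongr; exact Set.inter_subset_right)
    filter_upwards [ae_all_iff.2 key] with x hx
    obtain ⟨n, hn⟩ := hun x
    simpa [hn] using hx n
  have hq0 : 0 < q := by linarith
  have hq0' : 0 < q - 1 := by linarith
  have hp : p = ENNReal.ofReal (q / (q - 1)) := by
    have h1 : p⁻¹ = 1 - (ENNReal.ofReal q)⁻¹ :=
      ENNReal.eq_sub_of_add_eq (by simp [hq0]) hpq
    rw [← inv_inv p, h1, ← ENNReal.ofReal_inv_of_pos hq0, ← ENNReal.ofReal_one,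
      ← ENNReal.ofReal_sub _ (by positivity), ← ENNReal.ofReal_inv_of_pos
        (by rw [sub_pos]; exact inv_lt_one_of_one_lt₀ hq1)]
    congr 1
    field_simp
  have hP : 0 < q / (q - 1) := by positivity
  rw [hp, eLpNorm_eq_lintegral_rpow_enorm_toReal (by simpa using hP) (by simp),
    ENNReal.toReal_ofReal hP.le, one_div, ENNReal.rpow_inv_le_iff hP]
  simp only [enorm_eq_self]
  have main : ∀ n, ∫⁻ x in Z n, g x ^ (q / (q - 1)) ∂ν ≤ K ^ (q / (q - 1)) := fun n => by
    set f : Y → ℝ≥0∞ := (Z n).indicator fun x => g x ^ (q - 1)⁻¹ with hf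
    have mf : Measurable f := (hg.pow_const _).indicator (hZ n)
    have hfq : ∀ x, f x ^ q = (Z n).indicator (fun x => g x ^ (q / (q - 1))) x := fun x => by
      by_cases h : x ∈ Z n
      · simp only [hf, Set.indicator_of_mem h, ← ENNReal.rpow_mul]
        congr 1; field_simp
      · simp only [hf, Set.indicator_of_notMem h, ENNReal.zero_rpow_of_pos hq0]
    have hfg : ∀ x, f x ^ (q - 1) ≤ g x := fun x => by
      by_cases h : x ∈ Z n
      · simp only [hf, Set.indicator_of_mem h, ← ENNReal.rpow_mul]
        rw [inv_mul_cancel₀ hq0'.ne', ENNReal.rpow_one]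
      · simp only [hf, Set.indicator_of_notMem h, ENNReal.zero_rpow_of_pos hq0', zero_le]
    have hbk : ∀ k, ∫⁻ x, SimpleFunc.eapprox f k x ^ q ∂ν ≤ K ^ (q / (q - 1)) := fun k => by
      set b := SimpleFunc.eapprox f k with hb
      have hbf : ∀ x, b x ≤ f x := fun x => by
        rw [← SimpleFunc.iSup_eapprox_apply mf x]
        exact le_iSup (fun n => SimpleFunc.eapprox f n x) k
      have h1 := H n b (fun x => (SimpleFunc.eapprox_lt_top f k x).ne) (fun x hx => by
        have := hbf x
        simpa [hf, Set.indicator_of_notMem hx] using this)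
      set A := ∫⁻ x, b x ^ q ∂ν with hA
      have hAg : A ≤ ∫⁻ x, b x * g x ∂ν := lintegral_mono fun x => by
        calc b x ^ q = b x * b x ^ (q - 1) := by
              conv_rhs => rw [← ENNReal.rpow_one (b x), ← ENNReal.rpow_mul, one_mul]
              rw [← ENNReal.rpow_add_of_nonneg _ _ zero_le_one hq0'.le]; congr 1; ring
          _ ≤ b x * g x := mul_le_mul' le_rfl
              ((ENNReal.rpow_le_rpow (hbf x) hq0'.le).trans (hfg x))
      have hA_top : A ≠ ∞ := by
        refine ne_top_of_le_ne_top (b := (n : ℝ≥0∞) ^ (q / (q - 1)) * ν (Z n)) ?_ ?_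
        · exact ENNReal.mul_ne_top (ENNReal.rpow_ne_top_of_nonneg hP.le (by simp)) (hfin n)
        · rw [← setLIntegral_const, ← lintegral_indicator (hZ n)]
          refine lintegral_mono fun x => ((ENNReal.rpow_le_rpow (hbf x) hq0.le).trans
            (hfq x).le).trans ?_
          by_cases h : x ∈ Z n
          · simp only [Set.indicator_of_mem h]
            exact ENNReal.rpow_le_rpow (hbd n x h) hP.le
          · simp [h]
      have h2 := hAg.trans h1
      rcases eq_or_ne A 0 with h0 | h0
      · rw [h0]; exact zero_le
      have h3 : A ^ ((q - 1) / q) ≤ K := by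
        have hc0 : A ^ (1 / q) ≠ 0 := by
          simp [h0, hA_top]
        have hct : A ^ (1 / q) ≠ ∞ := ENNReal.rpow_ne_top_of_nonneg (by positivity) hA_top
        refine (ENNReal.mul_le_mul_iff_left hc0 hct).1 (le_trans (le_of_eq ?_) h2)
        rw [← ENNReal.rpow_add _ _ h0 hA_top]
        conv_rhs => rw [← ENNReal.rpow_one A]
        congr 1; field_simp; ring
      have h4 := ENNReal.rpow_le_rpow h3 hP.le
      rwa [← ENNReal.rpow_mul, div_mul_div_cancel₀ hq0.ne', div_self hq0'.ne',
        ENNReal.rpow_one] at h4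
    rw [← lintegral_indicator (hZ n)]
    simp only [← hfq]
    have e : ∀ x, f x ^ q = ⨆ k, SimpleFunc.eapprox f k x ^ q := fun x => by
      rw [← SimpleFunc.iSup_eapprox_apply mf x]
      exact (ENNReal.orderIsoRpow q hq0).map_iSup _
    simp only [e]
    rw [lintegral_iSup (fun k => (SimpleFunc.measurable _).pow_const _)
      (fun i j hij x => ENNReal.rpow_le_rpow (SimpleFunc.monotone_eapprox f hij x) hq0.le)]
    exact iSup_le hbk
  have hU : ⋃ n, Z n = Set.univ := Set.eq_univ_of_forall fun x => by simpa using hun x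
  rw [← setLIntegral_univ, ← hU, setLIntegral_iUnion_of_directed _ hmono.directed_le]
  exact iSup_le main

theorem eLpNorm_liminf_le {p : ℝ≥0∞} {g : ℕ → Y → ℝ≥0∞} (hg : ∀ n, Measurable (g n)) {K : ℝ≥0∞}
    (hK : ∀ n, eLpNorm (g n) p ν ≤ K) :
    eLpNorm (fun x => liminf (fun n => g n x) atTop) p ν ≤ K := by
  rcases eq_or_ne p 0 with rfl | h0
  · simp
  rcases eq_or_ne p ∞ with rfl | hp
  · simp only [eLpNorm_exponent_top] at hK ⊢
    refine eLpNormEssSup_le_of_ae_enorm_bound ?_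
    have : ∀ᵐ x ∂ν, ∀ n, g n x ≤ K := ae_all_iff.2 fun n =>
      (ENNReal.ae_le_essSup (g n)).mono fun x hx => hx.trans (hK n)
    filter_upwards [this] with x hx
    rw [enorm_eq_self]
    exact liminf_le_of_frequently_le' (Frequently.of_forall hx)
  have hpos := ENNReal.toReal_pos h0 hp
  simp only [eLpNorm_eq_lintegral_rpow_enorm_toReal h0 hp, enorm_eq_self, one_div,
    ENNReal.rpow_inv_le_iff hpos] at hK ⊢
  have e : ∀ x, liminf (fun n => g n x) atTop ^ p.toReal =
      liminf (fun n => g n x ^ p.toReal) atTop := fun x =>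
    (ENNReal.orderIsoRpow p.toReal hpos).liminf_apply (u := fun n => g n x)
  simp only [e]
  exact (lintegral_liminf_le fun n => (hg n).pow_const _).trans
    (liminf_le_of_frequently_le' (Frequently.of_forall hK))

end Duality

/-- A simple function selecting, among finitely many measurable functions, one with the largest
value. -/
theorem exists_simpleFunc_argmax {a : ℕ → ℝ → ℝ} (ha : ∀ i, Measurable (a i)) (N : ℕ) :
    ∃ s : SimpleFunc ℝ ℕ, ∀ t, ∀ i ≤ N, a i t ≤ a (s t) t := by
  induction N with
  | zero => exact ⟨SimpleFunc.const ℝ 0, fun t i hi => by simp [Nat.le_zero.1 hi]⟩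
  | succ N ih =>
    obtain ⟨s, hs⟩ := ih
    have m : Measurable fun t => a (s t) t :=
      (measurable_from_prod_countable_right (f := fun z : ℕ × ℝ => a z.1 z.2) ha).comp
        (s.measurable.prodMk measurable_id)
    set S : Set ℝ := {t | a (s t) t ≤ a (N + 1) t} with hS
    have mS : MeasurableSet S := measurableSet_le m (ha _)
    refine ⟨SimpleFunc.piecewise S mS (SimpleFunc.const ℝ (N + 1)) s, fun t i hi => ?_⟩
    rw [SimpleFunc.coe_piecewise]
    by_cases ht : t ∈ S
    · rw [Set.piecewise_eq_of_mem _ _ _ ht]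
      rcases Nat.le_succ_iff.1 hi with h | rfl
      · exact (hs t i h).trans ht
      · exact le_rfl
    · rw [Set.piecewise_eq_of_notMem _ _ _ ht]
      rcases Nat.le_succ_iff.1 hi with h | rfl
      · exact hs t i h
      · exact (not_le.1 fun h => ht h).le

section

variable {X : Type} [MeasurableSpace X] {μ : Measure X} {H : Type} [NormedAddCommGroup H]
  [InnerProductSpace ℂ H] {σ D : ℝ}

/-- A dense sequence, starting at `0`, in the part of `L²` where a second norm is at most one. -/
theorem exists_seq_dense_unitBall [TopologicalSpace.SeparableSpace (Lp ℂ 2 μ)] (p : ℝ≥0∞) :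
    ∃ ψ : ℕ → Lp ℂ 2 μ, ψ 0 = 0 ∧ (∀ i, eLpNorm (ψ i) p μ ≤ 1) ∧
      ∀ f : Lp ℂ 2 μ, eLpNorm f p μ ≤ 1 → f ∈ closure (Set.range ψ) := by
  obtain ⟨s, hsB, hsc, hd⟩ := (TopologicalSpace.IsSeparable.of_separableSpace
    {f : Lp ℂ 2 μ | eLpNorm f p μ ≤ 1}).exists_countable_dense_subset
  have hne : s.Nonempty := by
    rw [← closure_nonempty_iff]
    refine ⟨0, hd ?_⟩
    change eLpNorm ((0 : Lp ℂ 2 μ) : X → ℂ) p μ ≤ 1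
    rw [eLpNorm_coe_zero]
    exact zero_le
  obtain ⟨ψ, rfl⟩ := hsc.exists_eq_range hne
  refine ⟨fun i => Nat.casesOn i 0 ψ, rfl, fun i => ?_, fun f hf => ?_⟩
  · cases i with
    | zero => change eLpNorm ((0 : Lp ℂ 2 μ) : X → ℂ) p μ ≤ 1; rw [eLpNorm_coe_zero]; exact zero_le
    | succ i => exact hsB ⟨i, rfl⟩
  · refine closure_mono ?_ (hd hf)
    rintro _ ⟨i, rfl⟩
    exact ⟨i + 1, rfl⟩

theorem eLpNorm_coe_smul (c : ℂ) (f : Lp ℂ 2 μ) (p : ℝ≥0∞) :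
    eLpNorm (c • f : Lp ℂ 2 μ) p μ = ‖c‖ₑ * eLpNorm f p μ := by
  rw [eLpNorm_congr_ae (Lp.coeFn_smul c f), eLpNorm_const_smul]

/-- A bound for the real part of a linear functional on a dense subset of the unit ball gives a
bound for the functional. -/
theorem enorm_inner_le_of_dense {p : ℝ≥0∞} (hp : p ≠ 0) {ψ : ℕ → Lp ℂ 2 μ}
    (hd : ∀ f : Lp ℂ 2 μ, eLpNorm f p μ ≤ 1 → f ∈ closure (Set.range ψ)) (A : Lp ℂ 2 μ →L[ℂ] H)
    (v : H) {M : ℝ≥0∞} (hM : ∀ i, ENNReal.ofReal (inner ℂ (A (ψ i)) v).re ≤ M) (f : Lp ℂ 2 μ)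
    (hf : eLpNorm f p μ ≠ ∞) : ‖inner ℂ (A f) v‖ₑ ≤ M * eLpNorm f p μ := by
  have unit : ∀ g : Lp ℂ 2 μ, eLpNorm g p μ ≤ 1 → ENNReal.ofReal (inner ℂ (A g) v).re ≤ M := by
    intro g hg
    have hcl : IsClosed {g : Lp ℂ 2 μ | ENNReal.ofReal (inner ℂ (A g) v).re ≤ M} :=
      isClosed_le (ENNReal.continuous_ofReal.comp (Complex.continuous_re.comp
        (A.continuous.inner continuous_const))) continuous_const
    refine hcl.closure_subset_iff.2 ?_ (hd g hg)
    rintro _ ⟨i, rfl⟩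
    exact hM i
  rcases eq_or_ne (eLpNorm f p μ) 0 with h0 | h0
  · have : f = 0 := by
      rw [eLpNorm_eq_zero_iff (Lp.aestronglyMeasurable f) hp] at h0
      exact (Lp.eq_zero_iff_ae_eq_zero).2 h0
    simp [this]
  set z := inner ℂ (A f) v with hz
  rcases eq_or_ne z 0 with hz0 | hz0
  · simp [hz0]
  set n := (eLpNorm f p μ).toReal with hn
  have hnpos : 0 < n := ENNReal.toReal_pos h0 hf
  have hzn : 0 < ‖z‖ := norm_pos_iff.2 hz0
  set c : ℂ := z / (‖z‖ * n : ℝ) with hc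
  have hcn : ‖c‖ = n⁻¹ := by
    rw [hc, norm_div, Complex.norm_real, Real.norm_of_nonneg (by positivity)]
    field_simp
  have h1 := unit (c • f) (by
    rw [eLpNorm_coe_smul, ← ofReal_norm, hcn, ← ENNReal.ofReal_toReal hf, ← hn,
      ← ENNReal.ofReal_mul (by positivity), inv_mul_cancel₀ hnpos.ne', ENNReal.ofReal_one])
  have h2 : inner ℂ (A (c • f)) v = ((‖z‖ / n : ℝ) : ℂ) := by
    rw [map_smul, inner_smul_left, ← hz, hc, map_div₀, Complex.conj_ofReal, div_mul_eq_mul_div,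
      Complex.conj_mul']
    push_cast
    have : (‖z‖ : ℂ) ≠ 0 := by exact_mod_cast hzn.ne'
    field_simp
  rw [h2, Complex.ofReal_re] at h1
  rw [← ofReal_norm, ← ENNReal.ofReal_toReal hf, ← hn]
  calc ENNReal.ofReal ‖z‖ = ENNReal.ofReal (‖z‖ / n) * ENNReal.ofReal n := by
        rw [← ENNReal.ofReal_mul (by positivity), div_mul_cancel₀ _ hnpos.ne']
    _ ≤ _ := mul_le_mul' h1 le_rfl

theorem Decays.continuous_duhamel {T : ℝ → Lp ℂ 2 μ →L[ℂ] H} (h : Decays σ D T) {q : ℝ}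
    {Φ : SimpleFunc ℝ (Lp ℂ 2 μ)} (hΦ : IsTest q Φ) :
    Continuous fun t => ∫ τ in (0 : ℝ)..t, T τ (Φ τ) :=
  intervalIntegral.continuous_primitive (fun _ _ => (h.integrable hΦ.bdd).intervalIntegrable) 0

variable [CompleteSpace H]

theorem Decays.lintegral_le_duhamelForm {T : ℝ → Lp ℂ 2 μ →L[ℂ] H} (h : Decays σ D T) {q q' ρ : ℝ}
    {Φ : SimpleFunc ℝ (Lp ℂ 2 μ)} (hΦ : IsTest q Φ) {ψ : ℕ → Lp ℂ 2 μ}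
    (hψ : ∀ i, eLpNorm (ψ i) (ENNReal.ofReal q') μ ≤ 1) (s : SimpleFunc ℝ ℕ)
    (hs : ∀ t, 0 ≤ (inner ℂ (T t (ψ (s t))) (∫ τ in (0 : ℝ)..t, T τ (Φ τ))).re) (hρ : 0 < ρ)
    {R : ℝ} (b : SimpleFunc ℝ ℝ≥0∞) (hb : ∀ t, b t ≠ ∞) (hbR : ∀ t, R < |t| → b t = 0) :
    ∃ Γ : SimpleFunc ℝ (Lp ℂ 2 μ), IsTest q' Γ ∧
      mixNorm ρ q' Γ ≤ (∫⁻ t, b t ^ ρ) ^ (1 / ρ) ∧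
      ∫⁻ t, b t * ENNReal.ofReal (inner ℂ (T t (ψ (s t))) (∫ τ in (0 : ℝ)..t, T τ (Φ τ))).re ≤
        ‖duhamelForm T Φ Γ‖ₑ := by
  set v : ℝ → H := fun t => ∫ τ in (0 : ℝ)..t, T τ (Φ τ) with hv
  set Γ : SimpleFunc ℝ (Lp ℂ 2 μ) :=
    (b.pair s).map fun z => ((z.1.toReal : ℝ) : ℂ) • ψ z.2 with hΓ
  have eΓ : ∀ t, Γ t = (((b t).toReal : ℝ) : ℂ) • ψ (s t) := fun t => rfl
  have nΓ : ∀ t, eLpNorm (Γ t) (ENNReal.ofReal q') μ ≤ b t := fun t => by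
    rw [eΓ, eLpNorm_coe_smul, ← ofReal_norm, Complex.norm_real,
      Real.norm_of_nonneg ENNReal.toReal_nonneg, ENNReal.ofReal_toReal (hb t)]
    exact mul_le_of_le_one_right' (hψ _)
  have tΓ : IsTest q' Γ :=
    ⟨⟨R, fun t ht => by rw [eΓ, hbR t ht]; simp⟩, fun t => ne_top_of_le_ne_top (hb t) (nΓ t)⟩
  refine ⟨Γ, tΓ, ?_, ?_⟩
  · rw [mixNorm]
    gcongr with t
    exact nΓ t
  have hu := h.integrable hΦ.bdd
  have hi : Integrable fun t => inner ℂ (T t (Γ t)) (v t) :=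
    integrable_inner_of_continuous (h.integrable tΓ.bdd) (h.continuous_duhamel hΦ)
      (C := ∫ τ, ‖T τ (Φ τ)‖) fun t => by
        rw [hv]
        simp only
        rw [intervalIntegral.norm_intervalIntegral_eq]
        exact norm_setIntegral_le_integral_norm hu _
  have er : ∀ t, (inner ℂ (T t (Γ t)) (v t)).re =
      (b t).toReal * (inner ℂ (T t (ψ (s t))) (v t)).re :=
    fun t => by
      rw [eΓ, map_smul, inner_smul_left, Complex.conj_ofReal, Complex.re_ofReal_mul]
  have e1 : ∀ t, b t * ENNReal.ofReal (inner ℂ (T t (ψ (s t))) (v t)).re =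
      ENNReal.ofReal (inner ℂ (T t (Γ t)) (v t)).re := fun t => by
    rw [er, ENNReal.ofReal_mul ENNReal.toReal_nonneg, ENNReal.ofReal_toReal (hb t)]
  change ∫⁻ t, b t * ENNReal.ofReal (inner ℂ (T t (ψ (s t))) (v t)).re ≤ _
  have e2 := ofReal_integral_eq_lintegral_ofReal hi.re (ae_of_all _ fun t => by
    change 0 ≤ (inner ℂ (T t (Γ t)) (v t)).re
    rw [er]; exact mul_nonneg ENNReal.toReal_nonneg (hs t))
  rw [lintegral_congr e1]
  refine e2.ge.trans ?_
  rw [← ofReal_norm, integral_re (𝕜 := ℂ) hi]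
  refine ENNReal.ofReal_le_ofReal ?_
  exact Complex.re_le_norm _

end

/-- The Duhamel integral of a simple function has a measurable majorant obeying the inhomogeneous
Strichartz bound. -/
theorem exists_duhamel_majorant {σ D θ₁ θ₂ : ℝ} (hD : 0 < D) (hσ : 0 < σ) (hσ1 : σ ≠ 1)
    (h0 : 0 ≤ θ₁) (h1 : θ₁ ≤ 1) (hl : σ * θ₁ ≤ 1) (h0' : 0 ≤ θ₂) (h1' : θ₂ ≤ 1)
    (hl' : σ * θ₂ ≤ 1) :
    ∃ C : ℝ≥0∞, C ≠ ∞ ∧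
    ∀ {X : Type} [MeasurableSpace X] {μ : Measure X} [TopologicalSpace.SeparableSpace (Lp ℂ 2 μ)]
      {H : Type} [NormedAddCommGroup H] [InnerProductSpace ℂ H] [CompleteSpace H]
      {T : ℝ → Lp ℂ 2 μ →L[ℂ] H}, Decays σ D T →
    ∀ {r : ℝ≥0∞}, r⁻¹ + (ENNReal.ofReal (2 / (2 - σ * θ₂)))⁻¹ = 1 →
    ∀ {Φ : SimpleFunc ℝ (Lp ℂ 2 μ)}, IsTest (2 / (1 + θ₁)) Φ →
    ∃ M : ℝ → ℝ≥0∞, Measurable M ∧ eLpNorm M r volume ≤ C * admNorm σ θ₁ Φ ∧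
      ∀ t (f : Lp ℂ 2 μ), eLpNorm f (ENNReal.ofReal (2 / (1 + θ₂))) μ ≠ ∞ →
        ‖inner ℂ (T t f) (∫ τ in (0 : ℝ)..t, T τ (Φ τ))‖ₑ ≤
          M t * eLpNorm f (ENNReal.ofReal (2 / (1 + θ₂))) μ := by
  obtain ⟨C, hC, hb⟩ := exists_duhamelForm_le hD hσ hσ1 h0 h1 hl h0' h1' hl'
  refine ⟨C, hC, ?_⟩
  intro X _ μ _ H _ _ _ T h r hr Φ hΦ
  set v : ℝ → H := fun t => ∫ τ in (0 : ℝ)..t, T τ (Φ τ) with hv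
  have cv : Continuous v := h.continuous_duhamel hΦ
  set q := 2 / (1 + θ₂) with hq
  have hq0 : 0 < q := by positivity
  obtain ⟨ψ, hψ0, hψ1, hψd⟩ := exists_seq_dense_unitBall (μ := μ) (ENNReal.ofReal q)
  set a : ℕ → ℝ → ℝ := fun i t => (inner ℂ (T t (ψ i)) (v t)).re with ha
  have ma : ∀ i, Measurable (a i) := fun i =>
    (Complex.continuous_re.comp ((h.cont (ψ i)).inner cv)).measurable
  have ha0 : ∀ t, a 0 t = 0 := fun t => by simp [ha, hψ0]
  choose s hs using exists_simpleFunc_argmax ma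
  have hs0 : ∀ N t, 0 ≤ a (s N t) t := fun N t => by
    rw [← ha0 t]; exact hs N t 0 (Nat.zero_le _)
  set g : ℕ → ℝ → ℝ≥0∞ := fun N t => ENNReal.ofReal (a (s N t) t) with hg
  have mg : ∀ N, Measurable (g N) := fun N => ENNReal.measurable_ofReal.comp
    ((measurable_from_prod_countable_right (f := fun z : ℕ × ℝ => a z.1 z.2) ma).comp
      ((s N).measurable.prodMk measurable_id))
  have hρ : 1 ≤ 2 / (2 - σ * θ₂) := by
    rw [le_div_iff₀ (by linarith)]; nlinarith
  refine ⟨fun t => liminf (fun N => g N t) atTop, Measurable.liminf mg,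
    eLpNorm_liminf_le mg fun N => ?_, fun t f hf => ?_⟩
  · refine eLpNorm_le_of_forall_simpleFunc hρ hr (mg N)
      (Z := fun n => Set.Icc (-(n : ℝ)) n ∩ {t | g N t ≤ n})
      (fun n => measurableSet_Icc.inter (measurableSet_le (mg N) measurable_const))
      (fun m n hmn => Set.inter_subset_inter
        (Set.Icc_subset_Icc (by simpa using hmn) (by simpa using hmn))
        fun t (ht : g N t ≤ m) => ht.trans (by exact_mod_cast hmn))
      (fun n => ne_top_of_le_ne_top (by simp) (measure_mono (μ := volume) Set.inter_subset_left))
      (fun n t ht => ht.2) (fun t => ?_) (fun n b hbt hbz => ?_)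
    · obtain ⟨m, hm⟩ := exists_nat_ge |t|
      obtain ⟨k, hk⟩ := exists_nat_ge (a (s N t) t)
      have hmk : (m : ℝ) ≤ (max m k : ℕ) := by exact_mod_cast le_max_left m k
      have hkk : (k : ℝ) ≤ (max m k : ℕ) := by exact_mod_cast le_max_right m k
      refine ⟨max m k, abs_le.1 (hm.trans hmk), ?_⟩
      refine (ENNReal.ofReal_le_ofReal (hk.trans hkk)).trans ?_
      rw [ENNReal.ofReal_natCast]
    · obtain ⟨Γ, tΓ, nΓ, iΓ⟩ := h.lintegral_le_duhamelForm hΦ hψ1 (s N) (hs0 N)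
        (ρ := 2 / (2 - σ * θ₂)) (by linarith) (R := n) b hbt fun t ht => hbz t fun hz =>
          not_le.2 ht (abs_le.2 hz.1)
      refine iΓ.trans ((hb h hΦ tΓ).trans ?_)
      rw [← mul_assoc]
      exact mul_le_mul' le_rfl nΓ
  · refine enorm_inner_le_of_dense (by simpa using hq0) hψd (T t) (v t) (fun i => ?_) f hf
    refine le_liminf_of_le (by isBoundedDefault) ?_
    filter_upwards [eventually_ge_atTop i] with N hN
    exact ENNReal.ofReal_le_ofReal (hs N t i hN)

section

theorem exists_simpleFunc_of_cover {E : Type*} [Zero E] {A : ℕ → Set ℝ}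
    (hA : ∀ i, MeasurableSet (A i)) (d : ℕ → E) (N : ℕ) :
    ∃ Φ : SimpleFunc ℝ E, (∀ τ, (∃ i < N, τ ∈ A i) → ∃ i, τ ∈ A i ∧ Φ τ = d i) ∧
      ∀ τ, (¬ ∃ i < N, τ ∈ A i) → Φ τ = 0 := by
  classical
  induction N with
  | zero => exact ⟨SimpleFunc.const ℝ 0, by simp, by simp⟩
  | succ N ih =>
    obtain ⟨Φ, h1, h2⟩ := ih
    refine ⟨SimpleFunc.piecewise (A N) (hA N) (SimpleFunc.const ℝ (d N)) Φ, ?_, ?_⟩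
    · rintro τ ⟨i, hi, hτ⟩
      by_cases hN : τ ∈ A N
      · exact ⟨N, hN, by simp [hN]⟩
      · have : ∃ i < N, τ ∈ A i := ⟨i, lt_of_le_of_ne (Nat.lt_succ_iff.1 hi)
          (by rintro rfl; exact hN hτ), hτ⟩
        simpa [hN] using h1 τ this
    · intro τ hτ
      have hN : τ ∉ A N := fun h => hτ ⟨N, Nat.lt_succ_self N, h⟩
      simpa [hN] using h2 τ fun ⟨i, hi, h⟩ => hτ ⟨i, hi.trans (Nat.lt_succ_self N), h⟩

theorem exists_measure_diff_biUnion_le {A : ℕ → Set ℝ} (hA : ∀ i, MeasurableSet (A i))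
    (hc : volume (⋃ i, A i)ᶜ = 0) (R : ℝ) {ε : ℝ≥0∞} (hε : 0 < ε) :
    ∃ N, volume (Set.Icc (-R) R \ {τ | ∃ i < N, τ ∈ A i}) ≤ ε := by
  have hm : ∀ N, MeasurableSet {τ | ∃ i < N, τ ∈ A i} := fun N => by
    have : {τ | ∃ i < N, τ ∈ A i} = ⋃ i, ⋃ _ : i < N, A i := by ext; simp
    rw [this]
    exact MeasurableSet.iUnion fun i => MeasurableSet.iUnion fun _ => hA i
  have ht := tendsto_measure_iInter_atTop (μ := volume)
    (s := fun N => Set.Icc (-R) R \ {τ | ∃ i < N, τ ∈ A i})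
    (fun N => (measurableSet_Icc.diff (hm N)).nullMeasurableSet)
    (fun M N hMN => Set.sdiff_subset_sdiff_right fun τ ⟨i, hi, h⟩ => ⟨i, hi.trans_le hMN, h⟩)
    ⟨0, ne_top_of_le_ne_top (by simp) (measure_mono (μ := volume) Set.sdiff_subset)⟩
  have h0 : volume (⋂ N, Set.Icc (-R) R \ {τ | ∃ i < N, τ ∈ A i}) = 0 := by
    refine measure_mono_null (fun τ hτ => ?_) hc
    rw [Set.mem_compl_iff, Set.mem_iUnion]
    rintro ⟨i, hi⟩
    exact (Set.mem_iInter.1 hτ (i + 1)).2 ⟨i, Nat.lt_succ_self i, hi⟩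
  rw [h0] at ht
  exact ((ht.eventually (gt_mem_nhds hε)).exists).imp fun N h => h.le

theorem exists_rat_uIoc {t τ : ℝ} (hτ : τ ∈ Set.uIoc 0 t) (hne : τ ≠ t) :
    ∃ c : ℚ, τ ∈ Set.uIoc (0 : ℝ) c ∧ Set.uIoc (0 : ℝ) c ⊆ Set.uIoc 0 t := by
  rcases Set.mem_uIoc.1 hτ with ⟨h0, h1⟩ | ⟨h0, h1⟩
  · obtain ⟨c, hc, hc'⟩ := exists_rat_btwn (lt_of_le_of_ne h1 hne)
    have h0c : (0 : ℝ) ≤ c := (h0.trans hc).le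
    refine ⟨c, ?_, ?_⟩
    · rw [Set.uIoc_of_le h0c]; exact ⟨h0, hc.le⟩
    · rw [Set.uIoc_of_le h0c, Set.uIoc_of_le (h0c.trans hc'.le)]
      exact Set.Ioc_subset_Ioc_right hc'.le
  · obtain ⟨c, hc, hc'⟩ := exists_rat_btwn h0
    have h0c : (c : ℝ) ≤ 0 := (hc'.trans_le h1).le
    refine ⟨c, ?_, ?_⟩
    · rw [Set.uIoc_of_ge h0c]; exact ⟨hc', h1⟩
    · rw [Set.uIoc_of_ge h0c, Set.uIoc_of_ge (hc.le.trans h0c)]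
      exact Set.Ioc_subset_Ioc_left hc.le

variable {X : Type} [MeasurableSpace X] {μ : Measure X} {H : Type} [NormedAddCommGroup H]
  [InnerProductSpace ℂ H] {σ D : ℝ}

/-- Weak approximation of an arbitrary curve by simple functions, with control of a second norm by
a measurable majorant. -/
theorem Decays.exists_weak_approx [TopologicalSpace.SeparableSpace (Lp ℂ 2 μ)]
    [TopologicalSpace.SeparableSpace H] {T : ℝ → Lp ℂ 2 μ →L[ℂ] H} (hT : Decays σ D T) {q : ℝ}
    (F : ℝ → Lp ℂ 2 μ) {h : ℝ → ℝ} (mh : Measurable h) (h0 : ∀ τ, 0 < h τ) {W : Set ℝ}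
    (hW : ∀ A, MeasurableSet A → W ⊆ A → volume Aᶜ = 0)
    (hF : ∀ τ ∈ W, eLpNorm (F τ) (ENNReal.ofReal q) μ ≤ ENNReal.ofReal (h τ)) {ε : ℝ} (hε : 0 < ε)
    (R : ℝ) :
    ∃ (Φ : SimpleFunc ℝ (Lp ℂ 2 μ)) (E : Set ℝ), MeasurableSet E ∧ IsTest q Φ ∧
      (∀ τ, eLpNorm (Φ τ) (ENNReal.ofReal q) μ ≤ ENNReal.ofReal (2 * h τ)) ∧
      (∀ τ ∉ E, Φ τ = 0) ∧ volume (Set.Icc (-R) R \ E) ≤ ENNReal.ofReal ε ∧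
      ∀ t (y : H), AEMeasurable (fun τ => inner ℂ y (T τ (F τ))) (volume.restrict (Set.uIoc 0 t)) →
        ∀ᵐ τ, τ ∈ Set.uIoc 0 t → τ ∈ E →
          ‖inner ℂ y (T τ (F τ)) - inner ℂ y (T τ (Φ τ))‖ ≤ ‖y‖ * ε := by
  classical
  set u : ℝ → H := fun τ => T τ (F τ) with hu
  have hY : ∀ c : ℚ, ∃ y : ℕ → H,
      (∀ j, AEMeasurable (fun τ => inner ℂ (y j) (u τ)) (volume.restrict (Set.uIoc (0 : ℝ) c))) ∧
      {z : H | AEMeasurable (fun τ => inner ℂ z (u τ)) (volume.restrict (Set.uIoc (0 : ℝ) c))} ⊆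
        closure (Set.range y) := fun c => by
    obtain ⟨s, hsB, hsc, hd⟩ := (TopologicalSpace.IsSeparable.of_separableSpace
      {z : H | AEMeasurable (fun τ => inner ℂ z (u τ))
        (volume.restrict (Set.uIoc (0 : ℝ) c))}).exists_countable_dense_subset
    have hne : s.Nonempty := by
      rw [← closure_nonempty_iff]
      refine ⟨0, hd ?_⟩
      change AEMeasurable (fun τ => inner ℂ (0 : H) (u τ)) _
      simp only [inner_zero_left]
      exact aemeasurable_const
    obtain ⟨y, rfl⟩ := hsc.exists_eq_range hne
    exact ⟨y, fun j => hsB ⟨j, rfl⟩, hd⟩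
  choose y hym hyd using hY
  set m : ℚ → ℕ → ℝ → ℂ := fun c j => (hym c j).mk _ with hm
  have hmm : ∀ c j, Measurable (m c j) := fun c j => (hym c j).measurable_mk
  have hG : ∀ᵐ τ, ∀ (c : ℚ) (j : ℕ), τ ∈ Set.uIoc (0 : ℝ) c → inner ℂ (y c j) (u τ) = m c j τ :=
    ae_all_iff.2 fun c => ae_all_iff.2 fun j =>
      (ae_restrict_iff' measurableSet_uIoc).1 (hym c j).ae_eq_mk
  obtain ⟨ψ, -, hψ1, hψd⟩ := exists_seq_dense_unitBall (μ := μ) (ENNReal.ofReal q)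
  obtain ⟨e, he⟩ := exists_surjective_nat (ℚ × ℕ)
  set d : ℕ → Lp ℂ 2 μ := fun i => (((e i).1 : ℝ) : ℂ) • ψ (e i).2 with hd
  set A : ℕ → Set ℝ := fun i =>
    {τ | eLpNorm (d i) (ENNReal.ofReal q) μ ≤ ENNReal.ofReal (2 * h τ)} ∩
    ⋂ (c : ℚ) (j : ℕ), ((Set.uIoc (0 : ℝ) c)ᶜ ∪
      {τ | ‖m c j τ - inner ℂ (y c j) (T τ (d i))‖ ≤ ‖y c j‖ * ε}) with hA
  have mA : ∀ i, MeasurableSet (A i) := fun i => by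
    refine (measurableSet_le measurable_const (by fun_prop)).inter
      (MeasurableSet.iInter fun c => MeasurableSet.iInter fun j =>
        measurableSet_uIoc.compl.union (measurableSet_le ?_ measurable_const))
    exact ((hmm c j).sub (continuous_const.inner (hT.cont (d i))).measurable).norm
  have cover : ∀ τ ∈ W, (∀ (c : ℚ) (j : ℕ), τ ∈ Set.uIoc (0 : ℝ) c →
      inner ℂ (y c j) (u τ) = m c j τ) → τ ∈ ⋃ i, A i := fun τ hτ hg => by
    obtain ⟨c, hc, hc'⟩ := exists_rat_btwn (show h τ < 2 * h τ by linarith [h0 τ])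
    have hc0 : (0 : ℝ) < c := (h0 τ).trans hc
    have hcc : ((c : ℝ) : ℂ) ≠ 0 := by exact_mod_cast hc0.ne'
    have hcn : ‖((c : ℝ) : ℂ)‖ₑ = ENNReal.ofReal c := by
      rw [← ofReal_norm, Complex.norm_real, Real.norm_of_nonneg hc0.le]
    have hmem : (((c : ℝ) : ℂ)⁻¹ • F τ) ∈ closure (Set.range ψ) := hψd _ (by
      rw [eLpNorm_coe_smul, enorm_inv hcc, hcn]
      calc (ENNReal.ofReal c)⁻¹ * eLpNorm (F τ) (ENNReal.ofReal q) μ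
          ≤ (ENNReal.ofReal c)⁻¹ * ENNReal.ofReal c :=
            mul_le_mul' le_rfl ((hF τ hτ).trans (ENNReal.ofReal_le_ofReal hc.le))
        _ = 1 := ENNReal.inv_mul_cancel (by simpa using hc0) (by simp))
    obtain ⟨_, ⟨j, rfl⟩, hj⟩ := Metric.mem_closure_iff.1 hmem (ε / c) (by positivity)
    obtain ⟨i, hi⟩ := he (c, j)
    have hdi : d i = ((c : ℝ) : ℂ) • ψ j := by simp only [hd, hi]
    have hclose : ‖F τ - d i‖ ≤ ε := by
      have e1 : F τ - d i = ((c : ℝ) : ℂ) • (((c : ℝ) : ℂ)⁻¹ • F τ - ψ j) := by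
        rw [hdi, smul_sub, smul_smul, mul_inv_cancel₀ hcc, one_smul]
      rw [e1, norm_smul, Complex.norm_real, Real.norm_of_nonneg hc0.le, ← dist_eq_norm]
      rw [lt_div_iff₀ hc0, mul_comm] at hj
      exact hj.le
    refine Set.mem_iUnion.2 ⟨i, ?_, Set.mem_iInter₂.2 fun c' j' => ?_⟩
    · change eLpNorm (d i) (ENNReal.ofReal q) μ ≤ ENNReal.ofReal (2 * h τ)
      rw [hdi, eLpNorm_coe_smul, hcn]
      exact (mul_le_of_le_one_right' (hψ1 j)).trans (ENNReal.ofReal_le_ofReal hc'.le)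
    · by_cases hc1 : τ ∈ Set.uIoc (0 : ℝ) c'
      · right
        change ‖m c' j' τ - inner ℂ (y c' j') (T τ (d i))‖ ≤ ‖y c' j'‖ * ε
        rw [← hg c' j' hc1, hu, ← inner_sub_right, ← map_sub]
        exact (norm_inner_le_norm _ _).trans
          (mul_le_mul_of_nonneg_left ((hT.contr τ _).trans hclose) (norm_nonneg _))
      · exact Or.inl hc1
  have hnull : volume (⋃ i, A i)ᶜ = 0 := by
    obtain ⟨Z, hZ, mZ, vZ⟩ := exists_measurable_superset_of_null (ae_iff.1 hG)
    have h1 := hW ((⋃ i, A i) ∪ Z) ((MeasurableSet.iUnion mA).union mZ) fun τ hτ => by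
      by_cases hg : ∀ (c : ℚ) (j : ℕ), τ ∈ Set.uIoc (0 : ℝ) c → inner ℂ (y c j) (u τ) = m c j τ
      · exact Or.inl (cover τ hτ hg)
      · exact Or.inr (hZ hg)
    refine measure_mono_null (fun τ hτ => ?_) (measure_union_null h1 vZ)
    by_cases hz : τ ∈ Z
    · exact Or.inr hz
    · exact Or.inl fun hh => hh.elim hτ hz
  obtain ⟨N, hN⟩ := exists_measure_diff_biUnion_le mA hnull R (ENNReal.ofReal_pos.2 hε)
  obtain ⟨Φ, hΦ1, hΦ2⟩ := exists_simpleFunc_of_cover mA d N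
  have mI : MeasurableSet (Set.Icc (-R) R) := measurableSet_Icc
  have mU : MeasurableSet {τ | ∃ i < N, τ ∈ A i} := by
    have : {τ | ∃ i < N, τ ∈ A i} = ⋃ i, ⋃ _ : i < N, A i := by ext; simp
    rw [this]
    exact MeasurableSet.iUnion fun i => MeasurableSet.iUnion fun _ => mA i
  set E := Set.Icc (-R) R ∩ {τ | ∃ i < N, τ ∈ A i} with hE
  have hoff : ∀ τ ∉ E, Φ.restrict (Set.Icc (-R) R) τ = 0 := fun τ hτ => by
    rw [SimpleFunc.restrict_apply _ mI]
    by_cases h1 : τ ∈ Set.Icc (-R) R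
    · rw [Set.indicator_of_mem h1]
      exact hΦ2 τ fun h2 => hτ ⟨h1, h2⟩
    · rw [Set.indicator_of_notMem h1]
  have hon : ∀ τ ∈ E, ∃ i, τ ∈ A i ∧ Φ.restrict (Set.Icc (-R) R) τ = d i := fun τ hτ => by
    rw [SimpleFunc.restrict_apply _ mI, Set.indicator_of_mem hτ.1]
    exact hΦ1 τ hτ.2
  have hbd : ∀ τ, eLpNorm (Φ.restrict (Set.Icc (-R) R) τ) (ENNReal.ofReal q) μ ≤
      ENNReal.ofReal (2 * h τ) := fun τ => by
    by_cases hτ : τ ∈ E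
    · obtain ⟨i, hi, hi'⟩ := hon τ hτ
      rw [hi']; exact hi.1
    · rw [hoff τ hτ, eLpNorm_coe_zero]; exact zero_le
  refine ⟨Φ.restrict (Set.Icc (-R) R), E, mI.inter mU, ⟨⟨R, fun τ hτ => hoff τ fun h1 =>
    not_le.2 hτ (abs_le.2 h1.1)⟩, fun τ => ne_top_of_le_ne_top ENNReal.ofReal_ne_top (hbd τ)⟩,
    hbd, hoff, ?_, fun t z hz => ?_⟩
  · rwa [hE, Set.sdiff_self_inter]
  · have hne : ∀ᵐ τ : ℝ, τ ≠ t := by simp [ae_iff]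
    filter_upwards [hG, hne] with τ hg hτt hτ hτE
    obtain ⟨c, hc, hct⟩ := exists_rat_uIoc hτ hτt
    have hz' := hyd c (show AEMeasurable (fun τ => inner ℂ z (u τ)) _ from
      hz.mono_measure (Measure.restrict_mono hct le_rfl))
    obtain ⟨i, hi, hi'⟩ := hon τ hτE
    rw [hi']
    have hcl : IsClosed {z : H | ‖inner ℂ z (T τ (F τ)) - inner ℂ z (T τ (d i))‖ ≤ ‖z‖ * ε} :=
      isClosed_le (by fun_prop) (by fun_prop)
    refine hcl.closure_subset_iff.2 ?_ hz'
    rintro _ ⟨j, rfl⟩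
    rcases Set.mem_iInter₂.1 hi.2 c j with h1 | h1
    · exact absurd hc h1
    · change ‖m c j τ - inner ℂ (y c j) (T τ (d i))‖ ≤ ‖y c j‖ * ε at h1
      rwa [← hg c j hc] at h1

end

theorem tendsto_integral_of_approx {t K : ℝ} {a : ℝ → ℂ} {b : ℕ → ℝ → ℂ} {E : ℕ → Set ℝ}
    (ha : IntegrableOn a (Set.uIoc 0 t)) (hb : ∀ n, Integrable (b n))
    (mE : ∀ n, MeasurableSet (E n)) (hE : ∀ n, ∀ τ ∉ E n, b n τ = 0)
    (vE : ∀ n : ℕ, volume (Set.Icc (-(n : ℝ)) n \ E n) ≤ ENNReal.ofReal (1 / (n + 1)))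
    (hK : ∀ n : ℕ, ∀ᵐ τ, τ ∈ Set.uIoc 0 t → τ ∈ E n → ‖a τ - b n τ‖ ≤ K * (1 / (n + 1)))
    (hK0 : 0 ≤ K) :
    Tendsto (fun n => ∫ τ in (0 : ℝ)..t, b n τ) atTop (nhds (∫ τ in (0 : ℝ)..t, a τ)) := by
  set ν := volume.restrict (Set.uIoc 0 t) with hν
  have hνE : Tendsto (fun n => ν (E n)ᶜ) atTop (nhds 0) := by
    have h1 : Tendsto (fun n : ℕ => ENNReal.ofReal (1 / ((n : ℝ) + 1))) atTop (nhds 0) := by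
      have := ENNReal.tendsto_ofReal tendsto_one_div_add_atTop_nhds_zero_nat (f := atTop (α := ℕ))
      rwa [ENNReal.ofReal_zero] at this
    refine tendsto_of_tendsto_of_tendsto_of_le_of_le' tendsto_const_nhds h1
      (Eventually.of_forall fun _ => zero_le) ?_
    obtain ⟨m, hm⟩ := exists_nat_ge |t|
    filter_upwards [eventually_ge_atTop m] with n hn
    refine le_trans ?_ (vE n)
    rw [hν, Measure.restrict_apply (mE n).compl]
    refine measure_mono fun τ hτ => ⟨abs_le.1 ?_, hτ.1⟩
    have h2 : |τ| ≤ |t| := by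
      rcases Set.mem_uIoc.1 hτ.2 with ⟨h, h'⟩ | ⟨h, h'⟩
      · rw [abs_of_pos h, abs_of_pos (h.trans_le h')]; exact h'
      · rw [abs_of_nonpos h', abs_of_neg (h.trans_le h')]; linarith
    exact h2.trans (hm.trans (by exact_mod_cast hn))
  have hsmall : Tendsto (fun n => ∫ τ in (E n)ᶜ, ‖a τ‖ ∂ν) atTop (nhds 0) :=
    Integrable.tendsto_setIntegral_nhds_zero ha.norm hνE
  have hlim : Tendsto (fun n : ℕ => K * (1 / ((n : ℝ) + 1)) * ν.real Set.univ +
      ∫ τ in (E n)ᶜ, ‖a τ‖ ∂ν) atTop (nhds 0) := by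
    have := ((tendsto_one_div_add_atTop_nhds_zero_nat (𝕜 := ℝ)).const_mul K).mul_const
      (ν.real Set.univ)
    simpa using this.add hsmall
  rw [tendsto_iff_norm_sub_tendsto_zero]
  refine squeeze_zero (fun _ => norm_nonneg _) (fun n => ?_) hlim
  rw [← intervalIntegral.integral_sub (hb n).intervalIntegrable
    ((intervalIntegrable_iff (f := a)).2 ha),
    intervalIntegral.norm_intervalIntegral_eq]
  refine (norm_integral_le_integral_norm _).trans ?_
  have haE : Integrable ((E n)ᶜ.indicator fun τ => ‖a τ‖) ν := ha.norm.indicator (mE n).compl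
  have hc : Integrable (fun _ : ℝ => K * (1 / ((n : ℝ) + 1))) ν := by
    have : IsFiniteMeasure ν := ⟨by rw [hν, Measure.restrict_apply_univ, Set.uIoc]; simp⟩
    exact integrable_const _
  calc ∫ τ, ‖b n τ - a τ‖ ∂ν
      ≤ ∫ τ, (K * (1 / ((n : ℝ) + 1)) + (E n)ᶜ.indicator (fun τ => ‖a τ‖) τ) ∂ν := by
        refine integral_mono_ae ((hb n).restrict.sub ha).norm (hc.add haE) ?_
        filter_upwards [(ae_restrict_iff' measurableSet_uIoc).2 (hK n)] with τ hτ
        by_cases h : τ ∈ E n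
        · rw [Set.indicator_of_notMem (by simpa using h), add_zero, norm_sub_rev]
          exact hτ h
        · rw [Set.indicator_of_mem (by simpa using h), hE n τ h, zero_sub, norm_neg]
          have : 0 ≤ K * (1 / ((n : ℝ) + 1)) := by positivity
          linarith
    _ = _ := by
        rw [integral_add hc haE, integral_indicator (mE n).compl, integral_const, smul_eq_mul,
          mul_comm]

/-- For an arbitrary curve the weak Duhamel integrals have a measurable majorant obeying the
inhomogeneous Strichartz bound. -/
theorem exists_weak_duhamel_majorant {σ D θ₁ θ₂ : ℝ} (hD : 0 < D) (hσ : 0 < σ) (hσ1 : σ ≠ 1)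
    (h0 : 0 ≤ θ₁) (h1 : θ₁ ≤ 1) (hl : σ * θ₁ ≤ 1) (h0' : 0 ≤ θ₂) (h1' : θ₂ ≤ 1)
    (hl' : σ * θ₂ ≤ 1) :
    ∃ C : ℝ≥0∞, C ≠ ∞ ∧
    ∀ {X : Type} [MeasurableSpace X] {μ : Measure X} [TopologicalSpace.SeparableSpace (Lp ℂ 2 μ)]
      {H : Type} [NormedAddCommGroup H] [InnerProductSpace ℂ H] [CompleteSpace H]
      [TopologicalSpace.SeparableSpace H]
      {T : ℝ → Lp ℂ 2 μ →L[ℂ] H}, Decays σ D T →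
    ∀ {r : ℝ≥0∞}, r⁻¹ + (ENNReal.ofReal (2 / (2 - σ * θ₂)))⁻¹ = 1 →
    ∀ (F : ℝ → Lp ℂ 2 μ) {h : ℝ → ℝ}, Measurable h → (∀ τ, 0 < h τ) → ∀ {W : Set ℝ},
    (∀ A, MeasurableSet A → W ⊆ A → volume Aᶜ = 0) →
    (∀ τ ∈ W, eLpNorm (F τ) (ENNReal.ofReal (2 / (1 + θ₁))) μ ≤ ENNReal.ofReal (h τ)) →
    ∃ M : ℝ → ℝ≥0∞, Measurable M ∧ eLpNorm M r volume ≤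
        C * (∫⁻ τ, ENNReal.ofReal (h τ) ^ (2 / (2 - σ * θ₁))) ^ (1 / (2 / (2 - σ * θ₁))) ∧
      ∀ t (f : Lp ℂ 2 μ), eLpNorm f (ENNReal.ofReal (2 / (1 + θ₂))) μ ≠ ∞ →
        IntegrableOn (fun τ => inner ℂ (T t f) (T τ (F τ))) (Set.uIoc 0 t) →
        ‖∫ τ in (0 : ℝ)..t, inner ℂ (T t f) (T τ (F τ))‖ₑ ≤
          M t * eLpNorm f (ENNReal.ofReal (2 / (1 + θ₂))) μ := by
  obtain ⟨C, hC, hb⟩ := exists_duhamel_majorant hD hσ hσ1 h0 h1 hl h0' h1' hl'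
  refine ⟨C * 2, by finiteness, ?_⟩
  intro X _ μ _ H _ _ _ _ T hT r hr F h mh hpos W hW hF
  have hρ : 0 < 2 / (2 - σ * θ₁) := div_pos (by norm_num) (by linarith)
  choose Φ E mE tΦ nΦ zΦ vE aΦ using fun n : ℕ => hT.exists_weak_approx F mh hpos hW hF
    (ε := 1 / ((n : ℝ) + 1)) (by positivity) n
  choose M mM nM bM using fun n => hb hT hr (tΦ n)
  refine ⟨fun t => liminf (fun n => M n t) atTop, Measurable.liminf mM,
    eLpNorm_liminf_le mM fun n => (nM n).trans ?_, fun t f hf hint => ?_⟩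
  · rw [mul_assoc]
    refine mul_le_mul' le_rfl ?_
    rw [admNorm, mixNorm]
    refine (ENNReal.rpow_le_rpow (lintegral_mono fun τ => ENNReal.rpow_le_rpow (nΦ n τ) hρ.le)
      (by positivity)).trans (le_of_eq ?_)
    simp only [ENNReal.ofReal_mul zero_le_two, ENNReal.ofReal_ofNat,
      ENNReal.mul_rpow_of_nonneg _ _ hρ.le]
    rw [lintegral_const_mul' _ _ (ENNReal.rpow_ne_top_of_nonneg hρ.le (by simp)),
      ENNReal.mul_rpow_of_nonneg _ _ (by positivity), ← ENNReal.rpow_mul,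
      mul_one_div_cancel hρ.ne', ENNReal.rpow_one]
  · have hi : ∀ n, Integrable fun τ => T τ (Φ n τ) := fun n => hT.integrable (tΦ n).bdd
    have lim := tendsto_integral_of_approx (K := ‖T t f‖)
      (b := fun n τ => inner ℂ (T t f) (T τ (Φ n τ))) hint (fun n => (hi n).const_inner _)
      mE (fun n τ hτ => by rw [zΦ n τ hτ, map_zero, inner_zero_right]) vE
      (fun n => aΦ n t (T t f) hint.1.aemeasurable) (norm_nonneg _)
    have hn : ∀ n, ‖∫ τ in (0 : ℝ)..t, inner ℂ (T t f) (T τ (Φ n τ))‖ₑ ≤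
        M n t * eLpNorm f (ENNReal.ofReal (2 / (1 + θ₂))) μ := fun n => by
      refine le_trans (le_of_eq ?_) (bM n t f hf)
      rw [intervalIntegral, intervalIntegral, integral_inner (hi n).integrableOn,
        integral_inner (hi n).integrableOn, inner_sub_right]
    beta_reduce
    rw [mul_comm, ← ENNReal.liminf_const_mul_of_ne_top hf, ← lim.enorm.liminf_eq]
    exact liminf_le_liminf (Eventually.of_forall fun n => (hn n).trans (mul_comm _ _).le)

section FamilyIntegral

variable {d : ℕ} {ν : Measure ℝ} {G : ℝ → Sp d → ℂ}

/-- A family of continuous functions, not assumed measurable in the parameter, has a jointly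
measurable version over the closure of the points where it is integrable in the parameter. -/
theorem exists_measurable_version (hG : ∀ τ, Continuous (G τ))
    (hne : {x | Integrable (fun τ => G τ x) ν}.Nonempty) :
    ∃ (Q : Set (Sp d)) (g : Sp d × ℝ → ℂ), MeasurableSet Q ∧ Measurable g ∧
      {x | Integrable (fun τ => G τ x) ν} ⊆ Q ∧ ∀ᵐ τ ∂ν, ∀ x ∈ Q, g (x, τ) = G τ x := by
  classical
  set X := {x | Integrable (fun τ => G τ x) ν} with hX
  obtain ⟨S, hSX, hSc, hXS⟩ :=
    (TopologicalSpace.IsSeparable.of_separableSpace X).exists_countable_dense_subset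
  have hSne : S.Nonempty := by
    rw [← closure_nonempty_iff]
    exact hne.mono hXS
  obtain ⟨e, rfl⟩ := hSc.exists_eq_range hSne
  have hint : ∀ j, AEStronglyMeasurable (fun τ => G τ (e j)) ν := fun j =>
    (hSX ⟨j, rfl⟩ : Integrable (fun τ => G τ (e j)) ν).1
  obtain ⟨N, hN, hNm, hN0⟩ : ∃ N : Set ℝ, (∀ τ ∉ N, ∀ j, G τ (e j) = (hint j).mk _ τ) ∧
      MeasurableSet N ∧ ν N = 0 := by
    have h := ae_all_iff.2 fun j => (hint j).ae_eq_mk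
    obtain ⟨N, hsub, hNm, hN0⟩ := exists_measurable_superset_of_null (ae_iff.1 h)
    refine ⟨N, fun τ hτ => ?_, hNm, hN0⟩
    by_contra hc
    exact hτ (hsub hc)
  set Q := closure (Set.range e) with hQ
  have hQm : MeasurableSet Q := isClosed_closure.measurableSet
  have hset : MeasurableSet (Q ×ˢ Nᶜ) := hQm.prod hNm.compl
  let φ : ℕ → Sp d × ℝ → ℂ := fun n =>
    (Q ×ˢ Nᶜ).indicator fun z => (hint (SimpleFunc.nearestPtInd e n z.1)).mk _ z.2
  have hφ : ∀ n, Measurable (φ n) := fun n => by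
    refine Measurable.indicator ?_ hset
    have h1 : Measurable (fun z : ℕ × ℝ => (hint z.1).mk _ z.2) :=
      measurable_from_prod_countable_right fun j => (hint j).stronglyMeasurable_mk.measurable
    exact h1.comp (((SimpleFunc.nearestPtInd e n).measurable.comp measurable_fst).prodMk
      measurable_snd)
  let g : Sp d × ℝ → ℂ := (Q ×ˢ Nᶜ).indicator fun z => G z.2 z.1
  have hlim : Tendsto φ atTop (nhds g) := by
    rw [tendsto_pi_nhds]
    rintro ⟨x, τ⟩
    by_cases hz : (x, τ) ∈ Q ×ˢ Nᶜ
    · simp only [φ, g, Set.indicator_of_mem hz]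
      have h1 := ((hG τ).tendsto x).comp (SimpleFunc.tendsto_nearestPt hz.1)
      refine h1.congr fun n => ?_
      exact hN τ hz.2 _
    · simp only [φ, g, Set.indicator_of_notMem hz]
      exact tendsto_const_nhds
  refine ⟨Q, g, hQm, measurable_of_tendsto_metrizable hφ hlim, hXS, ?_⟩
  rw [ae_iff]
  refine measure_mono_null (fun τ hτ => ?_) hN0
  by_contra hc
  exact hτ fun x hx => Set.indicator_of_mem (Set.mk_mem_prod hx hc) _

/-- Duality bound for the parameter integral of a family of continuous functions. -/
theorem eLpNorm_integral_le [SFinite ν] (hG : ∀ τ, Continuous (G τ)) {p : ℝ≥0∞} {q : ℝ} (hq : 1 ≤ q)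
    (hpq : p⁻¹ + (ENNReal.ofReal q)⁻¹ = 1) {K : ℝ≥0∞}
    (H : ∀ ψ : Sp d → ℂ, Measurable ψ → (∃ B : ℝ, ∀ x, ‖ψ x‖ ≤ B) →
      (∃ R : ℝ, ∀ x, R < ‖x‖ → ψ x = 0) →
      Integrable (fun τ => ∫ x, (starRingEnd ℂ) (ψ x) * G τ x) ν →
      ‖∫ τ, ∫ x, (starRingEnd ℂ) (ψ x) * G τ x ∂volume ∂ν‖ₑ ≤
        K * eLpNorm ψ (ENNReal.ofReal q) volume) :
    eLpNorm (fun x => ∫ τ, G τ x ∂ν) p volume ≤ K := by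
  have hq0 : 0 < q := by linarith
  by_cases hne : {x | Integrable (fun τ => G τ x) ν}.Nonempty
  swap
  · have h0 : (fun x => ∫ τ, G τ x ∂ν) = fun _ => 0 := by
      funext x
      refine integral_undef fun h => hne ⟨x, h⟩
    rw [h0]
    simp
  obtain ⟨Q, g, hQm, hg, hXQ, hae⟩ := exists_measurable_version hG hne
  have haex : ∀ x ∈ Q, (fun τ => g (x, τ)) =ᵐ[ν] fun τ => G τ x := fun x hx =>
    hae.mono fun τ hτ => hτ x hx
  let L₀ : Sp d → ℝ≥0∞ := fun x => ∫⁻ τ, ‖g (x, τ)‖ₑ ∂ν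
  have hL₀ : Measurable L₀ := hg.enorm.lintegral_prod_right'
  let X : Set (Sp d) := Q ∩ {x | L₀ x < ∞}
  have hXm : MeasurableSet X := hQm.inter (measurableSet_lt hL₀ measurable_const)
  have hX : ∀ x, x ∈ X ↔ Integrable (fun τ => G τ x) ν := fun x => by
    constructor
    · rintro ⟨h1, h2⟩
      refine Integrable.congr ⟨?_, h2⟩ (haex x h1)
      exact (hg.comp measurable_prodMk_left).aestronglyMeasurable
    · intro h
      have h1 := hXQ h
      exact ⟨h1, (h.congr (haex x h1).symm).2⟩
  let D : Sp d → ℂ := X.indicator fun x => ∫ τ, g (x, τ) ∂ν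
  have hD : Measurable D :=
    (StronglyMeasurable.integral_prod_right' (f := g)
      hg.stronglyMeasurable).measurable.indicator hXm
  have hDeq : (fun x => ∫ τ, G τ x ∂ν) = D := by
    funext x
    by_cases hx : x ∈ X
    · simp only [D, Set.indicator_of_mem hx]
      exact integral_congr_ae (haex x hx.1).symm
    · simp only [D, Set.indicator_of_notMem hx]
      exact integral_undef fun h => hx ((hX x).2 h)
  let L : Sp d → ℝ≥0∞ := X.indicator L₀
  have hL : Measurable L := hL₀.indicator hXm
  have hLtop : ∀ x, L x ≠ ∞ := fun x => by
    by_cases hx : x ∈ X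
    · simp only [L, Set.indicator_of_mem hx]
      exact hx.2.ne
    · simp [L, Set.indicator_of_notMem hx]
  let Z : ℕ → Set (Sp d) := fun n => {x | ‖x‖ ≤ n} ∩ ({x | ‖D x‖ₑ ≤ n} ∩ {x | L x ≤ n})
  have hZ : ∀ n, MeasurableSet (Z n) := fun n =>
    (measurableSet_le measurable_norm measurable_const).inter
      ((measurableSet_le hD.enorm measurable_const).inter (measurableSet_le hL measurable_const))
  have hZb : ∀ n, volume (Z n) < ∞ := fun n => by
    refine lt_of_le_of_lt (measure_mono fun x hx => ?_)
      (measure_closedBall_lt_top (x := (0 : Sp d)) (r := n))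
    rw [mem_closedBall_zero_iff]
    exact hx.1
  rw [hDeq, ← eLpNorm_enorm]
  refine eLpNorm_le_of_forall_simpleFunc hq hpq hD.enorm hZ (fun a b hab x hx => ?_)
    (fun n => (hZb n).ne) (fun n x hx => hx.2.1) (fun x => ?_) fun n b hbt hb0 => ?_
  · have hab' : (a : ℝ≥0∞) ≤ b := by exact_mod_cast hab
    exact ⟨le_trans hx.1 (Nat.cast_le.2 hab : (a : ℝ) ≤ b), le_trans hx.2.1 hab',
      le_trans hx.2.2 hab'⟩
  · obtain ⟨n1, h1⟩ := exists_nat_ge ‖x‖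
    obtain ⟨n2, h2⟩ := ENNReal.exists_nat_gt (enorm_ne_top (x := D x))
    obtain ⟨n3, h3⟩ := ENNReal.exists_nat_gt (hLtop x)
    refine ⟨n1 + n2 + n3, ?_, ?_, ?_⟩
    · change ‖x‖ ≤ _
      push_cast
      linarith [(Nat.cast_nonneg n2 : (0 : ℝ) ≤ n2), (Nat.cast_nonneg n3 : (0 : ℝ) ≤ n3)]
    · refine h2.le.trans ?_
      exact_mod_cast (by lia : n2 ≤ n1 + n2 + n3)
    · refine h3.le.trans ?_
      exact_mod_cast (by lia : n3 ≤ n1 + n2 + n3)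
  · let ψ : Sp d → ℂ := fun x => ((b x).toReal : ℂ) * (D x * ((‖D x‖⁻¹ : ℝ) : ℂ))
    have hψm : Measurable ψ :=
      (Complex.measurable_ofReal.comp b.measurable.ennreal_toReal).mul
        (hD.mul (Complex.measurable_ofReal.comp hD.norm.inv))
    have hψb : ∀ x, ‖ψ x‖ ≤ (b x).toReal := fun x => by
      simp only [ψ, norm_mul, Complex.norm_real, norm_inv, norm_norm,
        Real.norm_of_nonneg ENNReal.toReal_nonneg]
      exact mul_le_of_le_one_right ENNReal.toReal_nonneg (mul_inv_le_one)
    have hψZ : ∀ x ∉ Z n, ψ x = 0 := fun x hx => by simp [ψ, hb0 x hx]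
    have hψX : ∀ x ∉ X, ψ x = 0 := fun x hx => by simp [ψ, D, Set.indicator_of_notMem hx]
    have hψD : ∀ x, (starRingEnd ℂ) (ψ x) * D x = (((b x).toReal * ‖D x‖ : ℝ) : ℂ) := fun x => by
      by_cases h0 : D x = 0
      · simp [h0]
      · have h1 : (starRingEnd ℂ) (D x) * D x = ((‖D x‖ : ℝ) : ℂ) ^ 2 := Complex.conj_mul' _
        have h2 : ((‖D x‖ : ℝ) : ℂ) ≠ 0 := by simpa using h0
        simp only [ψ, map_mul, Complex.conj_ofReal]
        push_cast
        rw [show ((b x).toReal : ℂ) * ((starRingEnd ℂ) (D x) * ((‖D x‖ : ℝ) : ℂ)⁻¹) * D x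
          = ((b x).toReal : ℂ) * ((starRingEnd ℂ) (D x) * D x) * ((‖D x‖ : ℝ) : ℂ)⁻¹ by ring, h1]
        field_simp
    obtain ⟨B, hB⟩ := (b.map ENNReal.toReal).exists_forall_norm_le
    have hbB : ∀ x, (b x).toReal ≤ B := fun x => (le_abs_self _).trans (hB x)
    have hbB' : ∀ x, ‖ψ x‖ ≤ B := fun x => (hψb x).trans (hbB x)
    have hprod : Integrable (fun z : Sp d × ℝ => (starRingEnd ℂ) (ψ z.1) * g z)
        (volume.prod ν) := by
      have hm : Measurable (fun z : Sp d × ℝ => (starRingEnd ℂ) (ψ z.1) * g z) :=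
        (Complex.continuous_conj.measurable.comp (hψm.comp measurable_fst)).mul hg
      refine ⟨hm.aestronglyMeasurable, ?_⟩
      rw [hasFiniteIntegral_iff_enorm, lintegral_prod _ hm.enorm.aemeasurable]
      have hle : ∀ x, ∫⁻ τ, ‖(starRingEnd ℂ) (ψ x) * g (x, τ)‖ₑ ∂ν ≤
          (Z n).indicator (fun _ => ENNReal.ofReal B * n) x := fun x => by
        by_cases hx : ψ x = 0
        · simp [hx]
        have hxZ : x ∈ Z n := by
          by_contra hc
          exact hx (hψZ x hc)
        have hxX : x ∈ X := by
          by_contra hc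
          exact hx (hψX x hc)
        rw [Set.indicator_of_mem hxZ]
        simp only [enorm_mul]
        have hgx : Measurable fun τ => g (x, τ) := hg.comp measurable_prodMk_left
        rw [lintegral_const_mul _ hgx.enorm]
        refine mul_le_mul' ?_ ?_
        · rw [← ofReal_norm, RCLike.norm_conj]
          exact ENNReal.ofReal_le_ofReal (hbB' x)
        · have := hxZ.2.2
          change L x ≤ n at this
          simpa only [L, Set.indicator_of_mem hxX] using this
      refine lt_of_le_of_lt (lintegral_mono hle) ?_
      rw [lintegral_indicator_const (hZ n)]
      exact ENNReal.mul_lt_top (ENNReal.mul_lt_top (by simp) (by simp)) (hZb n)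
    have hin : ∀ᵐ τ ∂ν, ∫ x, (starRingEnd ℂ) (ψ x) * g (x, τ) =
        ∫ x, (starRingEnd ℂ) (ψ x) * G τ x := by
      filter_upwards [hae] with τ hτ
      refine integral_congr_ae (Eventually.of_forall fun x => ?_)
      by_cases hx : x ∈ X
      · simp only [hτ x hx.1]
      · simp [hψX x hx]
    have hout : (fun x => ∫ τ, (starRingEnd ℂ) (ψ x) * g (x, τ) ∂ν) =
        fun x => (((b x).toReal * ‖D x‖ : ℝ) : ℂ) := by
      funext x
      rw [← hψD]
      by_cases hx : x ∈ X
      · simp only [D, Set.indicator_of_mem hx]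
        exact integral_const_mul _ _
      · simp [hψX x hx]
    have hI := H ψ hψm ⟨B, hbB'⟩ ⟨n, fun x hx => hψZ x fun h => not_le_of_gt hx h.1⟩
      (hprod.integral_prod_right.congr hin)
    rw [← integral_congr_ae hin, ← integral_integral_swap
      (f := fun x τ => (starRingEnd ℂ) (ψ x) * g (x, τ)) hprod, hout, integral_complex_ofReal] at hI
    have hIi : Integrable (fun x => (b x).toReal * ‖D x‖) volume := by
      have h1 := hprod.integral_prod_left
      rw [hout] at h1
      simpa using h1.re
    have hpos : 0 ≤ ∫ x, (b x).toReal * ‖D x‖ := integral_nonneg fun x => by positivity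
    rw [← ofReal_norm, Complex.norm_real, Real.norm_of_nonneg hpos,
      ofReal_integral_eq_lintegral_ofReal hIi (Eventually.of_forall fun x => by positivity)] at hI
    have hL : ∀ x, ENNReal.ofReal ((b x).toReal * ‖D x‖) = b x * ‖D x‖ₑ := fun x => by
      rw [ENNReal.ofReal_mul ENNReal.toReal_nonneg, ENNReal.ofReal_toReal (hbt x),
        ofReal_norm]
    simp only [hL] at hI
    refine hI.trans (mul_le_mul_right ?_ K)
    rw [eLpNorm_eq_lintegral_rpow_enorm_toReal (by simpa using hq0) (by simp),
      ENNReal.toReal_ofReal hq0.le]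
    refine ENNReal.rpow_le_rpow (lintegral_mono fun x => ENNReal.rpow_le_rpow ?_ hq0.le)
      (by positivity)
    rw [← ofReal_norm, ← ENNReal.ofReal_toReal (hbt x)]
    exact ENNReal.ofReal_le_ofReal (hψb x)

end FamilyIntegral

section Weight

/-- A function of finite upper integral is dominated, on a set of full outer measure, by a
measurable function of almost the same integral. -/
theorem exists_measurable_weight (N : ℝ → ℝ≥0∞) {s : ℝ} (hs : 0 < s) (hN : ∫⁻ τ, N τ ^ s ≠ ∞)
    {ε : ℝ≥0∞} (hε : ε ≠ 0) :
    ∃ h : ℝ → ℝ, Measurable h ∧ (∀ τ, 0 < h τ) ∧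
      (∀ A, MeasurableSet A → {τ | N τ ≤ ENNReal.ofReal (h τ)} ⊆ A → volume Aᶜ = 0) ∧
      ∫⁻ τ, ENNReal.ofReal (h τ) ^ s ≤ (∫⁻ τ, N τ ^ s) + ε := by
  classical
  obtain ⟨m, hm, hmN, hmI⟩ := exists_measurable_le_lintegral_eq volume fun τ => N τ ^ s
  obtain ⟨w, hw0, hw, hwI⟩ := exists_pos_lintegral_lt_of_sigmaFinite (volume : Measure ℝ) hε
  rw [hmI] at hN ⊢
  have hmfin : ∀ᵐ τ, m τ < ∞ := ae_lt_top hm hN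
  let h : ℝ → ℝ := fun τ => if m τ = ∞ then 1 else ((m τ + w τ) ^ (1 / s)).toReal
  have hofReal : ∀ τ, m τ ≠ ∞ → ENNReal.ofReal (h τ) = (m τ + w τ) ^ (1 / s) := fun τ hτ => by
    simp only [h, if_neg hτ]
    exact ENNReal.ofReal_toReal (ENNReal.rpow_ne_top_of_nonneg (by positivity) (by simp [hτ]))
  refine ⟨h, ?_, fun τ => ?_, fun A hA hWA => ?_, ?_⟩
  · refine Measurable.ite (hm (measurableSet_singleton ∞)) measurable_const ?_
    exact ((hm.add hw.coe_nnreal_ennreal).pow_const _).ennreal_toReal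
  · by_cases hτ : m τ = ∞
    · simp [h, hτ]
    · have h1 : ENNReal.ofReal (h τ) ≠ 0 := by
        rw [hofReal τ hτ]
        refine (ENNReal.rpow_pos ?_ (by simp [hτ])).ne'
        exact lt_of_lt_of_le (by exact_mod_cast hw0 τ) le_add_self
      simpa using h1
  · let B : Set ℝ := Aᶜ ∩ {τ | m τ = ∞}ᶜ
    have hB : MeasurableSet B := hA.compl.inter (hm (measurableSet_singleton ∞)).compl
    have hBN : ∀ τ ∈ B, m τ + w τ ≤ N τ ^ s := fun τ hτ => by
      by_contra hc
      refine hτ.1 (hWA ?_)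
      change N τ ≤ _
      rw [hofReal τ hτ.2, ← ENNReal.rpow_le_rpow_iff hs, ← ENNReal.rpow_mul, one_div,
        inv_mul_cancel₀ hs.ne', ENNReal.rpow_one]
      exact (not_le.1 hc).le
    have hle : ∀ τ, m τ + B.indicator (fun τ => (w τ : ℝ≥0∞)) τ ≤ N τ ^ s := fun τ => by
      by_cases hτ : τ ∈ B
      · rw [Set.indicator_of_mem hτ]
        exact hBN τ hτ
      · rw [Set.indicator_of_notMem hτ, add_zero]
        exact hmN τ
    have hI := lintegral_mono (μ := volume) hle
    rw [hmI, lintegral_add_left hm, lintegral_indicator hB] at hI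
    have hz : ∫⁻ τ in B, (w τ : ℝ≥0∞) = 0 := by
      have h1 : (∫⁻ τ, m τ) + ∫⁻ τ in B, (w τ : ℝ≥0∞) ≤ (∫⁻ τ, m τ) + 0 := by simpa using hI
      exact le_antisymm (ENNReal.le_of_add_le_add_left hN h1) zero_le
    have hB0 : volume B = 0 := by
      rw [lintegral_eq_zero_iff hw.coe_nnreal_ennreal] at hz
      have h2 : ∀ᵐ τ ∂(volume.restrict B), False := hz.mono fun τ hτ => by
        have := hw0 τ
        simp only [Pi.zero_apply, ENNReal.coe_eq_zero] at hτ
        exact this.ne' hτ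
      simpa using h2
    refine measure_mono_null (t := B ∪ {τ | ¬ m τ < ∞}) (fun τ hτ => ?_)
      (measure_union_null hB0 (ae_iff.1 hmfin))
    by_cases hτm : m τ = ∞
    · exact Or.inr (by simp [hτm])
    · exact Or.inl ⟨hτ, hτm⟩
  · calc ∫⁻ τ, ENNReal.ofReal (h τ) ^ s = ∫⁻ τ, (m τ + w τ) := by
          refine lintegral_congr_ae (hmfin.mono fun τ hτ => ?_)
          simp only
          rw [hofReal τ hτ.ne, ← ENNReal.rpow_mul, one_div, inv_mul_cancel₀ hs.ne',
            ENNReal.rpow_one]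
      _ = (∫⁻ τ, m τ) + ∫⁻ τ, (w τ : ℝ≥0∞) := lintegral_add_left hm _
      _ ≤ _ := by gcongr

end Weight

section GoodPart

variable {d : ℕ}

open Classical in
/-- The `L²` class of a function that is integrable along with its Fourier transform, and zero for
any other function. -/
noncomputable def toL2 (f : Sp d → ℂ) : L2 d :=
  if h : Integrable f ∧ Integrable (𝓕 f) then (memLp_two_of_fourier h.1 h.2).toLp f else 0

theorem eLpNorm_toL2_le (f : Sp d → ℂ) (p : ℝ≥0∞) :
    eLpNorm (toL2 f) p volume ≤ eLpNorm f p volume := by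
  by_cases h : Integrable f ∧ Integrable (𝓕 f)
  · rw [toL2, dif_pos h, eLpNorm_congr_ae (MemLp.coeFn_toLp _)]
  · rw [toL2, dif_neg h, eLpNorm_congr_ae (Lp.coeFn_zero ..)]
    simp

theorem propagator_eq_zero {α β γ t : ℝ} {f : Sp d → ℂ}
    (h : ¬ (Integrable f ∧ Integrable (𝓕 f))) : propagator α β γ t f = 0 := by
  have hc := continuous_dispersion (d := d) α β γ
  by_cases hf : Integrable f
  · have hF : ¬ Integrable (𝓕 f) := fun h' => h ⟨hf, h'⟩
    funext x
    simp only [propagator]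
    rw [Real.fourierInv_eq', Pi.zero_apply]
    refine integral_undef fun hi => hF ?_
    have h1 := hi.bdd_mul (c := 1) (f := fun ξ : Sp d =>
      Complex.exp (-(Complex.I * ((dispersion α β γ ξ * t : ℝ) : ℂ))) *
        Complex.exp (-(((2 * Real.pi * inner ℝ ξ x : ℝ) : ℂ) * Complex.I)))
      (by fun_prop) (Eventually.of_forall fun ξ => by
        rw [norm_mul, norm_phase, mul_comm _ Complex.I, norm_phase, mul_one])
    refine h1.congr (Eventually.of_forall fun ξ => ?_)
    simp only [smul_eq_mul, Complex.exp_neg]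
    have e1 := Complex.exp_ne_zero (Complex.I * ((dispersion α β γ ξ * t : ℝ) : ℂ))
    have e2 := Complex.exp_ne_zero (((2 * Real.pi * inner ℝ ξ x : ℝ) : ℂ) * Complex.I)
    field_simp
  · have hF : 𝓕 f = 0 := by
      funext ξ
      rw [Real.fourier_eq]
      exact integral_undef fun hi => hf (by simpa using hi)
    funext x
    simp [propagator, hF, Real.fourierInv_eq]

theorem continuous_propagator (α β γ t : ℝ) (f : Sp d → ℂ) :
    Continuous (propagator α β γ t f) := by
  by_cases h : Integrable f ∧ Integrable (𝓕 f)
  · have hc := continuous_dispersion (d := d) α β γ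
    have hi : Integrable fun ξ : Sp d =>
        Complex.exp (Complex.I * ((dispersion α β γ ξ * t : ℝ) : ℂ)) * 𝓕 f ξ := by
      refine h.2.bdd_mul (c := 1) (by fun_prop) (Eventually.of_forall fun ξ => ?_)
      rw [mul_comm, Complex.norm_exp_ofReal_mul_I]
    have h1 := (continuous_fourier hi).comp (continuous_neg (G := Sp d))
    refine h1.congr fun x => ?_
    exact (Real.fourierInv_eq_fourier_neg _ _).symm
  · rw [propagator_eq_zero h]
    exact continuous_const

theorem inner_evol_toL2 (α β γ s t : ℝ) (f : Sp d → ℂ) (g : L2 d) {g₀ : Sp d → ℂ}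
    (hgg : ⇑g =ᵐ[volume] g₀) (hg : Integrable g₀) :
    (inner ℂ (evol (dispersion α β γ) (continuous_dispersion α β γ) t g)
        (evol (dispersion α β γ) (continuous_dispersion α β γ) s (toL2 f)) : ℂ) =
      ∫ x, starRingEnd ℂ (g₀ x) * propagator α β γ (t - s) f x := by
  by_cases h : Integrable f ∧ Integrable (𝓕 f)
  · refine inner_evol_eq_integral_propagator α β γ s t _ g ?_ hgg h.1 h.2 hg
    rw [toL2, dif_pos h]
    exact MemLp.coeFn_toLp _
  · rw [propagator_eq_zero h, toL2, dif_neg h]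
    simp

theorem decays_evol (hd : 2 ≤ d) {α β γ : ℝ} (hα : α ≠ 0) (hβγ : (β, γ) ≠ (0, 0)) :
    ∃ D : ℝ, 0 < D ∧ Decays (dEff d γ / 2) D
      (evol (d := d) (dispersion α β γ) (continuous_dispersion α β γ)) := by
  obtain ⟨D, hD, hdis⟩ := dispersive hd hα hβγ
  refine ⟨D, hD, fun s f => (norm_evol _ s f).le, continuous_evol _, fun s t f g hst => ?_⟩
  have hpos : 0 < D * |t - s| ^ (-(dEff d γ / 2)) :=
    mul_pos hD (Real.rpow_pos_of_pos (abs_pos.2 (sub_ne_zero.2 hst.symm)) _)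
  by_cases hf0 : f = 0
  · simp [hf0]
  by_cases hg0 : g = 0
  · simp [hg0]
  have hne : ∀ u : L2 d, u ≠ 0 → eLpNorm u 1 volume ≠ 0 := fun u hu h0 => by
    rw [eLpNorm_eq_zero_iff (Lp.aestronglyMeasurable u) one_ne_zero] at h0
    exact hu ((Lp.eq_zero_iff_ae_eq_zero).2 h0)
  have hint : ∀ u : L2 d, eLpNorm u 1 volume ≠ ∞ → Integrable u := fun u hu =>
    memLp_one_iff_integrable.1 ⟨Lp.aestronglyMeasurable u, hu.lt_top⟩
  have hof : ENNReal.ofReal (D * |t - s| ^ (-(dEff d γ / 2))) ≠ 0 := by simpa using hpos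
  by_cases hf : eLpNorm f 1 volume = ∞
  · rw [hf, ENNReal.top_mul (hne g hg0), ENNReal.mul_top hof]
    exact le_top
  by_cases hg : eLpNorm g 1 volume = ∞
  · rw [hg, ENNReal.mul_top (hne f hf0), ENNReal.mul_top hof]
    exact le_top
  have hL1 : ∀ u : L2 d, Integrable u → eLpNorm u 1 volume = ENNReal.ofReal (∫ x, ‖u x‖) :=
    fun u hu => by
      rw [eLpNorm_one_eq_lintegral_enorm, ofReal_integral_norm_eq_lintegral_enorm hu]
  rw [hL1 f (hint f hf), hL1 g (hint g hg), ← ENNReal.ofReal_mul (by positivity),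
    ← ENNReal.ofReal_mul hpos.le, ← ofReal_norm]
  exact ENNReal.ofReal_le_ofReal (hdis s t f g hst (hint f hf) (hint g hg))

end GoodPart

theorem timeNorm_eq_eLpNorm {r : ℝ≥0∞} (hr : r ≠ 0) (g : ℝ → ℝ≥0∞) :
    timeNorm r g = eLpNorm g r volume := by
  by_cases hr' : r = ∞
  · rw [timeNorm, if_pos hr', hr', eLpNorm_exponent_top]
    rfl
  · rw [timeNorm, if_neg hr', eLpNorm_eq_lintegral_rpow_enorm_toReal hr hr']
    simp

/-- The inhomogeneous estimate in terms of interpolation parameters. -/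
theorem eLpNorm_duhamel_le {d : ℕ} (hd : 2 ≤ d) {α β γ : ℝ} (hα : α ≠ 0)
    (hβγ : (β, γ) ≠ (0, 0)) {σ θ₁ θ₂ : ℝ} (hσ : σ = dEff d γ / 2) (hσ0 : 0 < σ) (hσ1 : σ ≠ 1)
    (h0 : 0 ≤ θ₁) (h1 : θ₁ ≤ 1) (hl : σ * θ₁ ≤ 1) (h0' : 0 ≤ θ₂) (h1' : θ₂ ≤ 1)
    (hl' : σ * θ₂ ≤ 1) {p r : ℝ≥0∞}
    (hp : p⁻¹ + (ENNReal.ofReal (2 / (1 + θ₂)))⁻¹ = 1)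
    (hr : r⁻¹ + (ENNReal.ofReal (2 / (2 - σ * θ₂)))⁻¹ = 1) :
    ∃ C : ℝ≥0∞, C ≠ ∞ ∧ ∀ F : ℝ → Sp d → ℂ,
      ∫⁻ τ, eLpNorm (F τ) (ENNReal.ofReal (2 / (1 + θ₁))) volume ^ (2 / (2 - σ * θ₁)) ≠ ∞ →
      eLpNorm (fun t => eLpNorm (duhamel α β γ F t) p volume) r volume ≤
        C * (∫⁻ τ, eLpNorm (F τ) (ENNReal.ofReal (2 / (1 + θ₁))) volume ^ (2 / (2 - σ * θ₁))) ^
          (1 / (2 / (2 - σ * θ₁))) := by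
  subst hσ
  obtain ⟨D, hD, hdec⟩ := decays_evol hd hα hβγ
  obtain ⟨C, hC, hM⟩ := exists_weak_duhamel_majorant hD hσ0 hσ1 h0 h1 hl h0' h1' hl'
  have : Fact ((2 : ℝ≥0∞) ≠ ∞) := ⟨by simp⟩
  refine ⟨C, hC, fun F hF => ?_⟩
  set σ := dEff d γ / 2 with hσ
  set s := 2 / (2 - σ * θ₁) with hs
  have hs0 : 0 < s := by
    have : 0 < 2 - σ * θ₁ := by linarith
    positivity
  set I := ∫⁻ τ, eLpNorm (F τ) (ENNReal.ofReal (2 / (1 + θ₁))) volume ^ s with hI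
  have key : ∀ ε : ℝ≥0∞, ε ≠ 0 →
      eLpNorm (fun t => eLpNorm (duhamel α β γ F t) p volume) r volume ≤
        C * (I + ε) ^ (1 / s) := fun ε hε => by
    obtain ⟨h, hh, hpos, hW, hle⟩ := exists_measurable_weight _ hs0 hF hε
    obtain ⟨M, -, hMr, hMt⟩ := hM hdec hr (fun τ => toL2 (F τ)) hh hpos hW
      fun τ hτ => (eLpNorm_toL2_le _ _).trans hτ
    have hpt : ∀ t, eLpNorm (duhamel α β γ F t) p volume ≤ M t := fun t => by
      have hq : (1 : ℝ) ≤ 2 / (1 + θ₂) := by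
        rw [le_div_iff₀ (by linarith)]
        linarith
      have hcongr : eLpNorm (duhamel α β γ F t) p volume =
          eLpNorm (fun x => ∫ τ in Set.uIoc 0 t, propagator α β γ (t - τ) (F τ) x) p volume :=
        eLpNorm_congr_norm_ae (Eventually.of_forall fun x =>
          intervalIntegral.norm_intervalIntegral_eq _ _ _ _)
      rw [hcongr]
      refine eLpNorm_integral_le (fun τ => continuous_propagator α β γ (t - τ) (F τ)) hq hp
        fun ψ hψ ⟨B, hB⟩ ⟨R, hR⟩ hint => ?_
      have hmem : ∀ e : ℝ≥0∞, MemLp ψ e volume := fun e => by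
        have hfin : IsFiniteMeasure ((volume : Measure (Sp d)).restrict (Metric.closedBall 0 R)) :=
          ⟨by simpa using measure_closedBall_lt_top⟩
        have h1 : MemLp ψ e ((volume : Measure (Sp d)).restrict (Metric.closedBall 0 R)) :=
          MemLp.of_bound hψ.aestronglyMeasurable B (Eventually.of_forall hB)
        rw [← memLp_indicator_iff_restrict Metric.isClosed_closedBall.measurableSet] at h1
        refine h1.ae_eq (Eventually.of_forall fun x => ?_)
        by_cases hx : x ∈ Metric.closedBall (0 : Sp d) R
        · rw [Set.indicator_of_mem hx]
        · rw [Set.indicator_of_notMem hx, hR x (by simpa using hx)]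
      have hae := (hmem 2).coeFn_toLp
      have hψi : Integrable ψ := memLp_one_iff_integrable.1 (hmem 1)
      have hin := fun τ => inner_evol_toL2 α β γ τ t (F τ) ((hmem 2).toLp ψ) hae hψi
      have hb := hMt t ((hmem 2).toLp ψ) (by
        rw [eLpNorm_congr_ae hae]
        exact (hmem _).2.ne)
      simp only [hin, eLpNorm_congr_ae hae] at hb
      have hb' := hb hint
      rwa [← ofReal_norm, intervalIntegral.norm_intervalIntegral_eq,
        ofReal_norm] at hb'
    calc eLpNorm (fun t => eLpNorm (duhamel α β γ F t) p volume) r volume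
        ≤ eLpNorm M r volume := eLpNorm_mono_enorm fun t => by simpa using hpt t
      _ ≤ _ := hMr
      _ ≤ C * (I + ε) ^ (1 / s) := by gcongr
  have hlim : Tendsto (fun n : ℕ => C * (I + (n : ℝ≥0∞)⁻¹) ^ (1 / s)) atTop
      (nhds (C * (I + 0) ^ (1 / s))) := by
    refine ENNReal.Tendsto.const_mul ?_ (Or.inr hC)
    exact (ENNReal.continuous_rpow_const.tendsto _).comp
      (tendsto_const_nhds.add ENNReal.tendsto_inv_nat_nhds_zero)
  rw [add_zero] at hlim
  exact ge_of_tendsto' hlim fun n => key _ (by simp)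

/-- Translation of the admissibility condition into an interpolation parameter. -/
theorem Admissible.exists_param {d : ℕ} {γ σ : ℝ} (hσ : σ = dEff d γ / 2) {p r : ℝ≥0∞}
    (h : Admissible d γ p r) : ∃ θ : ℝ, 0 ≤ θ ∧ θ ≤ 1 ∧ σ * θ ≤ 1 ∧
      p⁻¹ + (ENNReal.ofReal (2 / (1 + θ)))⁻¹ = 1 ∧
      r⁻¹ + (ENNReal.ofReal (2 / (2 - σ * θ)))⁻¹ = 1 := by
  obtain ⟨h2p, h2r, heq⟩ := h
  have key : ∀ {q : ℝ≥0∞}, 2 ≤ q → q⁻¹ ≠ ∞ ∧ (q⁻¹).toReal ≤ 1 / 2 := fun {q} hq => by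
    have h1 : q⁻¹ ≤ 2⁻¹ := ENNReal.inv_le_inv.2 hq
    refine ⟨(h1.trans_lt (by simp)).ne, ?_⟩
    have h2 := ENNReal.toReal_mono (by simp) h1
    simpa using h2
  obtain ⟨hp, hp2⟩ := key h2p
  obtain ⟨hr, hr2⟩ := key h2r
  have hp0 : 0 ≤ (p⁻¹).toReal := ENNReal.toReal_nonneg
  have hr0 : 0 ≤ (r⁻¹).toReal := ENNReal.toReal_nonneg
  have conj : ∀ {q : ℝ≥0∞} {a : ℝ}, q⁻¹ ≠ ∞ → (q⁻¹).toReal ≤ 1 / 2 → (q⁻¹).toReal = 1 - a / 2 →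
      q⁻¹ + (ENNReal.ofReal (2 / a))⁻¹ = 1 := fun {q a} hq hq2 ha => by
    have ha0 : 0 < a := by linarith
    rw [← ENNReal.ofReal_inv_of_pos (by positivity), inv_div, ← ENNReal.ofReal_toReal hq,
      ← ENNReal.ofReal_add ENNReal.toReal_nonneg (by positivity), ha]
    simp
  have hrel : σ * (1 - 2 * (p⁻¹).toReal) = 2 * (r⁻¹).toReal := by
    rw [hσ]
    linarith
  refine ⟨1 - 2 * (p⁻¹).toReal, by linarith, by linarith, by linarith, conj hp hp2 (by ring),
    conj hr hr2 (by rw [hrel]; ring)⟩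

end Strichartz

/-- inhomogeneous Strichartz estimate: for admissible pairs
`(p, r)` and `(p̃', r̃')` (Hölder conjugates of `p̃, r̃`),
`‖∫₀ᵗ W(t-τ)F(τ)dτ‖_{L^r_t L^p_x} ≲ ‖F‖_{L^{r̃}_t L^{p̃}_x}`. -/
theorem stmt6 (d : ℕ) (hd : 2 ≤ d) (α β γ : ℝ) (hα : α ≠ 0) (hβγ : (β, γ) ≠ (0, 0))
    (p r pt rt pt' rt' : ℝ≥0∞)
    (hpc : pt⁻¹ + pt'⁻¹ = 1) (hrc : rt⁻¹ + rt'⁻¹ = 1)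
    (hadm : Admissible d γ p r) (hadm' : Admissible d γ pt' rt') :
    ∃ C : ℝ, 0 < C ∧ ∀ F : ℝ → Sp d → ℂ,
      timeNorm rt (fun t => eLpNorm (F t) pt volume) < ∞ →
      timeNorm r (fun t => eLpNorm (duhamel α β γ F t) p volume) ≤
        ENNReal.ofReal C * timeNorm rt (fun t => eLpNorm (F t) pt volume) := by
  have hd2 : (2 : ℝ) ≤ d := by exact_mod_cast hd
  have hσ : 0 < dEff d γ / 2 ∧ dEff d γ / 2 ≠ 1 := by
    unfold dEff cgam
    split_ifs
    · refine ⟨by norm_num; linarith, fun h => ?_⟩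
      have h1 : (2 * d : ℝ) = 5 := by linarith
      have h2 : 2 * d = 5 := by exact_mod_cast h1
      lia
    · refine ⟨by norm_num; linarith, fun h => ?_⟩
      have h1 : (3 * d : ℝ) = 7 := by linarith
      have h2 : 3 * d = 7 := by exact_mod_cast h1
      lia
  obtain ⟨θ₂, h0', h1', hl', hp, hr⟩ := Strichartz.Admissible.exists_param rfl hadm
  obtain ⟨θ₁, h0, h1, hl, hp', hr'⟩ := Strichartz.Admissible.exists_param rfl hadm'
  have hconj : ∀ {q q' : ℝ≥0∞} {s : ℝ}, 2 ≤ q' → q⁻¹ + q'⁻¹ = 1 →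
      q'⁻¹ + (ENNReal.ofReal s)⁻¹ = 1 → q = ENNReal.ofReal s := fun {q q' s} h2 e1 e2 => by
    have hfin : q'⁻¹ ≠ ∞ := by
      rw [ne_eq, ENNReal.inv_eq_top]
      rintro rfl
      simp at h2
    rw [add_comm, ← e2] at e1
    exact inv_injective ((ENNReal.add_right_inj hfin).1 e1)
  have hpt := hconj hadm'.1 hpc hp'
  have hrt := hconj hadm'.2.1 hrc hr'
  have hr0 : r ≠ 0 := by
    rintro rfl
    simpa using hadm.2.1
  have hs : 0 < 2 / (2 - dEff d γ / 2 * θ₁) := div_pos two_pos (by linarith)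
  obtain ⟨C, hC, hbd⟩ := Strichartz.eLpNorm_duhamel_le hd hα hβγ rfl hσ.1 hσ.2 h0 h1 hl h0' h1'
    hl' hp hr
  refine ⟨C.toReal + 1, by positivity, fun F hF => ?_⟩
  have hN : timeNorm rt (fun t => eLpNorm (F t) pt volume) =
      (∫⁻ τ, eLpNorm (F τ) (ENNReal.ofReal (2 / (1 + θ₁))) volume ^
        (2 / (2 - dEff d γ / 2 * θ₁))) ^ (1 / (2 / (2 - dEff d γ / 2 * θ₁))) := by
    rw [hpt, hrt, timeNorm, if_neg ENNReal.ofReal_ne_top, ENNReal.toReal_ofReal hs.le]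
  rw [hN] at hF ⊢
  rw [Strichartz.timeNorm_eq_eLpNorm hr0]
  refine (hbd F fun h => ?_).trans ?_
  · rw [h, ENNReal.top_rpow_of_pos (by positivity)] at hF
    exact lt_irrefl _ hF
  · refine mul_le_mul' ?_ le_rfl
    rw [← ENNReal.ofReal_toReal hC, ENNReal.toReal_ofReal ENNReal.toReal_nonneg]
    exact ENNReal.ofReal_le_ofReal (by linarith)
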